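/- Let ω be a radial weight in the class D̂ and let 1<p<∞, 1<q<∞, with p'=p/(p−1) and q'=q/(q−1). Then (A^{p,q}_ω)* ≃ A^{p',q'}_ω under the A²_ω-pairing with equivalence of norms: there exist constants C₁,C₂>0 (depending only on p,q,ω) such that (a) for every g∈A^{p',q'}_ω and every f∈A^{p,q}_ω the limit defining ⟨f,g⟩_{A²_ω} exists and L_g(f)=⟨f,g⟩_{A²_ω} defines a bounded linear functional on A^{p,q}_ω with ‖L_g‖ ≤ C₂‖g‖_{A^{p',q'}_ω}, and (b) every bounded linear functional L on A^{p,q}_ω equals L_g for some g∈A^{p',q'}_ω with ‖g‖_{A^{p',q'}_ω} ≤ C₁‖L‖. -/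

import Mathlib

open MeasureTheory Filter Set
open scoped ENNReal

noncomputable section

/-- `ω̂(r) = ∫_r^1 ω(s) ds`. -/
def omegaHat (ω : ℝ → ℝ) (r : ℝ) : ℝ := ∫ s in r..1, ω s

/-- A radial weight: nonnegative and Lebesgue integrable on `[0,1)`. -/
def IsRadialWeight (ω : ℝ → ℝ) : Prop :=
  (∀ r ∈ Set.Ico (0:ℝ) 1, 0 ≤ ω r) ∧ MeasureTheory.IntegrableOn ω (Set.Ico 0 1)

/-- The class `D̂` of upper doubling radial weights. -/
def InDhat (ω : ℝ → ℝ) : Prop :=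
  ∃ C > (0:ℝ), ∀ r ∈ Set.Ico (0:ℝ) 1, omegaHat ω r ≤ C * omegaHat ω ((1 + r) / 2)

/-- The class `Ď`. -/
def InDcheck (ω : ℝ → ℝ) : Prop :=
  ∃ K > (1:ℝ), ∃ C > (1:ℝ), ∀ r ∈ Set.Ico (0:ℝ) 1,
    C * omegaHat ω (1 - (1 - r) / K) ≤ omegaHat ω r

/-- Moments `μ_x = ∫_0^1 r^x μ(r) dr`. -/
def momentW (μ : ℝ → ℝ) (x : ℝ) : ℝ := ∫ r in (0:ℝ)..1, r ^ x * μ r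

/-- The coefficients `μ_{2k+1}` of the `A²_μ` pairing. -/
def momentCoeff (μ : ℝ → ℝ) : ℕ → ℝ := fun k => momentW μ (2 * (k:ℝ) + 1)

/-- The point `r e^{iθ}` of the circle of radius `r`. -/
def circlePt (r θ : ℝ) : ℂ := (r:ℂ) * Complex.exp ((θ:ℂ) * Complex.I)

/-- Integral means `M_p(r,f)` (with values in `[0,∞]`). -/
def MpE (p r : ℝ) (f : ℂ → ℂ) : ℝ≥0∞ :=
  (ENNReal.ofReal (1 / (2 * Real.pi)) *
    ∫⁻ θ in Set.Ioo (0:ℝ) (2 * Real.pi), ENNReal.ofReal (‖f (circlePt r θ)‖ ^ p)) ^ (1 / p)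

/-- Integral means of a `[0,∞]`-valued function. -/
def MpEE (p r : ℝ) (F : ℂ → ℝ≥0∞) : ℝ≥0∞ :=
  (ENNReal.ofReal (1 / (2 * Real.pi)) *
    ∫⁻ θ in Set.Ioo (0:ℝ) (2 * Real.pi), (F (circlePt r θ)) ^ p) ^ (1 / p)

/-- The norm of the mixed norm space `L^{p,q}_ω`. -/
def LpqNormE (ω : ℝ → ℝ) (p q : ℝ) (f : ℂ → ℂ) : ℝ≥0∞ :=
  (∫⁻ r in Set.Ioo (0:ℝ) 1, (MpE p r f) ^ q * ENNReal.ofReal (r * ω r)) ^ (1 / q)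

/-- The `L^{p,q}_ω` norm of a `[0,∞]`-valued function. -/
def LpqNormEE (ω : ℝ → ℝ) (p q : ℝ) (F : ℂ → ℝ≥0∞) : ℝ≥0∞ :=
  (∫⁻ r in Set.Ioo (0:ℝ) 1, (MpEE p r F) ^ q * ENNReal.ofReal (r * ω r)) ^ (1 / q)

/-- The norm of `A^{p,∞}_ω` : `sup_{0 ≤ r < 1} M_p(r,f) ω̂(r)`. -/
def ApInfNormE (ω : ℝ → ℝ) (p : ℝ) (f : ℂ → ℂ) : ℝ≥0∞ :=
  ⨆ r ∈ Set.Ico (0:ℝ) 1, MpE p r f * ENNReal.ofReal (omegaHat ω r)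

/-- Membership in the mixed norm space `A^{p,q}_ω`. -/
def InApq (ω : ℝ → ℝ) (p q : ℝ) (f : ℂ → ℂ) : Prop :=
  DifferentiableOn ℂ f (Metric.ball 0 1) ∧ LpqNormE ω p q f < ⊤

/-- Membership in `A^{p,∞}_ω`. -/
def InApInf (ω : ℝ → ℝ) (p : ℝ) (f : ℂ → ℂ) : Prop :=
  DifferentiableOn ℂ f (Metric.ball 0 1) ∧ ApInfNormE ω p f < ⊤

/-- Taylor coefficient of `f` at `0`. -/
def taylorCoeff (f : ℂ → ℂ) (n : ℕ) : ℂ := iteratedDeriv n f 0 / (n.factorial : ℂ)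

/-- The pairing `⟨f,g⟩ = lim_{r→1⁻} ∑_k f̂(k) conj(ĝ(k)) c(k) r^k` exists and equals `l`. -/
def HasPairingC (c : ℕ → ℝ) (f g : ℂ → ℂ) (l : ℂ) : Prop :=
  (∀ r ∈ Set.Ico (0:ℝ) 1, Summable (fun k : ℕ =>
    taylorCoeff f k * (starRingEnd ℂ) (taylorCoeff g k) * ((c k : ℝ) : ℂ) * ((r:ℂ)) ^ k)) ∧
  Filter.Tendsto (fun r : ℝ => ∑' k : ℕ,
    taylorCoeff f k * (starRingEnd ℂ) (taylorCoeff g k) * ((c k : ℝ) : ℂ) * ((r:ℂ)) ^ k)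
    (nhdsWithin 1 (Set.Iio 1)) (nhds l)

/-- `L` is linear on the functions satisfying `P`. -/
def IsLinearOn (P : (ℂ → ℂ) → Prop) (L : (ℂ → ℂ) → ℂ) : Prop :=
  (∀ f g : ℂ → ℂ, P f → P g → L (f + g) = L f + L g) ∧
  (∀ (c : ℂ) (f : ℂ → ℂ), P f → L (c • f) = c * L f)

/-- Dilation `f_r(z) = f(rz)`. -/
def dilateF (f : ℂ → ℂ) (r : ℝ) : ℂ → ℂ := fun z => f ((r:ℂ) * z)

/-- The BMOA norm `|f(0)| + sup_{a∈D} sup_{0<r<1} M₂(r, f∘φ_a - f(a))`. -/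
def BMOANormE (f : ℂ → ℂ) : ℝ≥0∞ :=
  ENNReal.ofReal ‖f 0‖ +
    ⨆ a ∈ Metric.ball (0:ℂ) 1, ⨆ r ∈ Set.Ioo (0:ℝ) 1,
      MpE 2 r (fun z => f ((a - z) / (1 - (starRingEnd ℂ) a * z)) - f a)

/-- The Bloch norm `|f(0)| + sup_{z∈D} (1-|z|²)|f'(z)|`. -/
def BlochNormE (f : ℂ → ℂ) : ℝ≥0∞ :=
  ENNReal.ofReal ‖f 0‖ +
    ⨆ z ∈ Metric.ball (0:ℂ) 1, ENNReal.ofReal ((1 - ‖z‖ ^ 2) * ‖deriv f z‖)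

/-- The norm of `X(q,ω)`: `(∫_0^1 ‖f_r‖_X^q ω(r) dr)^{1/q}`. -/
def XqNormE (Xnorm : (ℂ → ℂ) → ℝ≥0∞) (ω : ℝ → ℝ) (q : ℝ) (f : ℂ → ℂ) : ℝ≥0∞ :=
  (∫⁻ r in Set.Ioo (0:ℝ) 1, (Xnorm (dilateF f r)) ^ q * ENNReal.ofReal (ω r)) ^ (1 / q)

/-- The norm of `X(∞,ω)`: `sup_{0<r<1} ‖f_r‖_X ω̂(r)`. -/
def XInfNormE (Xnorm : (ℂ → ℂ) → ℝ≥0∞) (ω : ℝ → ℝ) (f : ℂ → ℂ) : ℝ≥0∞ :=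
  ⨆ r ∈ Set.Ioo (0:ℝ) 1, Xnorm (dilateF f r) * ENNReal.ofReal (omegaHat ω r)

/-- The standard radial weight `ν_β(r) = (β+1)(1-r²)^β`. -/
def nuWeight (β : ℝ) : ℝ → ℝ := fun r => (β + 1) * (1 - r ^ 2) ^ β

/-- The Bergman reproducing kernel `B^ω_a(z) = ∑ (z conj a)^n / (2 ω_{2n+1})`. -/
def bergmanKernel (ω : ℝ → ℝ) (a z : ℂ) : ℂ :=
  ∑' n : ℕ, (z * (starRingEnd ℂ) a) ^ n / (2 * ((momentW ω (2 * (n:ℝ) + 1) : ℝ) : ℂ))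

/-- The Bergman projection (`dA` is normalized area measure). -/
def PomegaProj (ω : ℝ → ℝ) (f : ℂ → ℂ) (z : ℂ) : ℂ :=
  (Real.pi)⁻¹ • ∫ ζ in Metric.ball (0:ℂ) 1,
    f ζ * (starRingEnd ℂ) (bergmanKernel ω z ζ) * ((ω ‖ζ‖ : ℝ) : ℂ)

/-- The maximal Bergman projection applied to `|f|`, with values in `[0,∞]`. -/
def PomegaPlusL (ω : ℝ → ℝ) (f : ℂ → ℂ) (z : ℂ) : ℝ≥0∞ :=
  ∫⁻ ζ in Metric.ball (0:ℂ) 1,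
    ENNReal.ofReal (‖f ζ‖ * ‖bergmanKernel ω z ζ‖ * ω ‖ζ‖ / Real.pi)

/-- The Hardy `H¹` norm. -/
def H1NormE (f : ℂ → ℂ) : ℝ≥0∞ := ⨆ r ∈ Set.Ioo (0:ℝ) 1, MpE 1 r f

/-- `r_n = inf{ r ∈ [0,1) : ω̂(r) = ω̂(0) K^{-n} }`. -/
def rSeq (ω : ℝ → ℝ) (K : ℝ) (n : ℕ) : ℝ :=
  sInf {r | r ∈ Set.Ico (0:ℝ) 1 ∧ omegaHat ω r = omegaHat ω 0 * K ^ (-(n:ℝ))}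

/-- `M_n = ⌊1/(1-r_n)⌋`. -/
def MSeq (ω : ℝ → ℝ) (K : ℝ) (n : ℕ) : ℕ := ⌊1 / (1 - rSeq ω K n)⌋₊

/-- Weighted Hadamard product of a polynomial with an analytic function:
`z ↦ ∑_j c(j) P̂(j) ĝ(j) z^j`. -/
def hadamardPolyC (c : ℕ → ℂ) (P : Polynomial ℂ) (g : ℂ → ℂ) : ℂ → ℂ :=
  fun z => ∑ j ∈ Finset.range (P.natDegree + 1), c j * P.coeff j * taylorCoeff g j * z ^ j

/-- An admissible Banach space of analytic functions on the unit disc, given by a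
carrier set and a norm function. -/
structure AdmissibleSpace where
  carrier : Set (ℂ → ℂ)
  nrm : (ℂ → ℂ) → ℝ
  mem_analytic : ∀ f ∈ carrier, DifferentiableOn ℂ f (Metric.ball 0 1)
  zero_mem : (0 : ℂ → ℂ) ∈ carrier
  add_mem : ∀ f g : ℂ → ℂ, f ∈ carrier → g ∈ carrier → f + g ∈ carrier
  smul_mem : ∀ (c : ℂ) (f : ℂ → ℂ), f ∈ carrier → c • f ∈ carrier
  nrm_nonneg : ∀ f ∈ carrier, 0 ≤ nrm f
  nrm_eq_zero : ∀ f ∈ carrier, nrm f = 0 → ∀ z ∈ Metric.ball (0:ℂ) 1, f z = 0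
  nrm_add : ∀ f g : ℂ → ℂ, f ∈ carrier → g ∈ carrier → nrm (f + g) ≤ nrm f + nrm g
  nrm_smul : ∀ (c : ℂ) (f : ℂ → ℂ), f ∈ carrier → nrm (c • f) = ‖c‖ * nrm f
  complete : ∀ u : ℕ → (ℂ → ℂ), (∀ n, u n ∈ carrier) →
    (∀ ε : ℝ, 0 < ε → ∃ N : ℕ, ∀ m ≥ N, ∀ n ≥ N, nrm (u m - u n) < ε) →
    ∃ f ∈ carrier, Filter.Tendsto (fun n => nrm (u n - f)) Filter.atTop (nhds 0)
  norm_conv_implies_ucc : ∀ (u : ℕ → (ℂ → ℂ)) (f : ℂ → ℂ),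
    (∀ n, u n ∈ carrier) → f ∈ carrier →
    Filter.Tendsto (fun n => nrm (u n - f)) Filter.atTop (nhds 0) →
    ∀ Kc : Set ℂ, Kc ⊆ Metric.ball 0 1 → IsCompact Kc →
      TendstoUniformlyOn (fun n => u n) f Filter.atTop Kc
  ucc_implies_norm_conv : ∀ R : ℝ, 1 < R → ∀ (u : ℕ → (ℂ → ℂ)) (f : ℂ → ℂ),
    (∀ n, u n ∈ carrier ∧ DifferentiableOn ℂ (u n) (Metric.ball 0 R)) →
    DifferentiableOn ℂ f (Metric.ball 0 R) →
    (∀ Kc : Set ℂ, Kc ⊆ Metric.ball (0:ℂ) R → IsCompact Kc →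
      TendstoUniformlyOn (fun n => u n) f Filter.atTop Kc) →
    f ∈ carrier ∧ Filter.Tendsto (fun n => nrm (u n - f)) Filter.atTop (nhds 0)
  dilation_bound : ∃ C > (0:ℝ), ∀ f ∈ carrier, ∀ ζ : ℂ, ‖ζ‖ ≤ 1 →
    (fun z => f (ζ * z)) ∈ carrier ∧ nrm (fun z => f (ζ * z)) ≤ C * nrm f

/-- The operator `T_p = I^{ν_{1/p-2}}`. -/
def TpOp (p : ℝ) (g : ℂ → ℂ) : ℂ → ℂ :=
  fun z => ∑' k : ℕ,
    taylorCoeff g k * ((momentW (nuWeight (1 / p - 2)) (2 * (k:ℝ) + 1) : ℝ) : ℂ) * z ^ k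

/-- Membership in the Bloch space. -/
def InBloch (g : ℂ → ℂ) : Prop :=
  DifferentiableOn ℂ g (Metric.ball 0 1) ∧ BlochNormE g < ⊤

open Classical in
/-- The norm of the space `X_p = T_p(B)`, normed so that `T_p` is an isometry. -/
def XpNormE (p : ℝ) (h : ℂ → ℂ) : ℝ≥0∞ :=
  if H : ∃ g : ℂ → ℂ, InBloch g ∧ Set.EqOn h (TpOp p g) (Metric.ball 0 1)
  then BlochNormE H.choose else ⊤

/-- The polynomial `V_n ∗ g` where `V_n(z) = ∑_{j=2^{n-1}}^{2^{n+1}-1} ψ(j/2^{n-1}) z^j`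
and `ψ(t) = Ψ(t/2) - Ψ(t)`. -/
def VnStar (Ψ : ℝ → ℝ) (n : ℕ) (g : ℂ → ℂ) : ℂ → ℂ :=
  fun z => ∑ j ∈ Finset.Icc (2 ^ (n - 1) : ℕ) (2 ^ (n + 1) - 1 : ℕ),
    (((Ψ ((j:ℝ) / 2 ^ n) - Ψ ((j:ℝ) / 2 ^ (n - 1))) : ℝ) : ℂ) * taylorCoeff g j * z ^ j

/-- `D^ω(V_n ∗ g)`, where `D^ω h(z) = ∑ ĥ(k) z^k/(2ω_{2k+1})`. -/
def DVnStar (Ψ : ℝ → ℝ) (ω : ℝ → ℝ) (n : ℕ) (g : ℂ → ℂ) : ℂ → ℂ :=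
  fun z => ∑ j ∈ Finset.Icc (2 ^ (n - 1) : ℕ) (2 ^ (n + 1) - 1 : ℕ),
    (((Ψ ((j:ℝ) / 2 ^ n) - Ψ ((j:ℝ) / 2 ^ (n - 1))) : ℝ) : ℂ) * taylorCoeff g j * z ^ j /
      (2 * ((momentW ω (2 * (j:ℝ) + 1) : ℝ) : ℂ))

/-- `J_ω(t) = ∫_0^t ds/(ω̂(s)(1-s))`. -/
def Jomega (ω : ℝ → ℝ) (t : ℝ) : ℝ := ∫ s in (0:ℝ)..t, 1 / (omegaHat ω s * (1 - s))


/-- Normalized Lebesgue measure on one period of the circle. -/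
def circMeas : Measure ℝ :=
  ENNReal.ofReal (1 / (2 * Real.pi)) • volume.restrict (Set.Ioo (0:ℝ) (2 * Real.pi))

/-- The point `e^{iθ}`. -/
def ex (θ : ℝ) : ℂ := Complex.exp ((θ:ℂ) * Complex.I)

@[fun_prop]
lemma continuous_ex : Continuous ex := by unfold ex; fun_prop

@[simp]
lemma norm_ex (θ : ℝ) : ‖ex θ‖ = 1 := by simp [ex, Complex.norm_exp]

lemma circlePt_eq (r θ : ℝ) : circlePt r θ = (r:ℂ) * ex θ := rfl

lemma conj_ex_mul_ex (θ : ℝ) : (starRingEnd ℂ) (ex θ) * ex θ = 1 := by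
  rw [mul_comm, Complex.mul_conj, Complex.normSq_eq_norm_sq]; simp

lemma norm_circlePt {r : ℝ} (hr : 0 ≤ r) (θ : ℝ) : ‖circlePt r θ‖ = r := by
  simp [circlePt_eq, abs_of_nonneg hr]

instance : IsProbabilityMeasure circMeas := by
  constructor
  rw [circMeas, Measure.smul_apply, Measure.restrict_apply_univ, Real.volume_Ioo, smul_eq_mul,
    ← ENNReal.ofReal_mul (by positivity), sub_zero,
    one_div_mul_cancel (by positivity), ENNReal.ofReal_one]

lemma integral_circMeas {E : Type*} [NormedAddCommGroup E] [NormedSpace ℝ E] (u : ℝ → E) :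
    ∫ θ, u θ ∂circMeas = (2 * Real.pi)⁻¹ • ∫ θ in (0:ℝ)..(2 * Real.pi), u θ := by
  rw [circMeas, integral_smul_measure, intervalIntegral.integral_of_le (by positivity),
    integral_Ioc_eq_integral_Ioo, ENNReal.toReal_ofReal (by positivity), one_div]

lemma Continuous.integrable_circMeas {E : Type*} [NormedAddCommGroup E] {u : ℝ → E}
    (hu : Continuous u) : Integrable u circMeas := by
  refine Integrable.smul_measure ?_ ENNReal.ofReal_ne_top
  exact (hu.continuousOn.integrableOn_Icc (a := 0) (b := 2 * Real.pi)).mono_set Ioo_subset_Icc_self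

lemma Continuous.memLp_circMeas {E : Type*} [NormedAddCommGroup E] [SecondCountableTopology E]
    {u : ℝ → E} (hu : Continuous u) (p : ℝ≥0∞) : MemLp u p circMeas := by
  obtain ⟨C, hC⟩ := (isCompact_Icc (a := (0:ℝ)) (b := 2 * Real.pi)).exists_bound_of_continuousOn
    hu.continuousOn
  refine MemLp.of_bound hu.aestronglyMeasurable C ?_
  refine Measure.ae_smul_measure ?_ _
  filter_upwards [ae_restrict_mem measurableSet_Ioo] with θ hθ
  exact hC θ ⟨hθ.1.le, hθ.2.le⟩

/-- The `L^p` norm on the circle. -/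
def nrm (p : ℝ) (u : ℝ → ℂ) : ℝ := (∫ θ, ‖u θ‖ ^ p ∂circMeas) ^ (1 / p)

lemma nrm_nonneg (p : ℝ) (u : ℝ → ℂ) : 0 ≤ nrm p u := by
  unfold nrm; positivity

lemma nrm_rpow {p : ℝ} (hp : 0 < p) (u : ℝ → ℂ) : nrm p u ^ p = ∫ θ, ‖u θ‖ ^ p ∂circMeas := by
  unfold nrm
  rw [← Real.rpow_mul (by positivity), one_div_mul_cancel hp.ne', Real.rpow_one]

lemma nrm_congr {p : ℝ} {u v : ℝ → ℂ} (h : ∀ θ, ‖u θ‖ = ‖v θ‖) : nrm p u = nrm p v := by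
  simp [nrm, h]

lemma continuous_norm_rpow {p : ℝ} (hp : 0 < p) {u : ℝ → ℂ} (hu : Continuous u) :
    Continuous (fun θ => ‖u θ‖ ^ p) :=
  hu.norm.rpow_const (fun _ => Or.inr hp.le)

lemma nrm_mono {p : ℝ} (hp : 0 < p) {u v : ℝ → ℂ} (hu : Continuous u) (hv : Continuous v)
    (h : ∀ θ, ‖u θ‖ ≤ ‖v θ‖) : nrm p u ≤ nrm p v := by
  unfold nrm
  refine Real.rpow_le_rpow (by positivity) ?_ (by positivity)
  refine integral_mono (continuous_norm_rpow hp hu).integrable_circMeas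
    (continuous_norm_rpow hp hv).integrable_circMeas fun θ => ?_
  exact Real.rpow_le_rpow (norm_nonneg _) (h θ) hp.le

lemma nrm_le_of_bound {p : ℝ} (hp : 0 < p) {u : ℝ → ℂ} (hu : Continuous u) {B : ℝ} (hB : 0 ≤ B)
    (h : ∀ θ, ‖u θ‖ ≤ B) : nrm p u ≤ B := by
  refine (nrm_mono hp (v := fun _ => (B:ℂ)) hu continuous_const
    (fun θ => by simpa [abs_of_nonneg hB] using h θ)).trans (le_of_eq ?_)
  simp only [nrm, Complex.norm_real, Real.norm_eq_abs, abs_of_nonneg hB, integral_const,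
    probReal_univ, one_smul]
  rw [← Real.rpow_mul hB, mul_one_div_cancel hp.ne', Real.rpow_one]

lemma nrm_const_mul {p : ℝ} (hp : 0 < p) (c : ℂ) (u : ℝ → ℂ) :
    nrm p (fun θ => c * u θ) = ‖c‖ * nrm p u := by
  unfold nrm
  have : ∀ θ, ‖c * u θ‖ ^ p = ‖c‖ ^ p * ‖u θ‖ ^ p := fun θ => by
    rw [norm_mul, Real.mul_rpow (norm_nonneg _) (norm_nonneg _)]
  simp_rw [this]
  rw [integral_const_mul, Real.mul_rpow (by positivity) (by positivity),
    ← Real.rpow_mul (norm_nonneg _), mul_one_div_cancel hp.ne', Real.rpow_one]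

/-- Hölder's inequality on the circle. -/
lemma norm_integral_mul_conj_le {p p' : ℝ} (h : p.HolderConjugate p') {u v : ℝ → ℂ}
    (hu : Continuous u) (hv : Continuous v) :
    ‖∫ θ, u θ * (starRingEnd ℂ) (v θ) ∂circMeas‖ ≤ nrm p u * nrm p' v := by
  refine (norm_integral_le_integral_norm _).trans ?_
  simp only [norm_mul, RCLike.norm_conj]
  exact integral_mul_norm_le_Lp_mul_Lq h (hu.memLp_circMeas _) (hv.memLp_circMeas _)

/-- Fourier coefficients. -/
def fcoef (u : ℝ → ℂ) (k : ℕ) : ℂ := ∫ θ, (starRingEnd ℂ) (ex θ) ^ k * u θ ∂circMeas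

lemma norm_fcoef_le {p p' : ℝ} (h : p.HolderConjugate p') {u : ℝ → ℂ} (hu : Continuous u)
    (k : ℕ) : ‖fcoef u k‖ ≤ nrm p u := by
  have := norm_integral_mul_conj_le h hu (v := fun θ => ex θ ^ k) (by fun_prop)
  have h1 : nrm p' (fun θ => ex θ ^ k) ≤ 1 :=
    nrm_le_of_bound h.symm.pos (by fun_prop) zero_le_one (by simp)
  unfold fcoef
  simp only [map_pow, mul_comm (u _)] at this
  exact this.trans (mul_le_of_le_one_right (nrm_nonneg _ _) h1)

/-- Integrating an absolutely convergent series of unimodular terms against a continuous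
function. -/
lemma hasSum_integral_series {c : ℕ → ℂ} (hc : Summable fun k => ‖c k‖) {φ : ℕ → ℝ → ℂ}
    (hφ : ∀ k, Continuous (φ k)) (h1 : ∀ k θ, ‖φ k θ‖ ≤ 1) {u : ℝ → ℂ} (hu : Continuous u) :
    HasSum (fun k => c k * ∫ θ, φ k θ * u θ ∂circMeas)
      (∫ θ, (∑' k, c k * φ k θ) * u θ ∂circMeas) := by
  have hs := hasSum_integral_of_summable_integral_norm (μ := circMeas)
    (F := fun k θ => c k * φ k θ * u θ)
    (fun k => ((continuous_const.mul (hφ k)).mul hu).integrable_circMeas) ?_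
  · simp_rw [← integral_const_mul, ← mul_assoc, ← tsum_mul_right]
    exact hs
  · refine Summable.of_nonneg_of_le (fun k => by positivity) (fun k => ?_)
      (hc.mul_right (∫ θ, ‖u θ‖ ∂circMeas))
    rw [← integral_const_mul]
    refine integral_mono ((continuous_const.mul (hφ k)).mul hu).norm.integrable_circMeas
      (continuous_const.mul hu.norm).integrable_circMeas fun θ => ?_
    simp only [norm_mul]
    gcongr
    exact mul_le_of_le_one_right (norm_nonneg _) (h1 k θ)

lemma integral_circMeas_conj (u : ℝ → ℂ) :
    ∫ θ, (starRingEnd ℂ) (u θ) ∂circMeas = (starRingEnd ℂ) (∫ θ, u θ ∂circMeas) := integral_conj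

/-- Pairing an absolutely convergent Fourier series with a continuous function. -/
lemma hasSum_pairing {c : ℕ → ℂ} (hc : Summable fun k => ‖c k‖) {v : ℝ → ℂ}
    (hv : Continuous v) :
    HasSum (fun k => c k * (starRingEnd ℂ) (fcoef v k))
      (∫ θ, (∑' k, c k * ex θ ^ k) * (starRingEnd ℂ) (v θ) ∂circMeas) := by
  have := hasSum_integral_series hc (φ := fun k θ => ex θ ^ k) (by fun_prop) (by simp)
    (u := fun θ => (starRingEnd ℂ) (v θ)) (by fun_prop)
  convert this using 3
  rw [fcoef, ← integral_circMeas_conj]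
  simp

/-- Mean value property. -/
lemma integral_circMeas_analytic {F : ℂ → ℂ} (hF : DifferentiableOn ℂ F (Metric.ball 0 1))
    {ρ : ℝ} (h0 : 0 ≤ ρ) (h1 : ρ < 1) : ∫ θ, F (ρ * ex θ) ∂circMeas = F 0 := by
  have : DiffContOnCl ℂ F (Metric.ball 0 |ρ|) := by
    rw [abs_of_nonneg h0]
    exact (hF.mono (Metric.closedBall_subset_ball h1)).diffContOnCl_ball subset_rfl
  have := this.circleAverage
  rw [Real.circleAverage_def] at this
  rw [integral_circMeas, ← this]
  simp [circleMap, ex]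

lemma integral_ex_pow (k : ℕ) : ∫ θ, ex θ ^ k ∂circMeas = if k = 0 then 1 else 0 := by
  have h := integral_circMeas_analytic (F := fun z => (2 * z) ^ k) (ρ := 1/2)
    (by fun_prop) (by norm_num) (by norm_num)
  simp only [Complex.ofReal_div, Complex.ofReal_one, Complex.ofReal_ofNat] at h
  rcases eq_or_ne k 0 with rfl | hk
  · simp
  · simpa [hk, ← mul_assoc] using h

lemma fcoef_ex_pow (n k : ℕ) : fcoef (fun θ => ex θ ^ n) k = if k = n then 1 else 0 := by
  unfold fcoef
  rcases le_total k n with h | h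
  · obtain ⟨m, rfl⟩ := Nat.exists_eq_add_of_le h
    simp_rw [pow_add, ← mul_assoc, ← mul_pow, conj_ex_mul_ex, one_pow, one_mul]
    rw [integral_ex_pow]; simp
  · obtain ⟨m, rfl⟩ := Nat.exists_eq_add_of_le h
    have : ∀ θ, (starRingEnd ℂ) (ex θ) ^ (n + m) * ex θ ^ n = (starRingEnd ℂ) (ex θ ^ m) := by
      intro θ
      rw [pow_add, mul_right_comm, ← mul_pow, conj_ex_mul_ex, one_pow, one_mul, map_pow]
    simp_rw [this]
    rw [integral_circMeas_conj, integral_ex_pow]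
    split_ifs <;> simp_all

lemma continuous_series {c : ℕ → ℂ} (hc : Summable fun k => ‖c k‖) :
    Continuous fun θ => ∑' k, c k * ex θ ^ k :=
  continuous_tsum (fun k => by fun_prop) hc (fun k θ => by simp)

lemma fcoef_series {c : ℕ → ℂ} (hc : Summable fun k => ‖c k‖) (n : ℕ) :
    fcoef (fun θ => ∑' k, c k * ex θ ^ k) n = c n := by
  have h := hasSum_pairing hc (v := fun θ => ex θ ^ n) (by fun_prop)
  simp only [fcoef_ex_pow] at h
  have h2 := hasSum_single (f := fun k => c k * (starRingEnd ℂ) (if k = n then (1:ℂ) else 0)) n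
    (fun b hb => by simp [hb])
  have := h.unique h2
  simp only [if_true, map_one, mul_one] at this
  rw [← this, fcoef]
  simp only [map_pow, mul_comm]

/-- The series with coefficients of subexponential growth. -/
lemma differentiableOn_powerSeries {b : ℕ → ℂ}
    (hb : ∀ x : ℝ, 0 ≤ x → x < 1 → Summable fun k => ‖b k‖ * x ^ k) :
    DifferentiableOn ℂ (fun z => ∑' k, b k * z ^ k) (Metric.ball 0 1) := by
  intro z hz
  rw [mem_ball_zero_iff] at hz
  obtain ⟨x, hx1, hx2⟩ := exists_between hz
  have hx0 : 0 ≤ x := (norm_nonneg _).trans hx1.le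
  have := Complex.differentiableOn_tsum_of_summable_norm (hb x hx0 hx2)
    (F := fun k z => b k * z ^ k) (U := Metric.ball 0 x) (fun k => by fun_prop)
    Metric.isOpen_ball (fun k w hw => by
      rw [mem_ball_zero_iff] at hw
      rw [norm_mul, norm_pow]
      gcongr)
  exact (this.differentiableAt (Metric.isOpen_ball.mem_nhds (by simpa using hx1))).differentiableWithinAt

lemma hasSum_taylorCoeff {f : ℂ → ℂ} (hf : DifferentiableOn ℂ f (Metric.ball 0 1)) {z : ℂ}
    (hz : ‖z‖ < 1) : HasSum (fun k => taylorCoeff f k * z ^ k) (f z) := by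
  have := Complex.hasSum_taylorSeries_on_ball (c := 0) (r := 1) (by simpa using hf)
    (z := z) (by simpa using hz)
  refine this.congr_fun fun k => ?_
  simp only [taylorCoeff, sub_zero, smul_eq_mul]
  ring

lemma summable_taylorCoeff {f : ℂ → ℂ} (hf : DifferentiableOn ℂ f (Metric.ball 0 1)) {x : ℝ}
    (h0 : 0 ≤ x) (h1 : x < 1) : Summable (fun k => ‖taylorCoeff f k‖ * x ^ k) := by
  have := (hasSum_taylorCoeff hf (z := (x:ℂ)) (by simpa [abs_of_nonneg h0] using h1)).summable.norm
  simpa [abs_of_nonneg h0] using this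

lemma continuous_circlePt_comp {f : ℂ → ℂ} (hf : DifferentiableOn ℂ f (Metric.ball 0 1)) {r : ℝ}
    (h0 : 0 ≤ r) (h1 : r < 1) : Continuous fun θ => f (circlePt r θ) := by
  refine hf.continuousOn.comp_continuous ?_ fun θ => ?_
  · change Continuous fun θ => (r:ℂ) * ex θ
    fun_prop
  · rwa [mem_ball_zero_iff, norm_circlePt h0]

lemma circle_series {f : ℂ → ℂ} (hf : DifferentiableOn ℂ f (Metric.ball 0 1)) {r : ℝ}
    (h0 : 0 ≤ r) (h1 : r < 1) (θ : ℝ) :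
    f (circlePt r θ) = ∑' k, taylorCoeff f k * r ^ k * ex θ ^ k := by
  rw [← (hasSum_taylorCoeff hf (z := circlePt r θ) (by rwa [norm_circlePt h0])).tsum_eq]
  refine tsum_congr fun k => ?_
  rw [circlePt_eq, mul_pow, mul_assoc]

lemma summable_taylorCoeff_mul_pow {f : ℂ → ℂ} (hf : DifferentiableOn ℂ f (Metric.ball 0 1))
    {x : ℝ} (h0 : 0 ≤ x) (h1 : x < 1) : Summable (fun k => ‖taylorCoeff f k * (x:ℂ) ^ k‖) := by
  simpa [abs_of_nonneg h0] using summable_taylorCoeff hf h0 h1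

lemma fcoef_circle {f : ℂ → ℂ} (hf : DifferentiableOn ℂ f (Metric.ball 0 1)) {r : ℝ}
    (h0 : 0 ≤ r) (h1 : r < 1) (k : ℕ) :
    fcoef (fun θ => f (circlePt r θ)) k = taylorCoeff f k * r ^ k := by
  rw [← fcoef_series (summable_taylorCoeff_mul_pow hf h0 h1) k]
  congr 1; funext θ; exact circle_series hf h0 h1 θ

/-- A power series is its own Taylor series. -/
lemma taylorCoeff_powerSeries {b : ℕ → ℂ}
    (hb : ∀ x : ℝ, 0 ≤ x → x < 1 → Summable fun k => ‖b k‖ * x ^ k) {g : ℂ → ℂ}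
    (hg : EqOn g (fun z => ∑' k, b k * z ^ k) (Metric.ball 0 1)) (n : ℕ) :
    taylorCoeff g n = b n := by
  have hd : DifferentiableOn ℂ g (Metric.ball 0 1) := (differentiableOn_powerSeries hb).congr hg
  have h1 := fcoef_circle hd (r := 1/2) (by norm_num) (by norm_num) n
  have hs : Summable fun k => ‖b k * ((1/2 : ℝ) : ℂ) ^ k‖ := by
    simpa using hb (1/2) (by norm_num) (by norm_num)
  have h2 := fcoef_series hs n
  have h3 : (fun θ => g (circlePt (1/2) θ)) =
      fun θ => ∑' k, b k * ((1/2 : ℝ) : ℂ) ^ k * ex θ ^ k := by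
    funext θ
    rw [hg (by rw [mem_ball_zero_iff, norm_circlePt (by norm_num)]; norm_num)]
    simp only [circlePt_eq, mul_pow, mul_assoc]
  rw [h3, h2] at h1
  have : (((1/2 : ℝ) : ℂ)) ^ n ≠ 0 := by simp
  exact (mul_right_cancel₀ this h1).symm

lemma MpE_eq_lintegral (p r : ℝ) (f : ℂ → ℂ) :
    MpE p r f = (∫⁻ θ, ENNReal.ofReal (‖f (circlePt r θ)‖ ^ p) ∂circMeas) ^ (1 / p) := by
  rw [MpE, circMeas, lintegral_smul_measure, smul_eq_mul]

lemma MpE_eq_nrm {p : ℝ} (hp : 0 < p) {f : ℂ → ℂ}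
    (hf : DifferentiableOn ℂ f (Metric.ball 0 1)) {r : ℝ} (h0 : 0 ≤ r) (h1 : r < 1) :
    MpE p r f = ENNReal.ofReal (nrm p (fun θ => f (circlePt r θ))) := by
  rw [MpE_eq_lintegral, ← ofReal_integral_eq_lintegral_ofReal, nrm,
    ENNReal.ofReal_rpow_of_nonneg (by positivity) (by positivity)]
  · exact (continuous_norm_rpow hp (continuous_circlePt_comp hf h0 h1)).integrable_circMeas
  · exact ae_of_all _ fun θ => by positivity

/-- The extremal function for Hölder's inequality. -/
def dualFun (p : ℝ) (w : ℂ) : ℂ := ((‖w‖ ^ (p - 2) : ℝ) : ℂ) * w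

lemma norm_dualFun {p : ℝ} (hp : 1 < p) (w : ℂ) : ‖dualFun p w‖ = ‖w‖ ^ (p - 1) := by
  rcases eq_or_ne w 0 with rfl | hw
  · simp [dualFun, Real.zero_rpow (by linarith : p - 1 ≠ 0)]
  · have := norm_pos_iff.2 hw
    rw [dualFun, norm_mul, Complex.norm_real, Real.norm_of_nonneg (by positivity),
      ← Real.rpow_add_one this.ne']
    congr 1; ring

lemma mul_conj_dualFun {p : ℝ} (hp : 1 < p) (w : ℂ) :
    w * (starRingEnd ℂ) (dualFun p w) = ((‖w‖ ^ p : ℝ) : ℂ) := by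
  rcases eq_or_ne w 0 with rfl | hw
  · simp [dualFun, Real.zero_rpow (by linarith : p ≠ 0)]
  · have := norm_pos_iff.2 hw
    rw [dualFun, map_mul, Complex.conj_ofReal, mul_left_comm, Complex.mul_conj,
      Complex.normSq_eq_norm_sq, ← Complex.ofReal_mul, ← Real.rpow_natCast,
      ← Real.rpow_add this]
    congr 2; push_cast; ring

lemma continuous_dualFun {p : ℝ} (hp : 1 < p) : Continuous (dualFun p) := by
  rw [continuous_iff_continuousAt]
  intro w
  rcases eq_or_ne w 0 with rfl | hw
  · have h0 : dualFun p 0 = 0 := by simp [dualFun]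
    rw [ContinuousAt, h0, tendsto_zero_iff_norm_tendsto_zero]
    simp_rw [norm_dualFun hp]
    have : Continuous fun w : ℂ => ‖w‖ ^ (p - 1) :=
      continuous_norm.rpow_const fun _ => Or.inr (by linarith)
    simpa [Real.zero_rpow (by linarith : p - 1 ≠ 0)] using this.tendsto 0
  · unfold dualFun
    have : ContinuousAt (fun w : ℂ => ‖w‖ ^ (p - 2)) w :=
      continuous_norm.continuousAt.rpow_const (Or.inl (norm_ne_zero_iff.2 hw))
    exact (Complex.continuous_ofReal.continuousAt.comp this).mul continuousAt_id

lemma nrm_dualFun {p p' : ℝ} (h : p.HolderConjugate p') (u : ℝ → ℂ) :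
    nrm p' (fun θ => dualFun p (u θ)) = nrm p u ^ (p - 1) := by
  unfold nrm
  simp_rw [norm_dualFun h.lt, ← Real.rpow_mul (norm_nonneg _)]
  rw [h.sub_one_mul_conj, ← Real.rpow_mul (by positivity)]
  congr 1
  have := h.symm.one_sub_inv
  have hp := h.pos.ne'
  rw [one_div, ← h.one_sub_inv]
  field_simp

lemma poissonKernel_ex (z : ℂ) (t : ℝ) :
    poissonKernel 0 z (ex t) = (1 - ‖z‖ ^ 2) / ‖ex t - z‖ ^ 2 := by
  simp [poissonKernel_def]

lemma ex_sub_ne_zero {z : ℂ} (hz : ‖z‖ < 1) (t : ℝ) : ex t - z ≠ 0 := by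
  intro h
  rw [sub_eq_zero] at h
  rw [← h, norm_ex] at hz
  exact lt_irrefl _ hz

lemma poissonKernel_nonneg {z : ℂ} (hz : ‖z‖ < 1) (t : ℝ) : 0 ≤ poissonKernel 0 z (ex t) := by
  rw [poissonKernel_ex]
  have : ‖z‖ ^ 2 ≤ 1 := pow_le_one₀ (norm_nonneg _) hz.le
  exact div_nonneg (by linarith) (by positivity)

lemma continuous_poissonKernel {z : ℂ} (hz : ‖z‖ < 1) :
    Continuous fun t => poissonKernel 0 z (ex t) := by
  simp_rw [poissonKernel_ex]
  refine continuous_const.div (by fun_prop) fun t => ?_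
  have := ex_sub_ne_zero hz t
  positivity

lemma norm_mul_ex {ρ : ℝ} (h0 : 0 ≤ ρ) (θ : ℝ) : ‖(ρ:ℂ) * ex θ‖ = ρ := norm_circlePt h0 θ

lemma poissonKernel_symm {ρ : ℝ} (h0 : 0 ≤ ρ) (θ t : ℝ) :
    poissonKernel 0 (ρ * ex θ) (ex t) = poissonKernel 0 (ρ * ex t) (ex θ) := by
  rw [poissonKernel_ex, poissonKernel_ex, norm_mul_ex h0, norm_mul_ex h0]
  congr 2
  have h1 : ex t - ρ * ex θ = ex t * ex θ * (starRingEnd ℂ) (ex θ - ρ * ex t) := by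
    simp only [map_sub, map_mul, Complex.conj_ofReal]
    linear_combination (-ex t) * conj_ex_mul_ex θ + ρ * ex θ * conj_ex_mul_ex t
  rw [h1]; simp only [norm_mul, norm_ex, RCLike.norm_conj, one_mul]

/-- Poisson integral formula. -/
lemma integral_poissonKernel_mul {F : ℂ → ℂ} (hF : DiffContOnCl ℂ F (Metric.ball 0 1)) {z : ℂ}
    (hz : ‖z‖ < 1) :
    ∫ t, ((poissonKernel 0 z (ex t) : ℝ) : ℂ) * F (ex t) ∂circMeas = F z := by
  have := hF.circleAverage_poissonKernel_smul (w := z) (by simpa using hz)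
  rw [Real.circleAverage_def] at this
  rw [integral_circMeas, ← this]
  simp [circleMap, ex]

lemma integral_poissonKernel {z : ℂ} (hz : ‖z‖ < 1) :
    ∫ t, poissonKernel 0 z (ex t) ∂circMeas = 1 := by
  have := integral_poissonKernel_mul (F := fun _ => 1) diffContOnCl_const hz
  simp only [mul_one] at this
  rw [integral_complex_ofReal] at this
  exact_mod_cast this

lemma continuous_poissonKernel_uncurry {ρ : ℝ} (h0 : 0 ≤ ρ) (h1 : ρ < 1) :
    Continuous fun x : ℝ × ℝ => poissonKernel 0 (ρ * ex x.1) (ex x.2) := by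
  simp_rw [poissonKernel_ex]
  refine Continuous.div (by fun_prop) (by fun_prop) fun x => ?_
  have := ex_sub_ne_zero (z := ρ * ex x.1) (by rwa [norm_mul_ex h0]) x.2
  positivity

lemma poissonKernel_le {ρ : ℝ} (h0 : 0 ≤ ρ) (h1 : ρ < 1) (θ t : ℝ) :
    poissonKernel 0 (ρ * ex θ) (ex t) ≤ 1 / (1 - ρ) ^ 2 := by
  rw [poissonKernel_ex, norm_mul_ex h0]
  have h2 : 1 - ρ ≤ ‖ex t - ρ * ex θ‖ := by
    have := norm_sub_norm_le (ex t) (ρ * ex θ)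
    rwa [norm_ex, norm_mul_ex h0] at this
  have : 0 < 1 - ρ := by linarith
  gcongr
  nlinarith

/-- Poisson averaging is a contraction in `L^p`. -/
lemma integral_poisson_rpow_le {p : ℝ} (hp : 1 < p) {u : ℝ → ℝ} (hu : Continuous u)
    (hu0 : ∀ t, 0 ≤ u t) {ρ : ℝ} (h0 : 0 ≤ ρ) (h1 : ρ < 1) :
    Integrable (fun θ => (∫ t, poissonKernel 0 (ρ * ex θ) (ex t) * u t ∂circMeas) ^ p) circMeas ∧
    ∫ θ, (∫ t, poissonKernel 0 (ρ * ex θ) (ex t) * u t ∂circMeas) ^ p ∂circMeas ≤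
      ∫ t, u t ^ p ∂circMeas := by
  have hup : Continuous fun t => u t ^ p := hu.rpow_const fun _ => Or.inr (by linarith)
  have hz : ∀ θ, ‖(ρ:ℂ) * ex θ‖ < 1 := fun θ => by rwa [norm_mul_ex h0]
  have hpq : p.HolderConjugate (p.conjExponent) := Real.HolderConjugate.conjExponent hp
  have key : ∀ θ, (∫ t, poissonKernel 0 (ρ * ex θ) (ex t) * u t ∂circMeas) ^ p ≤
      ∫ t, poissonKernel 0 (ρ * ex θ) (ex t) * u t ^ p ∂circMeas := by
    intro θ
    set c := ∫ t, poissonKernel 0 (ρ * ex θ) (ex t) * u t ∂circMeas with hc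
    have hc0 : 0 ≤ c := integral_nonneg fun t => mul_nonneg (poissonKernel_nonneg (hz θ) t) (hu0 t)
    have hk := continuous_poissonKernel (hz θ)
    have young : ∀ t, p * c ^ (p - 1) * u t - (p - 1) * c ^ p ≤ u t ^ p := by
      intro t
      have := Real.young_inequality_of_nonneg (hu0 t) (Real.rpow_nonneg hc0 (p - 1)) hpq
      rw [← Real.rpow_mul hc0, hpq.sub_one_mul_conj] at this
      have e : c ^ p / p.conjExponent = (p - 1) / p * c ^ p := by
        rw [Real.conjExponent]; field_simp
      rw [e] at this
      have hp0 : 0 < p := by linarith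
      have := mul_le_mul_of_nonneg_left this hp0.le
      have e2 : p * (u t ^ p / p + (p - 1) / p * c ^ p) = u t ^ p + (p - 1) * c ^ p := by
        field_simp
      rw [e2] at this
      linarith
    have hcc : c ^ (p - 1) * c = c ^ p := by
      rcases hc0.eq_or_lt with h | h
      · rw [← h, Real.zero_rpow (by linarith : p ≠ 0), mul_zero]
      · rw [← Real.rpow_add_one h.ne', sub_add_cancel]
    calc c ^ p = p * c ^ (p - 1) * c - (p - 1) * c ^ p * 1 := by
          rw [mul_assoc p, hcc]; ring
      _ = ∫ t, poissonKernel 0 (ρ * ex θ) (ex t) *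
            (p * c ^ (p - 1) * u t - (p - 1) * c ^ p) ∂circMeas := by
          rw [← integral_poissonKernel (hz θ)]
          nth_rewrite 4 [hc]
          rw [← integral_const_mul, ← integral_const_mul, ← integral_sub]
          · congr 1; funext t; ring
          · exact (continuous_const.mul (hk.mul hu)).integrable_circMeas
          · exact (continuous_const.mul hk).integrable_circMeas
      _ ≤ _ := by
          refine integral_mono (hk.mul (by fun_prop)).integrable_circMeas
            (hk.mul hup).integrable_circMeas fun t => ?_
          exact mul_le_mul_of_nonneg_left (young t) (poissonKernel_nonneg (hz θ) t)
  have h_int : ∀ {w : ℝ → ℝ}, Continuous w → Integrable (fun x : ℝ × ℝ =>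
      poissonKernel 0 (ρ * ex x.1) (ex x.2) * w x.2) (circMeas.prod circMeas) := by
    intro w hw
    refine (hw.integrable_circMeas.comp_snd circMeas).bdd_mul (c := 1 / (1 - ρ) ^ 2)
      (continuous_poissonKernel_uncurry h0 h1).aestronglyMeasurable
      (ae_of_all _ fun x => ?_)
    rw [Real.norm_of_nonneg (poissonKernel_nonneg (hz _) _)]
    exact poissonKernel_le h0 h1 _ _
  have hI : Integrable (fun θ => (∫ t, poissonKernel 0 (ρ * ex θ) (ex t) * u t ∂circMeas) ^ p)
      circMeas := by
    refine (h_int hup).integral_prod_left.mono' ?_ (ae_of_all _ fun θ => ?_)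
    · have := (h_int hu).integral_prod_left.aestronglyMeasurable
      exact (this.aemeasurable.pow_const p).aestronglyMeasurable
    · rw [Real.norm_of_nonneg]
      · exact key θ
      · exact Real.rpow_nonneg (integral_nonneg fun t =>
          mul_nonneg (poissonKernel_nonneg (hz θ) t) (hu0 t)) _
  refine ⟨hI, ?_⟩
  calc _ ≤ ∫ θ, ∫ t, poissonKernel 0 (ρ * ex θ) (ex t) * u t ^ p ∂circMeas ∂circMeas :=
        integral_mono hI (h_int hup).integral_prod_left key
    _ = ∫ t, ∫ θ, poissonKernel 0 (ρ * ex θ) (ex t) * u t ^ p ∂circMeas ∂circMeas :=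
        integral_integral_swap (h_int hup)
    _ = _ := by
        congr 1; funext t
        rw [integral_mul_const]
        simp_rw [poissonKernel_symm h0 _ t]
        rw [integral_poissonKernel (hz t), one_mul]

/-- Integral means of analytic functions are increasing. -/
lemma nrm_circle_mono {p : ℝ} (hp : 1 < p) {f : ℂ → ℂ}
    (hf : DifferentiableOn ℂ f (Metric.ball 0 1)) {ρ r : ℝ} (h0 : 0 ≤ ρ) (h1 : ρ ≤ 1)
    (hr0 : 0 ≤ r) (hr1 : r < 1) :
    nrm p (fun θ => f (circlePt (ρ * r) θ)) ≤ nrm p (fun θ => f (circlePt r θ)) := by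
  rcases h1.eq_or_lt with rfl | h1
  · simp
  unfold nrm
  refine Real.rpow_le_rpow (by positivity) ?_ (by positivity)
  have hc := continuous_circlePt_comp hf hr0 hr1
  have hρr : ρ * r < 1 := by nlinarith
  have hz : ∀ θ, ‖(ρ:ℂ) * ex θ‖ < 1 := fun θ => by rwa [norm_mul_ex h0]
  have hd : DiffContOnCl ℂ (fun z => f (r * z)) (Metric.ball 0 1) := by
    have hm : MapsTo (fun z : ℂ => (r:ℂ) * z) (Metric.closedBall 0 1) (Metric.ball 0 1) := by
      intro z hz
      rw [mem_closedBall_zero_iff] at hz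
      rw [mem_ball_zero_iff, norm_mul, Complex.norm_real, Real.norm_of_nonneg hr0]
      nlinarith [norm_nonneg z]
    refine ⟨hf.comp (by fun_prop) (hm.mono_left Metric.ball_subset_closedBall), ?_⟩
    rw [closure_ball _ one_ne_zero]
    exact hf.continuousOn.comp (by fun_prop) hm
  obtain ⟨hI, hle⟩ := integral_poisson_rpow_le hp hc.norm (fun _ => norm_nonneg _) h0 h1
  refine le_trans (integral_mono
    (continuous_norm_rpow (by linarith) (continuous_circlePt_comp hf (by positivity)
      hρr)).integrable_circMeas hI fun θ => ?_) hle
  refine Real.rpow_le_rpow (norm_nonneg _) ?_ (by linarith)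
  have := integral_poissonKernel_mul hd (hz θ)
  have e : f (circlePt (ρ * r) θ) = f (r * (ρ * ex θ)) := by
    rw [circlePt_eq]; push_cast; congr 1; ring
  beta_reduce
  rw [e, ← this]
  refine (norm_integral_le_integral_norm _).trans (le_of_eq ?_)
  congr 1; funext t
  rw [norm_mul, Complex.norm_real, Real.norm_of_nonneg (poissonKernel_nonneg (hz θ) t), circlePt_eq]

lemma norm_rpow_le_re {p : ℝ} (hp1 : 1 < p) (hp2 : p ≤ 2) :
    ∃ A > (0:ℝ), ∃ B > (0:ℝ), ∀ w : ℂ, 0 < w.re →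
      ‖w‖ ^ p ≤ A * w.re ^ p - B * (w ^ (p:ℂ)).re := by
  have hpi := Real.pi_pos
  have hp0 : 0 < p := by linarith
  set φ := (Real.pi / 2 + Real.pi / (2 * p)) / 2 with hφ
  have hlt : Real.pi / (2 * p) < Real.pi / 2 := by
    apply div_lt_div_of_pos_left hpi (by norm_num) (by linarith)
  have h1 : φ < Real.pi / 2 := by linarith
  have h0 : Real.pi / (2 * p) < φ := by linarith
  have hφ0 : 0 < φ := lt_trans (by positivity) h0
  have h2 : Real.pi / 2 < p * φ := by
    have := mul_lt_mul_of_pos_left h0 hp0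
    have e : p * (Real.pi / (2 * p)) = Real.pi / 2 := by field_simp
    linarith
  have h3 : p * φ < Real.pi := by nlinarith
  have hcn : Real.cos (p * φ) < 0 := Real.cos_neg_of_pi_div_two_lt_of_lt h2 (by linarith)
  have hcp : 0 < Real.cos φ := Real.cos_pos_of_mem_Ioo ⟨by linarith, h1⟩
  set B := 1 / (-Real.cos (p * φ)) with hB
  have hB0 : 0 < B := one_div_pos.2 (by linarith)
  refine ⟨(1 + B) / Real.cos φ ^ p, by positivity, B, hB0, fun w hw => ?_⟩
  have hn : 0 < ‖w‖ := norm_pos_iff.2 (by rintro rfl; simp at hw)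
  have harg := Complex.abs_arg_lt_pi_div_two_iff.2 (Or.inl hw)
  have hre : w.re = ‖w‖ * Real.cos |w.arg| := by rw [Real.cos_abs, Complex.norm_mul_cos_arg]
  have hcpow : (w ^ (p:ℂ)).re = ‖w‖ ^ p * Real.cos (p * |w.arg|) := by
    rw [Complex.cpow_ofReal_re, ← Real.cos_abs (w.arg * p), abs_mul, abs_of_pos hp0, mul_comm p]
  have hc : 0 ≤ Real.cos |w.arg| := (Real.cos_pos_of_mem_Ioo ⟨by linarith [abs_nonneg w.arg],
    harg⟩).le
  rw [hcpow, hre, Real.mul_rpow hn.le hc]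
  suffices 1 ≤ (1 + B) / Real.cos φ ^ p * Real.cos |w.arg| ^ p - B * Real.cos (p * |w.arg|) by
    have := mul_le_mul_of_nonneg_left this (by positivity : 0 ≤ ‖w‖ ^ p)
    linarith
  rcases le_total φ |w.arg| with h | h
  · have : Real.cos (p * |w.arg|) ≤ Real.cos (p * φ) :=
      Real.cos_le_cos_of_nonneg_of_le_pi (by positivity) (by nlinarith) (by gcongr)
    have h5 : 1 ≤ -(B * Real.cos (p * |w.arg|)) := by
      have e : B * -Real.cos (p * φ) = 1 := by
        rw [hB]; exact one_div_mul_cancel (by linarith)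
      nlinarith
    have : 0 ≤ (1 + B) / Real.cos φ ^ p * Real.cos |w.arg| ^ p := by positivity
    linarith
  · have h4 : Real.cos φ ≤ Real.cos |w.arg| :=
      Real.cos_le_cos_of_nonneg_of_le_pi (abs_nonneg _) (by linarith) h
    have h5 : 1 + B ≤ (1 + B) / Real.cos φ ^ p * Real.cos |w.arg| ^ p := by
      rw [div_mul_eq_mul_div, le_div_iff₀ (by positivity)]
      gcongr
    have := Real.cos_le_one (p * |w.arg|)
    nlinarith

/-- The Herglotz transform of `u`. -/
def herglotz (u : ℝ → ℂ) (z : ℂ) : ℂ := 2 * ∑' k, fcoef u k * z ^ k - fcoef u 0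

lemma norm_fcoef_le_integral {u : ℝ → ℂ} (k : ℕ) :
    ‖fcoef u k‖ ≤ ∫ θ, ‖u θ‖ ∂circMeas := by
  unfold fcoef
  refine (norm_integral_le_integral_norm _).trans (le_of_eq ?_)
  simp

lemma summable_fcoef_mul_pow {u : ℝ → ℂ} {x : ℝ} (h0 : 0 ≤ x) (h1 : x < 1) :
    Summable fun k => ‖fcoef u k‖ * x ^ k :=
  Summable.of_nonneg_of_le (fun k => by positivity)
    (fun k => mul_le_mul_of_nonneg_right (norm_fcoef_le_integral k) (by positivity))
    ((summable_geometric_of_lt_one h0 h1).mul_left _)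

lemma differentiableOn_herglotz (u : ℝ → ℂ) :
    DifferentiableOn ℂ (herglotz u) (Metric.ball 0 1) :=
  ((differentiableOn_powerSeries fun _ h0 h1 => summable_fcoef_mul_pow h0 h1).const_mul _).sub_const _

lemma herglotz_zero (u : ℝ → ℂ) : herglotz u 0 = fcoef u 0 := by
  rw [herglotz, tsum_eq_single 0 (fun k hk => by simp [hk])]
  simp; ring

lemma fcoef_ofReal_zero (u : ℝ → ℝ) : fcoef (fun t => (u t : ℂ)) 0 = ((∫ t, u t ∂circMeas : ℝ) : ℂ) := by
  simp only [fcoef, pow_zero, one_mul]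
  exact integral_complex_ofReal

lemma re_herglotz {u : ℝ → ℝ} (hu : Continuous u) {z : ℂ} (hz : ‖z‖ < 1) :
    (herglotz (fun t => (u t : ℂ)) z).re = ∫ t, poissonKernel 0 z (ex t) * u t ∂circMeas := by
  have hcu : Continuous fun t => (u t : ℂ) := by fun_prop
  have hs : Summable fun k : ℕ => ‖z ^ k‖ := by
    simpa using summable_geometric_of_lt_one (norm_nonneg z) hz
  have h := (hasSum_integral_series hs (φ := fun k θ => (starRingEnd ℂ) (ex θ) ^ k)
    (fun k => by fun_prop) (by simp) hcu).tsum_eq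
  have hne : ∀ t, 1 - z * (starRingEnd ℂ) (ex t) ≠ 0 := by
    intro t h0
    have : ‖z * (starRingEnd ℂ) (ex t)‖ = 1 := by rw [← sub_eq_zero.1 h0]; simp
    rw [norm_mul, RCLike.norm_conj, norm_ex, mul_one] at this
    linarith
  have hg : ∀ t, ∑' k, z ^ k * (starRingEnd ℂ) (ex t) ^ k = (1 - z * (starRingEnd ℂ) (ex t))⁻¹ := by
    intro t
    simp_rw [← mul_pow]
    exact tsum_geometric_of_norm_lt_one (by simpa using hz)
  simp_rw [hg] at h
  have hc : Continuous fun t => (1 - z * (starRingEnd ℂ) (ex t))⁻¹ * (u t : ℂ) :=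
    (Continuous.inv₀ (by fun_prop) hne).mul hcu
  have hc2 : Continuous fun t => 2 * ((1 - z * (starRingEnd ℂ) (ex t))⁻¹ * (u t : ℂ)) :=
    continuous_const.mul hc
  have e : herglotz (fun t => (u t : ℂ)) z =
      ∫ t, (2 * ((1 - z * (starRingEnd ℂ) (ex t))⁻¹ * (u t : ℂ)) - u t) ∂circMeas := by
    rw [integral_sub hc2.integrable_circMeas hcu.integrable_circMeas,
      integral_const_mul, ← h, herglotz]
    congr 2
    · exact tsum_congr fun k => mul_comm _ _
    · simp [fcoef]
  rw [e]
  have := integral_re (𝕜 := ℂ) (hc2.integrable_circMeas.sub hcu.integrable_circMeas)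
  simp only [RCLike.re_eq_complex_re, Pi.sub_apply] at this
  rw [← this]
  congr 1; funext t
  have e2 : (2 * ((1 - z * (starRingEnd ℂ) (ex t))⁻¹ * (u t : ℂ)) - u t) =
      ((2 * (1 - z * (starRingEnd ℂ) (ex t))⁻¹ - 1) * (u t : ℝ) : ℂ) := by ring
  rw [e2, Complex.re_mul_ofReal]
  congr 1
  rw [poissonKernel_ex]
  have hn : ‖ex t - z‖ ^ 2 = Complex.normSq (1 - z * (starRingEnd ℂ) (ex t)) := by
    have : ex t - z = ex t * (1 - z * (starRingEnd ℂ) (ex t)) := by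
      linear_combination z * conj_ex_mul_ex t
    rw [this, norm_mul, norm_ex, one_mul, Complex.normSq_eq_norm_sq]
  have hp := Complex.normSq_pos.2 (hne t)
  rw [hn, Complex.sub_re, Complex.mul_re, Complex.inv_re]
  simp only [Complex.re_ofNat, Complex.im_ofNat, zero_mul, sub_zero, Complex.one_re]
  have hz2 : ‖z‖ ^ 2 = Complex.normSq (z * (starRingEnd ℂ) (ex t)) := by
    rw [Complex.normSq_eq_norm_sq]; simp
  rw [hz2, eq_div_iff hp.ne', sub_mul, mul_assoc, div_mul_cancel₀ _ hp.ne']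
  simp only [Complex.normSq_apply, Complex.sub_re, Complex.one_re, Complex.sub_im, Complex.one_im]
  ring

lemma poissonKernel_ge {z : ℂ} (hz : ‖z‖ < 1) (t : ℝ) :
    (1 - ‖z‖ ^ 2) / 4 ≤ poissonKernel 0 z (ex t) := by
  rw [poissonKernel_ex]
  have : ‖z‖ ^ 2 < 1 := pow_lt_one₀ (norm_nonneg _) hz (by norm_num)
  have h2 := norm_pos_iff.2 (ex_sub_ne_zero hz t)
  have h3 : ‖ex t - z‖ ≤ 2 := (norm_sub_le _ _).trans (by rw [norm_ex]; linarith)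
  have h4 : ‖ex t - z‖ ^ 2 ≤ 4 := by nlinarith
  exact div_le_div_of_nonneg_left (by linarith) (by positivity) h4

lemma re_herglotz_pos {u : ℝ → ℝ} (hu : Continuous u) (hu0 : ∀ t, 0 ≤ u t)
    (hpos : 0 < ∫ t, u t ∂circMeas) {z : ℂ} (hz : ‖z‖ < 1) :
    0 < (herglotz (fun t => (u t : ℂ)) z).re := by
  rw [re_herglotz hu hz]
  have h1 : ‖z‖ ^ 2 < 1 := pow_lt_one₀ (norm_nonneg _) hz (by norm_num)
  have h2 : 0 < (1 - ‖z‖ ^ 2) / 4 := by linarith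
  calc (0:ℝ) < (1 - ‖z‖ ^ 2) / 4 * ∫ t, u t ∂circMeas := mul_pos h2 hpos
    _ = ∫ t, (1 - ‖z‖ ^ 2) / 4 * u t ∂circMeas := (integral_const_mul _ _).symm
    _ ≤ _ := integral_mono (continuous_const.mul hu).integrable_circMeas
        ((continuous_poissonKernel hz).mul hu).integrable_circMeas
        fun t => mul_le_mul_of_nonneg_right (poissonKernel_ge hz t) (hu0 t)

/-- The theorem of M. Riesz for the Herglotz transform of a nonnegative function. -/
lemma nrm_herglotz_le {p : ℝ} (hp1 : 1 < p) (hp2 : p ≤ 2) :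
    ∃ A > (0:ℝ), ∀ u : ℝ → ℝ, Continuous u → (∀ t, 0 ≤ u t) → ∀ ρ : ℝ, 0 ≤ ρ → ρ < 1 →
      nrm p (fun θ => herglotz (fun t => (u t : ℂ)) (ρ * ex θ)) ≤ A * nrm p (fun t => (u t : ℂ)) := by
  obtain ⟨A, hA, B, hB, H⟩ := norm_rpow_le_re hp1 hp2
  have hp0 : 0 < p := by linarith
  refine ⟨A ^ (1 / p), by positivity, fun u hu hu0 ρ h0 h1 => ?_⟩
  have hz : ∀ θ, ‖(ρ:ℂ) * ex θ‖ < 1 := fun θ => by rwa [norm_mul_ex h0]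
  set F := herglotz (fun t => (u t : ℂ)) with hF
  have hd : DifferentiableOn ℂ F (Metric.ball 0 1) := differentiableOn_herglotz _
  have hcF : Continuous fun θ => F (ρ * ex θ) := continuous_circlePt_comp hd h0 h1
  rcases (integral_nonneg (μ := circMeas) (f := u) fun t => hu0 t).eq_or_lt with hz0 | hpos
  · have h2 : ∀ k, fcoef (fun t => (u t : ℂ)) k = 0 := fun k => by
      have := norm_fcoef_le_integral (u := fun t => (u t : ℂ)) k
      simp only [Complex.norm_real, Real.norm_of_nonneg (hu0 _)] at this
      rw [← hz0] at this
      exact norm_le_zero_iff.1 this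
    have h3 : ∀ z, F z = 0 := fun z => by simp [hF, herglotz, h2]
    refine (nrm_le_of_bound hp0 hcF le_rfl (by simp [h3])).trans ?_
    have := nrm_nonneg p (fun t => (u t : ℂ))
    positivity
  have hre : ∀ z : ℂ, ‖z‖ < 1 → 0 < (F z).re := fun z hz => re_herglotz_pos hu hu0 hpos hz
  have hpow : DifferentiableOn ℂ (fun z => F z ^ (p:ℂ)) (Metric.ball 0 1) :=
    hd.cpow_const fun z hz => Or.inl (hre z (by simpa using hz))
  have hcpow : Continuous fun θ => F (ρ * ex θ) ^ (p:ℂ) := continuous_circlePt_comp hpow h0 h1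
  have hmean := integral_circMeas_analytic hpow h0 h1
  have hm : 0 ≤ ∫ θ, (F (ρ * ex θ) ^ (p:ℂ)).re ∂circMeas := by
    have := integral_re (𝕜 := ℂ) hcpow.integrable_circMeas
    simp only [RCLike.re_eq_complex_re] at this
    rw [this, hmean, hF, herglotz_zero, fcoef_ofReal_zero, ← Complex.ofReal_cpow hpos.le,
      Complex.ofReal_re]
    positivity
  obtain ⟨hI, hle⟩ := integral_poisson_rpow_le hp1 hu hu0 h0 h1
  simp_rw [← re_herglotz hu (hz _)] at hI hle
  have hcre : Continuous fun θ => (F (ρ * ex θ) ^ (p:ℂ)).re := Complex.continuous_re.comp hcpow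
  have main : ∫ θ, ‖F (ρ * ex θ)‖ ^ p ∂circMeas ≤ A * ∫ t, ‖(u t : ℂ)‖ ^ p ∂circMeas := by
    calc _ ≤ ∫ θ, (A * (F (ρ * ex θ)).re ^ p - B * (F (ρ * ex θ) ^ (p:ℂ)).re) ∂circMeas := by
          refine integral_mono (continuous_norm_rpow hp0 hcF).integrable_circMeas
            ((hI.const_mul A).sub (hcre.integrable_circMeas.const_mul B)) fun θ => ?_
          exact H _ (hre _ (hz θ))
      _ = A * ∫ θ, (F (ρ * ex θ)).re ^ p ∂circMeas
          - B * ∫ θ, (F (ρ * ex θ) ^ (p:ℂ)).re ∂circMeas := by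
          rw [integral_sub (hI.const_mul A) (hcre.integrable_circMeas.const_mul B),
            integral_const_mul, integral_const_mul]
      _ ≤ A * ∫ θ, (F (ρ * ex θ)).re ^ p ∂circMeas := by
          have := mul_nonneg hB.le hm
          linarith
      _ ≤ _ := by
          refine mul_le_mul_of_nonneg_left (hle.trans (le_of_eq ?_)) hA.le
          simp only [Complex.norm_real, Real.norm_of_nonneg (hu0 _)]
  unfold nrm
  rw [← Real.mul_rpow hA.le (by positivity)]
  exact Real.rpow_le_rpow (by positivity) main (by positivity)

lemma fcoef_shift (u : ℝ → ℂ) (N k : ℕ) :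
    fcoef (fun θ => (starRingEnd ℂ) (ex θ) ^ N * u θ) k = fcoef u (k + N) := by
  simp only [fcoef, pow_add, mul_assoc]

lemma summable_fcoef_pairing (u : ℝ → ℂ) (v : ℝ → ℂ) {ρ : ℝ} (h0 : 0 ≤ ρ) (h1 : ρ < 1) :
    Summable fun k => fcoef u k * (ρ:ℂ) ^ k * (starRingEnd ℂ) (fcoef v k) := by
  refine Summable.of_norm_bounded ((summable_fcoef_mul_pow (u := u) h0 h1).mul_right
    (∫ θ, ‖v θ‖ ∂circMeas)) fun k => ?_
  simp only [norm_mul, norm_pow, Complex.norm_real, Real.norm_of_nonneg h0, RCLike.norm_conj]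
  exact mul_le_mul_of_nonneg_left (norm_fcoef_le_integral k) (by positivity)

lemma norm_tsum_pairing_le_of_nonneg {p : ℝ} (hp2 : p ≤ 2) {p' : ℝ} (h : p.HolderConjugate p') :
    ∃ A > (0:ℝ), ∀ u : ℝ → ℝ, Continuous u → (∀ t, 0 ≤ u t) → ∀ v : ℝ → ℂ, Continuous v →
      ∀ ρ : ℝ, 0 ≤ ρ → ρ < 1 →
      ‖∑' k, fcoef (fun t => (u t : ℂ)) k * (ρ:ℂ) ^ k * (starRingEnd ℂ) (fcoef v k)‖ ≤
        A * nrm p (fun t => (u t : ℂ)) * nrm p' v := by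
  obtain ⟨A, hA, H⟩ := nrm_herglotz_le h.lt hp2
  refine ⟨A + 1, by positivity, fun u hu hu0 v hv ρ h0 h1 => ?_⟩
  have hcu : Continuous fun t => (u t : ℂ) := by fun_prop
  set U := fcoef fun t => (u t : ℂ) with hU
  set F := herglotz fun t => (u t : ℂ) with hF
  have hcF : Continuous fun θ => F (ρ * ex θ) :=
    continuous_circlePt_comp (differentiableOn_herglotz _) h0 h1
  have hs : Summable fun k => ‖U k * (ρ:ℂ) ^ k‖ := by
    simpa [abs_of_nonneg h0] using summable_fcoef_mul_pow (u := fun t => (u t : ℂ)) h0 h1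
  have e := (hasSum_pairing hs hv).tsum_eq
  have e2 : ∀ θ, ∑' k, U k * (ρ:ℂ) ^ k * ex θ ^ k = (1/2) * F (ρ * ex θ) + (1/2) * U 0 := by
    intro θ
    rw [hF, herglotz]
    simp_rw [mul_pow, ← mul_assoc]
    rw [← hU]; ring
  have hcv : Continuous fun θ => (starRingEnd ℂ) (v θ) := by fun_prop
  have e3 : ∫ θ, (∑' k, U k * (ρ:ℂ) ^ k * ex θ ^ k) * (starRingEnd ℂ) (v θ) ∂circMeas =
      (1/2) * (∫ θ, F (ρ * ex θ) * (starRingEnd ℂ) (v θ) ∂circMeas) +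
      (1/2) * (U 0 * (starRingEnd ℂ) (fcoef v 0)) := by
    have : fcoef v 0 = ∫ θ, v θ ∂circMeas := by simp [fcoef]
    rw [this, ← integral_circMeas_conj, ← integral_const_mul, ← integral_const_mul,
      ← integral_const_mul, ← integral_add]
    · congr 1; funext θ; rw [e2]; ring
    · exact (continuous_const.mul (hcF.mul hcv)).integrable_circMeas
    · exact (continuous_const.mul (continuous_const.mul hcv)).integrable_circMeas
  rw [e, e3]
  have b1 := (norm_integral_mul_conj_le h hcF hv).trans
    (mul_le_mul_of_nonneg_right (H u hu hu0 ρ h0 h1) (nrm_nonneg _ _))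
  have b2 := mul_le_mul (norm_fcoef_le h hcu 0) (norm_fcoef_le h.symm hv 0) (norm_nonneg _)
    (nrm_nonneg _ _)
  have b3 : ‖U 0 * (starRingEnd ℂ) (fcoef v 0)‖ = ‖U 0‖ * ‖fcoef v 0‖ := by simp
  refine (norm_add_le _ _).trans ?_
  rw [norm_mul, norm_mul (1/2 : ℂ), b3]
  have hh : ‖(1/2 : ℂ)‖ = 1/2 := by norm_num
  rw [hh]
  have := mul_nonneg (nrm_nonneg p fun t => (u t : ℂ)) (nrm_nonneg p' v)
  have := mul_nonneg hA.le this
  rw [← hU] at b2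
  nlinarith

lemma norm_tsum_pairing_le {p : ℝ} (hp2 : p ≤ 2) {p' : ℝ} (h : p.HolderConjugate p') :
    ∃ A > (0:ℝ), ∀ u : ℝ → ℂ, Continuous u → ∀ v : ℝ → ℂ, Continuous v →
      ∀ ρ : ℝ, 0 ≤ ρ → ρ < 1 →
      ‖∑' k, fcoef u k * (ρ:ℂ) ^ k * (starRingEnd ℂ) (fcoef v k)‖ ≤ A * nrm p u * nrm p' v := by
  obtain ⟨A, hA, H⟩ := norm_tsum_pairing_le_of_nonneg hp2 h
  refine ⟨4 * A, by positivity, fun u hu v hv ρ h0 h1 => ?_⟩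
  set a : ℝ → ℝ := fun t => max (u t).re 0 with ha
  set b : ℝ → ℝ := fun t => max (-(u t).re) 0 with hb
  set c : ℝ → ℝ := fun t => max (u t).im 0 with hc
  set d : ℝ → ℝ := fun t => max (-(u t).im) 0 with hd
  have hre : Continuous fun t => (u t).re := Complex.continuous_re.comp hu
  have him : Continuous fun t => (u t).im := Complex.continuous_im.comp hu
  have ca : Continuous a := hre.max continuous_const
  have cb : Continuous b := hre.neg.max continuous_const
  have cc : Continuous c := him.max continuous_const
  have cd : Continuous d := him.neg.max continuous_const
  have key : ∀ w : ℝ → ℝ, Continuous w → (∀ t, 0 ≤ w t) → (∀ t, w t ≤ ‖u t‖) →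
      ‖∑' k, fcoef (fun t => (w t : ℂ)) k * (ρ:ℂ) ^ k * (starRingEnd ℂ) (fcoef v k)‖ ≤
        A * nrm p u * nrm p' v := by
    intro w hw hw0 hwu
    refine (H w hw hw0 v hv ρ h0 h1).trans ?_
    refine mul_le_mul_of_nonneg_right (mul_le_mul_of_nonneg_left ?_ hA.le) (nrm_nonneg _ _)
    refine nrm_mono h.pos (by fun_prop) hu fun t => ?_
    rw [Complex.norm_real, Real.norm_of_nonneg (hw0 t)]
    exact hwu t
  have r1 : ∀ t, |(u t).re| ≤ ‖u t‖ := fun t => Complex.abs_re_le_norm _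
  have r2 : ∀ t, |(u t).im| ≤ ‖u t‖ := fun t => Complex.abs_im_le_norm _
  have ka := key a ca (fun t => le_max_right _ _)
    fun t => max_le ((le_abs_self _).trans (r1 t)) (norm_nonneg _)
  have kb := key b cb (fun t => le_max_right _ _)
    fun t => max_le ((neg_le_abs _).trans (r1 t)) (norm_nonneg _)
  have kc := key c cc (fun t => le_max_right _ _)
    fun t => max_le ((le_abs_self _).trans (r2 t)) (norm_nonneg _)
  have kd := key d cd (fun t => le_max_right _ _)
    fun t => max_le ((neg_le_abs _).trans (r2 t)) (norm_nonneg _)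
  have hmax : ∀ x : ℝ, max x 0 - max (-x) 0 = x := fun x => by
    rcases le_total x 0 with h | h
    · rw [max_eq_right h, max_eq_left (by linarith)]; ring
    · rw [max_eq_left h, max_eq_right (by linarith)]; ring
  have hdec : ∀ t, u t = ((a t : ℂ) - b t) + Complex.I * ((c t : ℂ) - d t) := by
    intro t
    rw [← Complex.ofReal_sub, ← Complex.ofReal_sub, ha, hb, hc, hd]
    simp only [hmax]
    rw [mul_comm, Complex.re_add_im]
  have h_int : ∀ (w : ℝ → ℝ), Continuous w → ∀ k : ℕ,
      Integrable (fun θ => (starRingEnd ℂ) (ex θ) ^ k * (w θ : ℂ)) circMeas := fun w hw k =>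
    Continuous.integrable_circMeas (by fun_prop)
  have hco : ∀ k, fcoef u k = (fcoef (fun t => (a t : ℂ)) k - fcoef (fun t => (b t : ℂ)) k) +
      Complex.I * (fcoef (fun t => (c t : ℂ)) k - fcoef (fun t => (d t : ℂ)) k) := by
    intro k
    unfold fcoef
    rw [← integral_sub (h_int a ca k) (h_int b cb k), ← integral_sub (h_int c cc k) (h_int d cd k),
      ← integral_const_mul]
    refine Eq.trans ?_ (integral_add ((h_int a ca k).sub (h_int b cb k))
      (((h_int c cc k).sub (h_int d cd k)).const_mul _))
    congr 1; funext θ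
    rw [hdec θ]; ring
  have hsum := fun w : ℝ → ℂ => summable_fcoef_pairing w v h0 h1
  have e : ∑' k, fcoef u k * (ρ:ℂ) ^ k * (starRingEnd ℂ) (fcoef v k) =
      (∑' k, fcoef (fun t => (a t : ℂ)) k * (ρ:ℂ) ^ k * (starRingEnd ℂ) (fcoef v k) -
      ∑' k, fcoef (fun t => (b t : ℂ)) k * (ρ:ℂ) ^ k * (starRingEnd ℂ) (fcoef v k)) +
      Complex.I * (∑' k, fcoef (fun t => (c t : ℂ)) k * (ρ:ℂ) ^ k * (starRingEnd ℂ) (fcoef v k) -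
      ∑' k, fcoef (fun t => (d t : ℂ)) k * (ρ:ℂ) ^ k * (starRingEnd ℂ) (fcoef v k)) := by
    rw [← (hsum _).tsum_sub (hsum _), ← (hsum _).tsum_sub (hsum _), ← tsum_mul_left,
      ← ((hsum _).sub (hsum _)).tsum_add (((hsum _).sub (hsum _)).mul_left _)]
    refine tsum_congr fun k => ?_
    rw [hco k]; ring
  rw [e]
  refine (norm_add_le _ _).trans ?_
  rw [norm_mul, Complex.norm_I, one_mul]
  refine (add_le_add (norm_sub_le _ _) (norm_sub_le _ _)).trans ?_
  linarith

lemma norm_sum_pairing_le_aux {p : ℝ} (hp2 : p ≤ 2) {p' : ℝ} (h : p.HolderConjugate p') :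
    ∃ A > (0:ℝ), ∀ u : ℝ → ℂ, Continuous u → ∀ v : ℝ → ℂ, Continuous v → ∀ N : ℕ,
      ‖∑ k ∈ Finset.range N, fcoef u k * (starRingEnd ℂ) (fcoef v k)‖ ≤
        A * nrm p u * nrm p' v := by
  obtain ⟨A, hA, H⟩ := norm_tsum_pairing_le hp2 h
  refine ⟨2 * A, by positivity, fun u hu v hv N => ?_⟩
  have hlim : Tendsto (fun ρ : ℝ => ‖∑ k ∈ Finset.range N,
      fcoef u k * (ρ:ℂ) ^ k * (starRingEnd ℂ) (fcoef v k)‖) (nhdsWithin 1 (Set.Iio 1))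
      (nhds ‖∑ k ∈ Finset.range N, fcoef u k * (starRingEnd ℂ) (fcoef v k)‖) := by
    have hc : Continuous fun ρ : ℝ => ‖∑ k ∈ Finset.range N,
      fcoef u k * (ρ:ℂ) ^ k * (starRingEnd ℂ) (fcoef v k)‖ := by fun_prop
    have := hc.tendsto 1
    simp only [Complex.ofReal_one, one_pow, mul_one] at this
    exact this.mono_left nhdsWithin_le_nhds
  refine le_of_tendsto hlim ?_
  have hmem : Ioo (0:ℝ) 1 ∈ nhdsWithin (1:ℝ) (Set.Iio 1) := Ioo_mem_nhdsLT zero_lt_one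
  filter_upwards [hmem] with ρ hρ
  have hs := (summable_fcoef_pairing u v hρ.1.le hρ.2).sum_add_tsum_nat_add N
  have b1 := H u hu v hv ρ hρ.1.le hρ.2
  have b2 := H (fun θ => (starRingEnd ℂ) (ex θ) ^ N * u θ) (by fun_prop)
    (fun θ => (starRingEnd ℂ) (ex θ) ^ N * v θ) (by fun_prop) ρ hρ.1.le hρ.2
  rw [nrm_congr (u := fun θ => (starRingEnd ℂ) (ex θ) ^ N * u θ) (v := u) (by simp),
    nrm_congr (u := fun θ => (starRingEnd ℂ) (ex θ) ^ N * v θ) (v := v) (by simp)] at b2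
  simp only [fcoef_shift] at b2
  have e : ∑' k, fcoef u (k + N) * (ρ:ℂ) ^ (k + N) * (starRingEnd ℂ) (fcoef v (k + N)) =
      (ρ:ℂ) ^ N * ∑' k, fcoef u (k + N) * (ρ:ℂ) ^ k * (starRingEnd ℂ) (fcoef v (k + N)) := by
    rw [← tsum_mul_left]
    refine tsum_congr fun k => ?_
    ring
  rw [e] at hs
  rw [eq_sub_of_add_eq hs]
  refine (norm_sub_le _ _).trans ?_
  rw [norm_mul, norm_pow, Complex.norm_real, Real.norm_of_nonneg hρ.1.le]
  have h3 : ρ ^ N ≤ 1 := pow_le_one₀ hρ.1.le hρ.2.le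
  have h4 := mul_le_of_le_one_left (norm_nonneg (∑' k, fcoef u (k + N) * (ρ:ℂ) ^ k *
    (starRingEnd ℂ) (fcoef v (k + N)))) h3
  linarith

/-- The theorem of M. Riesz in bilinear form: partial sum operators are uniformly bounded. -/
lemma norm_sum_pairing_le {p p' : ℝ} (h : p.HolderConjugate p') :
    ∃ A > (0:ℝ), ∀ u : ℝ → ℂ, Continuous u → ∀ v : ℝ → ℂ, Continuous v → ∀ N : ℕ,
      ‖∑ k ∈ Finset.range N, fcoef u k * (starRingEnd ℂ) (fcoef v k)‖ ≤
        A * nrm p u * nrm p' v := by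
  rcases le_total p 2 with hp | hp
  · exact norm_sum_pairing_le_aux hp h
  · have hp' : p' ≤ 2 := by
      have := h.inv_add_inv_eq_one
      by_contra! hc
      have h1 : p⁻¹ ≤ 2⁻¹ := inv_anti₀ (by norm_num) hp
      have h2 : p'⁻¹ < 2⁻¹ := inv_strictAnti₀ (by norm_num) hc
      linarith
    obtain ⟨A, hA, H⟩ := norm_sum_pairing_le_aux hp' h.symm
    refine ⟨A, hA, fun u hu v hv N => ?_⟩
    have := H v hv u hu N
    rw [← RCLike.norm_conj, map_sum] at this
    simp only [map_mul, Complex.conj_conj] at this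
    calc _ = _ := by congr 1; exact Finset.sum_congr rfl fun k _ => mul_comm _ _
      _ ≤ _ := this
      _ = _ := by ring

lemma omegaHat_eq {ω : ℝ → ℝ} {x : ℝ} (hx : x ≤ 1) : omegaHat ω x = ∫ s in Ioo x 1, ω s := by
  rw [omegaHat, intervalIntegral.integral_of_le hx, integral_Ioc_eq_integral_Ioo]

lemma IsRadialWeight.integrableOn_Ioo {ω : ℝ → ℝ} (hω : IsRadialWeight ω) {x : ℝ} (hx : 0 ≤ x) :
    IntegrableOn ω (Ioo x 1) :=
  hω.2.mono_set fun _ hs => ⟨hx.trans hs.1.le, hs.2⟩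

lemma IsRadialWeight.nonneg_ae {ω : ℝ → ℝ} (hω : IsRadialWeight ω) {x : ℝ} (hx : 0 ≤ x) :
    ∀ᵐ s ∂(volume.restrict (Ioo x 1)), 0 ≤ ω s := by
  filter_upwards [ae_restrict_mem measurableSet_Ioo] with s hs
  exact hω.1 s ⟨hx.trans hs.1.le, hs.2⟩

lemma omegaHat_anti {ω : ℝ → ℝ} (hω : IsRadialWeight ω) {x y : ℝ} (hx : 0 ≤ x) (hxy : x ≤ y)
    (hy : y ≤ 1) : omegaHat ω y ≤ omegaHat ω x := by
  rw [omegaHat_eq hy, omegaHat_eq (hxy.trans hy)]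
  exact setIntegral_mono_set (hω.integrableOn_Ioo hx) (hω.nonneg_ae hx)
    (Ioo_subset_Ioo_left hxy).eventuallyLE

lemma integrableOn_pow_mul {ω : ℝ → ℝ} (hω : IsRadialWeight ω) (n : ℕ) :
    IntegrableOn (fun r => r ^ n * ω r) (Ioo 0 1) := by
  refine (hω.integrableOn_Ioo le_rfl).bdd_mul (c := 1)
    (continuous_pow n).aestronglyMeasurable ?_
  filter_upwards [ae_restrict_mem measurableSet_Ioo] with r hr
  rw [norm_pow, Real.norm_of_nonneg hr.1.le]
  exact pow_le_one₀ hr.1.le hr.2.le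

lemma momentCoeff_eq {ω : ℝ → ℝ} (k : ℕ) :
    momentCoeff ω k = ∫ r in Ioo (0:ℝ) 1, r ^ (2 * k + 1) * ω r := by
  rw [momentCoeff, momentW, intervalIntegral.integral_of_le zero_le_one,
    integral_Ioc_eq_integral_Ioo]
  congr 1; funext r
  congr 1
  rw [← Real.rpow_natCast]; push_cast; rfl

lemma momentCoeff_anti {ω : ℝ → ℝ} (hω : IsRadialWeight ω) (k : ℕ) :
    momentCoeff ω (k + 1) ≤ momentCoeff ω k := by
  rw [momentCoeff_eq, momentCoeff_eq]
  refine setIntegral_mono_on (integrableOn_pow_mul hω _) (integrableOn_pow_mul hω _)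
    measurableSet_Ioo fun r hr => ?_
  exact mul_le_mul_of_nonneg_right
    (pow_le_pow_of_le_one hr.1.le hr.2.le (by omega)) (hω.1 r ⟨hr.1.le, hr.2⟩)

lemma pow_mul_omegaHat_le {ω : ℝ → ℝ} (hω : IsRadialWeight ω) {y : ℝ} (h0 : 0 ≤ y) (h1 : y < 1)
    (k : ℕ) : y ^ (2 * k + 1) * omegaHat ω y ≤ momentCoeff ω k := by
  rw [momentCoeff_eq, omegaHat_eq h1.le, ← integral_const_mul]
  calc _ ≤ ∫ r in Ioo y 1, r ^ (2 * k + 1) * ω r := by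
        refine setIntegral_mono_on ((hω.integrableOn_Ioo h0).const_mul _)
          ((integrableOn_pow_mul hω _).mono_set (Ioo_subset_Ioo_left h0)) measurableSet_Ioo
          fun r hr => ?_
        have h2 : 0 ≤ ω r := hω.1 r ⟨h0.trans hr.1.le, hr.2⟩
        have h3 := hr.1.le
        gcongr
    _ ≤ _ := by
        refine setIntegral_mono_set (integrableOn_pow_mul hω _) ?_
          (Ioo_subset_Ioo_left h0).eventuallyLE
        filter_upwards [ae_restrict_mem measurableSet_Ioo] with r hr
        exact mul_nonneg (pow_nonneg hr.1.le _) (hω.1 r ⟨hr.1.le, hr.2⟩)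

lemma momentCoeff_pos {ω : ℝ → ℝ} (hω : IsRadialWeight ω)
    (hpos : ∀ r ∈ Set.Ico (0:ℝ) 1, 0 < omegaHat ω r) (k : ℕ) : 0 < momentCoeff ω k := by
  refine lt_of_lt_of_le ?_ (pow_mul_omegaHat_le hω (y := 1/2) (by norm_num) (by norm_num) k)
  have := hpos (1/2) ⟨by norm_num, by norm_num⟩
  positivity

/-- The moment estimate for upper doubling weights. -/
lemma exists_pow_mul_omegaHat_le {ω : ℝ → ℝ} (hω : IsRadialWeight ω)
    (hpos : ∀ r ∈ Set.Ico (0:ℝ) 1, 0 < omegaHat ω r) (hD : InDhat ω) :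
    ∃ D > (0:ℝ), ∀ x : ℝ, 0 ≤ x → x < 1 → ∀ k : ℕ,
      x ^ (k / 2) / momentCoeff ω k ≤ D / omegaHat ω x := by
  obtain ⟨C, hC, H⟩ := hD
  refine ⟨C ^ 2 * (64 / 27), by positivity, fun x h0 h1 k => ?_⟩
  rw [div_le_div_iff₀ (momentCoeff_pos hω hpos k) (hpos x ⟨h0, h1⟩)]
  set y := (1 + x) / 2 with hy
  set z := (1 + y) / 2 with hz
  have hy0 : 1/2 ≤ y := by linarith
  have hy1 : y < 1 := by linarith
  have hz0 : 3/4 ≤ z := by linarith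
  have hz1 : z < 1 := by linarith
  have hxy : x ≤ y ^ 2 := by rw [hy]; nlinarith [sq_nonneg (1 - x)]
  have hyz : y ≤ z ^ 2 := by rw [hz]; nlinarith [sq_nonneg (1 - y)]
  have hxz : x ≤ z ^ 4 := by
    calc x ≤ y ^ 2 := hxy
      _ ≤ (z ^ 2) ^ 2 := by gcongr
      _ = z ^ 4 := by ring
  have hH : omegaHat ω x ≤ C ^ 2 * omegaHat ω z := by
    calc _ ≤ C * omegaHat ω y := H x ⟨h0, h1⟩
      _ ≤ C * (C * omegaHat ω z) := by
        have := H y ⟨by linarith, hy1⟩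
        gcongr
      _ = _ := by ring
  have hzp := hpos z ⟨by linarith, hz1⟩
  have hp : x ^ (k / 2) ≤ 64 / 27 * z ^ (2 * k + 1) := by
    calc x ^ (k / 2) ≤ (z ^ 4) ^ (k / 2) := by gcongr
      _ = z ^ (4 * (k / 2)) * 1 := by rw [← pow_mul, mul_one]
      _ ≤ z ^ (4 * (k / 2)) * (64 / 27 * z ^ 3) := by
        have : (3/4 : ℝ) ^ 3 ≤ z ^ 3 := by gcongr
        gcongr
        linarith
      _ = 64 / 27 * z ^ (4 * (k / 2) + 3) := by ring
      _ ≤ _ := by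
        have : z ^ (4 * (k / 2) + 3) ≤ z ^ (2 * k + 1) :=
          pow_le_pow_of_le_one (by linarith) hz1.le (by omega)
        gcongr
  calc x ^ (k / 2) * omegaHat ω x ≤ 64 / 27 * z ^ (2 * k + 1) * (C ^ 2 * omegaHat ω z) :=
        mul_le_mul hp hH (hpos x ⟨h0, h1⟩).le (by positivity)
    _ = C ^ 2 * (64 / 27) * (z ^ (2 * k + 1) * omegaHat ω z) := by ring
    _ ≤ _ := by
      have := pow_mul_omegaHat_le hω (y := z) (by linarith) hz1 k
      gcongr

lemma one_sub_mul_sum_pow_half_le {x : ℝ} (h0 : 0 ≤ x) (h1 : x < 1) (N : ℕ) :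
    (1 - x) * ∑ k ∈ Finset.range N, x ^ (k / 2) ≤ 2 := by
  have key : ∀ n : ℕ, (1 - x) * ∑ k ∈ Finset.range (2 * n), x ^ (k / 2) = 2 * (1 - x ^ n) := by
    intro n
    induction n with
    | zero => simp
    | succ n ih =>
      rw [show 2 * (n + 1) = 2 * n + 1 + 1 by ring, Finset.sum_range_succ, Finset.sum_range_succ,
        mul_add, mul_add, ih, show (2 * n + 1) / 2 = n by omega, show (2 * n) / 2 = n by omega]
      ring
  calc _ ≤ (1 - x) * ∑ k ∈ Finset.range (2 * N), x ^ (k / 2) := by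
        refine mul_le_mul_of_nonneg_left ?_ (by linarith)
        exact Finset.sum_le_sum_of_subset_of_nonneg
          (Finset.range_mono (by omega)) fun _ _ _ => by positivity
    _ ≤ 2 := by
        rw [key]
        have : 0 ≤ x ^ N := by positivity
        linarith

lemma summable_pow_div_momentCoeff {ω : ℝ → ℝ} (hω : IsRadialWeight ω)
    (hpos : ∀ r ∈ Set.Ico (0:ℝ) 1, 0 < omegaHat ω r) (hD : InDhat ω) {x : ℝ} (h0 : 0 ≤ x)
    (h1 : x < 1) : Summable fun k => x ^ k / momentCoeff ω k := by
  obtain ⟨D, hD0, H⟩ := exists_pow_mul_omegaHat_le hω hpos hD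
  obtain ⟨y, hxy, hy1⟩ := exists_between h1
  have hy0 : 0 < y := h0.trans_lt hxy
  refine Summable.of_nonneg_of_le
    (fun k => div_nonneg (by positivity) (momentCoeff_pos hω hpos k).le) (fun k => ?_)
    ((summable_geometric_of_lt_one (r := x / y) (by positivity)
      ((div_lt_one hy0).2 hxy)).mul_left (D / omegaHat ω y))
  calc x ^ k / momentCoeff ω k = y ^ k / momentCoeff ω k * (x / y) ^ k := by
        rw [div_pow]; field_simp
    _ ≤ y ^ (k / 2) / momentCoeff ω k * (x / y) ^ k := by
        have := momentCoeff_pos hω hpos k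
        have : y ^ k ≤ y ^ (k / 2) := pow_le_pow_of_le_one hy0.le hy1.le (by omega)
        gcongr
    _ ≤ _ := by
        have := H y hy0.le hy1 k
        gcongr

lemma sum_mul_eq_summation_by_parts (l : ℕ → ℝ) (a : ℕ → ℂ) (N : ℕ) :
    ∑ k ∈ Finset.range N, (l k : ℂ) * a k = l N * ∑ k ∈ Finset.range N, a k +
      ∑ k ∈ Finset.range N, ((l k - l (k + 1) : ℝ) : ℂ) * ∑ j ∈ Finset.range (k + 1), a j := by
  induction N with
  | zero => simp
  | succ n ih =>
    rw [Finset.sum_range_succ, ih, Finset.sum_range_succ _ n, Finset.sum_range_succ _ n]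
    push_cast
    rw [Finset.sum_range_succ]
    ring

/-- Bound for a series with coefficients `x^k/ω_{2k+1}` in terms of the partial sums. -/
lemma exists_norm_tsum_moment_le {ω : ℝ → ℝ} (hω : IsRadialWeight ω)
    (hpos : ∀ r ∈ Set.Ico (0:ℝ) 1, 0 < omegaHat ω r) (hD : InDhat ω) :
    ∃ D > (0:ℝ), ∀ (a : ℕ → ℂ) (K : ℝ), (∀ N, ‖∑ k ∈ Finset.range N, a k‖ ≤ K) →
      ∀ x : ℝ, 0 ≤ x → x < 1 →
      (Summable fun k => ((x ^ k / momentCoeff ω k : ℝ) : ℂ) * a k) ∧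
      ‖∑' k, ((x ^ k / momentCoeff ω k : ℝ) : ℂ) * a k‖ ≤ D / omegaHat ω x * K := by
  obtain ⟨D, hD0, H⟩ := exists_pow_mul_omegaHat_le hω hpos hD
  refine ⟨6 * D, by positivity, fun a K ha x h0 h1 => ?_⟩
  have hm := momentCoeff_pos hω hpos
  have hx := hpos x ⟨h0, h1⟩
  have hK : 0 ≤ K := (norm_nonneg _).trans (ha 0)
  have hbound : ∀ k, ‖a k‖ ≤ 2 * K := fun k => by
    have : a k = ∑ j ∈ Finset.range (k + 1), a j - ∑ j ∈ Finset.range k, a j := by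
      rw [Finset.sum_range_succ]; ring
    rw [this]
    exact (norm_sub_le _ _).trans (by linarith [ha (k + 1), ha k])
  have hsum : Summable fun k => ((x ^ k / momentCoeff ω k : ℝ) : ℂ) * a k := by
    refine Summable.of_norm_bounded
      ((summable_pow_div_momentCoeff hω hpos hD h0 h1).mul_right (2 * K)) fun k => ?_
    have : 0 ≤ x ^ k / momentCoeff ω k := div_nonneg (by positivity) (hm k).le
    rw [norm_mul, Complex.norm_real, Real.norm_of_nonneg this]
    exact mul_le_mul_of_nonneg_left (hbound k) this
  refine ⟨hsum, ?_⟩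
  refine le_of_tendsto hsum.hasSum.tendsto_sum_nat.norm (Eventually.of_forall fun N => ?_)
  set l : ℕ → ℝ := fun k => x ^ k / momentCoeff ω k with hl
  have hl0 : ∀ k, 0 ≤ l k := fun k => div_nonneg (by positivity) (hm k).le
  have hlN : ∀ k, l k ≤ D / omegaHat ω x := fun k => by
    refine le_trans ?_ (H x h0 h1 k)
    have := hm k
    have h2 : x ^ k ≤ x ^ (k / 2) := pow_le_pow_of_le_one h0 h1.le (by omega)
    simp only [hl]; gcongr
  have hs : ∀ k, x ^ k / momentCoeff ω (k + 1) ≤ D / omegaHat ω x * x ^ (k / 2) := fun k => by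
    have h2 := H x h0 h1 (k + 1)
    have h3 : x ^ k = x ^ ((k + 1) / 2) * x ^ (k / 2) := by
      rw [← pow_add]; congr 1; omega
    rw [h3, mul_div_right_comm]
    gcongr
  have hdiff : ∀ k, |l k - l (k + 1)| ≤
      (l (k + 1) - l k) + 2 * ((1 - x) * (x ^ k / momentCoeff ω (k + 1))) := fun k => by
    have e : l k - l (k + 1) = (x ^ k / momentCoeff ω k - x ^ k / momentCoeff ω (k + 1)) +
        (1 - x) * (x ^ k / momentCoeff ω (k + 1)) := by
      simp only [hl, pow_succ]; ring
    have h2 : x ^ k / momentCoeff ω k ≤ x ^ k / momentCoeff ω (k + 1) :=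
      div_le_div_of_nonneg_left (by positivity) (hm _) (momentCoeff_anti hω k)
    have h3 : 0 ≤ (1 - x) * (x ^ k / momentCoeff ω (k + 1)) :=
      mul_nonneg (by linarith) (div_nonneg (by positivity) (hm _).le)
    rw [abs_le]
    constructor <;> linarith
  have hvar : ∑ k ∈ Finset.range N, |l k - l (k + 1)| ≤ 5 * (D / omegaHat ω x) := by
    calc _ ≤ ∑ k ∈ Finset.range N, ((l (k + 1) - l k) +
          2 * ((1 - x) * (D / omegaHat ω x * x ^ (k / 2)))) := by
          refine Finset.sum_le_sum fun k _ => (hdiff k).trans ?_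
          have := mul_le_mul_of_nonneg_left (hs k) (by linarith : 0 ≤ 1 - x)
          linarith
      _ = (l N - l 0) + 2 * (D / omegaHat ω x) * ((1 - x) * ∑ k ∈ Finset.range N, x ^ (k / 2)) := by
          rw [Finset.sum_add_distrib, Finset.sum_range_sub, Finset.mul_sum, Finset.mul_sum]
          congr 1
          exact Finset.sum_congr rfl fun k _ => by ring
      _ ≤ (D / omegaHat ω x) + 2 * (D / omegaHat ω x) * 2 := by
          have := one_sub_mul_sum_pow_half_le h0 h1 N
          have h5 : 0 ≤ 2 * (D / omegaHat ω x) := by positivity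
          have := mul_le_mul_of_nonneg_left this h5
          linarith [hlN N, hl0 0]
      _ = _ := by ring
  rw [sum_mul_eq_summation_by_parts]
  calc _ ≤ ‖(l N : ℂ) * ∑ k ∈ Finset.range N, a k‖ + ∑ k ∈ Finset.range N,
          ‖((l k - l (k + 1) : ℝ) : ℂ) * ∑ j ∈ Finset.range (k + 1), a j‖ :=
        (norm_add_le _ _).trans (add_le_add_right (norm_sum_le _ _) _)
    _ ≤ D / omegaHat ω x * K + ∑ k ∈ Finset.range N, |l k - l (k + 1)| * K := by
        refine add_le_add ?_ (Finset.sum_le_sum fun k _ => ?_)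
        · rw [norm_mul, Complex.norm_real, Real.norm_of_nonneg (hl0 N)]
          exact mul_le_mul (hlN N) (ha N) (norm_nonneg _) (by positivity)
        · rw [norm_mul, Complex.norm_real, Real.norm_eq_abs]
          exact mul_le_mul_of_nonneg_left (ha _) (abs_nonneg _)
    _ ≤ D / omegaHat ω x * K + 5 * (D / omegaHat ω x) * K := by
        rw [← Finset.sum_mul]
        gcongr
    _ = _ := by ring

/-- The kernel estimate `‖∑ (x^k/ω_{2k+1}) û(k) conj v̂(k)‖ ≲ ‖u‖_p ‖v‖_{p'} / ω̂(x)`. -/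
lemma exists_kernel_bound {ω : ℝ → ℝ} (hω : IsRadialWeight ω)
    (hpos : ∀ r ∈ Set.Ico (0:ℝ) 1, 0 < omegaHat ω r) (hD : InDhat ω) {p p' : ℝ}
    (h : p.HolderConjugate p') :
    ∃ A > (0:ℝ), ∀ u : ℝ → ℂ, Continuous u → ∀ v : ℝ → ℂ, Continuous v →
      ∀ x : ℝ, 0 ≤ x → x < 1 →
      ‖∑' k, ((x ^ k / momentCoeff ω k : ℝ) : ℂ) * (fcoef u k * (starRingEnd ℂ) (fcoef v k))‖ ≤
        A / omegaHat ω x * (nrm p u * nrm p' v) := by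
  obtain ⟨A, hA, H⟩ := norm_sum_pairing_le h
  obtain ⟨D, hD0, HD⟩ := exists_norm_tsum_moment_le hω hpos hD
  refine ⟨D * A, by positivity, fun u hu v hv x h0 h1 => ?_⟩
  refine (HD _ _ (H u hu v hv) x h0 h1).2.trans (le_of_eq ?_)
  ring

lemma lintegral_antitone_comp_le {ν : Measure ℝ} {W : ℝ → ℝ} (hW : Measurable W)
    (hpos : ∀ r, 0 < W r) (hν : ∀ c, ν {r | W r ≤ c} ≤ ENNReal.ofReal c) {φ : ℝ → ℝ}
    (hφ0 : ∀ t, 0 < t → 0 ≤ φ t) (hφ : AntitoneOn φ (Ioi 0)) (hm : Measurable φ) :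
    ∫⁻ r, ENNReal.ofReal (φ (W r)) ∂ν ≤ ∫⁻ t in Ioi (0:ℝ), ENNReal.ofReal (φ t) := by
  rw [lintegral_eq_lintegral_meas_lt ν (ae_of_all _ fun r => hφ0 _ (hpos r))
    (hm.comp hW).aemeasurable,
    lintegral_eq_lintegral_meas_lt (volume.restrict (Ioi (0:ℝ))) ?_ hm.aemeasurable]
  · refine lintegral_mono fun s => ?_
    set U : Set ℝ := {t | 0 < t ∧ s < φ t} with hU
    have hres : volume.restrict (Ioi (0:ℝ)) {t | s < φ t} = volume U := by
      rw [Measure.restrict_apply (measurableSet_lt measurable_const hm)]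
      congr 1; ext t; simp [hU, and_comm]
    rw [hres]
    have hdown : ∀ t, 0 < t → ∀ u ∈ U, t ≤ u → t ∈ U := fun t ht u hu htu =>
      ⟨ht, hu.2.trans_le (hφ ht hu.1 htu)⟩
    rcases U.eq_empty_or_nonempty with he | hne
    · have : {r | s < φ (W r)} = ∅ := by
        ext r
        simp only [mem_ofPred_eq, mem_empty_iff_false, iff_false]
        intro hr
        have : W r ∈ U := ⟨hpos r, hr⟩
        rw [he] at this; exact this
      rw [this]; simp
    by_cases hb : BddAbove U
    · calc ν {r | s < φ (W r)} ≤ ν {r | W r ≤ sSup U} :=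
            measure_mono fun r hr => le_csSup hb ⟨hpos r, hr⟩
        _ ≤ ENNReal.ofReal (sSup U) := hν _
        _ = volume (Ioo 0 (sSup U)) := by rw [Real.volume_Ioo, sub_zero]
        _ ≤ volume U := measure_mono fun t ht => by
            obtain ⟨u, hu, htu⟩ := exists_lt_of_lt_csSup hne ht.2
            exact hdown t ht.1 u hu htu.le
    · have : Ioi (0:ℝ) ⊆ U := fun t ht => by
        obtain ⟨u, hu, htu⟩ := not_bddAbove_iff.1 hb t
        exact hdown t ht u hu htu.le
      have h2 := measure_mono (μ := volume) this
      rw [Real.volume_Ioi, top_le_iff] at h2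
      rw [h2]; exact le_top
  · filter_upwards [ae_restrict_mem measurableSet_Ioi] with t ht using hφ0 t ht

lemma lintegral_rpow_div_max_le {α : ℝ} (h0 : 0 < α) (h1 : α < 1) {T : ℝ} (hT : 0 < T) :
    ∫⁻ t in Ioi (0:ℝ), ENNReal.ofReal (t ^ (-α) / max T t) ≤
      ENNReal.ofReal ((1 / (1 - α) + 1 / α) * T ^ (-α)) := by
  have h2 : 0 < 1 - α := by linarith
  rw [← Ioc_union_Ioi_eq_Ioi hT.le, lintegral_union measurableSet_Ioi
    (Set.Ioc_disjoint_Ioi le_rfl), add_mul, ENNReal.ofReal_add (by positivity) (by positivity)]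
  refine add_le_add ?_ ?_
  · have hi : IntegrableOn (fun t : ℝ => t ^ (-α) / T) (Ioc 0 T) := by
      have := (intervalIntegral.intervalIntegrable_rpow' (a := 0) (b := T)
        (r := -α) (by linarith)).1
      exact this.div_const T
    calc _ = ∫⁻ t in Ioc 0 T, ENNReal.ofReal (t ^ (-α) / T) := by
          refine setLIntegral_congr_fun measurableSet_Ioc fun t ht => ?_
          simp only [max_eq_left ht.2]
      _ = ENNReal.ofReal (∫ t in Ioc 0 T, t ^ (-α) / T) := by
          rw [ofReal_integral_eq_lintegral_ofReal hi]
          filter_upwards [ae_restrict_mem measurableSet_Ioc] with t ht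
          have := ht.1
          positivity
      _ ≤ _ := by
          refine ENNReal.ofReal_le_ofReal (le_of_eq ?_)
          rw [integral_div, ← intervalIntegral.integral_of_le hT.le,
            integral_rpow (Or.inl (by linarith)), Real.zero_rpow (by linarith),
            Real.rpow_add_one hT.ne']
          have : -α + 1 ≠ 0 := by linarith
          have : 1 - α ≠ 0 := by linarith
          field_simp
          ring
  · calc _ = ∫⁻ t in Ioi T, ENNReal.ofReal (t ^ (-α - 1)) := by
          refine setLIntegral_congr_fun measurableSet_Ioi fun t ht => ?_
          have ht0 : 0 < t := hT.trans ht
          have hmax : max T t = t := max_eq_right (mem_Ioi.1 ht).le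
          simp only [hmax]
          rw [Real.rpow_sub_one ht0.ne']
      _ = ENNReal.ofReal (∫ t in Ioi T, t ^ (-α - 1)) := by
          rw [ofReal_integral_eq_lintegral_ofReal
            (integrableOn_Ioi_rpow_of_lt (by linarith) hT)]
          filter_upwards [ae_restrict_mem measurableSet_Ioi] with t ht
          have ht0 : 0 < t := hT.trans ht
          positivity
      _ ≤ _ := by
          refine ENNReal.ofReal_le_ofReal (le_of_eq ?_)
          rw [integral_Ioi_rpow_of_lt (by linarith) hT, sub_add_cancel]
          field_simp

/-- The kernel `1 / max (W s) (W r)`. -/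
def maxKernel (W : ℝ → ℝ) (s r : ℝ) : ℝ≥0∞ := ENNReal.ofReal (1 / max (W s) (W r))

lemma maxKernel_comm (W : ℝ → ℝ) (s r : ℝ) : maxKernel W s r = maxKernel W r s := by
  rw [maxKernel, maxKernel, max_comm]

lemma measurable_maxKernel {W : ℝ → ℝ} (hW : Measurable W) :
    Measurable fun x : ℝ × ℝ => maxKernel W x.1 x.2 := by
  unfold maxKernel
  fun_prop

lemma lintegral_maxKernel_mul_rpow_le {ν : Measure ℝ} {W : ℝ → ℝ} (hW : Measurable W)
    (hpos : ∀ r, 0 < W r) (hν : ∀ c, ν {r | W r ≤ c} ≤ ENNReal.ofReal c) {α : ℝ} (h0 : 0 < α)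
    (h1 : α < 1) (s : ℝ) :
    ∫⁻ r, maxKernel W s r * ENNReal.ofReal (W r ^ (-α)) ∂ν ≤
      ENNReal.ofReal (1 / (1 - α) + 1 / α) * ENNReal.ofReal (W s ^ (-α)) := by
  have h2 : 0 < 1 - α := by linarith
  rw [← ENNReal.ofReal_mul (by positivity)]
  refine le_trans (le_of_eq ?_) ((lintegral_antitone_comp_le hW hpos hν
    (φ := fun t => t ^ (-α) / max (W s) t) ?_ ?_ ?_).trans
    (lintegral_rpow_div_max_le h0 h1 (hpos s)))
  · refine lintegral_congr fun r => ?_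
    have := hpos s
    rw [maxKernel, ← ENNReal.ofReal_mul (by positivity)]
    congr 1; ring
  · intro t ht
    have := hpos s
    positivity
  · intro t ht u hu htu
    have := hpos s
    have ht' : 0 < t := ht
    have hu' : 0 < u := hu
    have h4 : u ^ (-α) ≤ t ^ (-α) := Real.rpow_le_rpow_of_nonpos ht' htu (by linarith)
    simp only
    gcongr
  · fun_prop

/-- Schur's test for the kernel `1 / max (W s) (W r)`. -/
lemma lintegral_maxKernel_rpow_le {ν : Measure ℝ} [SFinite ν] {W : ℝ → ℝ} (hW : Measurable W)
    (hpos : ∀ r, 0 < W r) (hν : ∀ c, ν {r | W r ≤ c} ≤ ENNReal.ofReal c) {q q' : ℝ}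
    (h : q.HolderConjugate q') {φ : ℝ → ℝ≥0∞} (hφ : Measurable φ) :
    ∫⁻ s, (∫⁻ r, maxKernel W s r * φ r ∂ν) ^ q ∂ν ≤
      ENNReal.ofReal (1 / (1 - 1 / q) + 1 / (1 / q)) ^ (q / q') *
      ENNReal.ofReal (1 / (1 - 1 / q') + 1 / (1 / q')) * ∫⁻ r, φ r ^ q ∂ν := by
  set C₁ := ENNReal.ofReal (1 / (1 - 1 / q) + 1 / (1 / q)) with hC₁
  set C₂ := ENNReal.ofReal (1 / (1 - 1 / q') + 1 / (1 / q')) with hC₂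
  have hq0 := h.pos
  have hq'0 := h.symm.pos
  have hK := measurable_maxKernel hW
  have hKs : ∀ s, Measurable (maxKernel W s) := fun s => hK.comp (measurable_const.prodMk measurable_id)
  set H : ℝ → ℝ≥0∞ := fun r => ENNReal.ofReal (W r ^ (-(1 / (q * q')))) with hH
  have hHm : Measurable H := by fun_prop
  have hH0 : ∀ r, H r ≠ 0 := fun r => by
    have := hpos r
    simp only [hH, ne_eq, ENNReal.ofReal_eq_zero, not_le]; positivity
  have hHt : ∀ r, H r ≠ ⊤ := fun r => ENNReal.ofReal_ne_top
  have hHq' : ∀ r, H r ^ q' = ENNReal.ofReal (W r ^ (-(1 / q))) := fun r => by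
    have := hpos r
    rw [hH, ENNReal.ofReal_rpow_of_nonneg (by positivity) hq'0.le, ← Real.rpow_mul this.le]
    congr 2; field_simp
  have hHq : ∀ r, H r ^ q = ENNReal.ofReal (W r ^ (-(1 / q'))) := fun r => by
    have := hpos r
    rw [hH, ENNReal.ofReal_rpow_of_nonneg (by positivity) hq0.le, ← Real.rpow_mul this.le]
    congr 2; field_simp
  have hpow : ∀ s, (∫⁻ r, maxKernel W s r * φ r ∂ν) ^ q ≤
      C₁ ^ (q / q') * (H s ^ q * ∫⁻ r, maxKernel W s r * ((H r)⁻¹ * φ r) ^ q ∂ν) := by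
    intro s
    have hol := ENNReal.lintegral_mul_le_Lp_mul_Lq ν h.symm
      (f := fun r => maxKernel W s r ^ (1 / q') * H r)
      (g := fun r => maxKernel W s r ^ (1 / q) * ((H r)⁻¹ * φ r))
      ((((hKs s).pow_const _).mul hHm).aemeasurable)
      ((((hKs s).pow_const _).mul (hHm.inv.mul hφ)).aemeasurable)
    have e1 : ∀ r, (maxKernel W s r ^ (1 / q') * H r) *
        (maxKernel W s r ^ (1 / q) * ((H r)⁻¹ * φ r)) = maxKernel W s r * φ r := by
      intro r
      have e : maxKernel W s r ^ (1 / q') * maxKernel W s r ^ (1 / q) = maxKernel W s r := by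
        rw [← ENNReal.rpow_add_of_nonneg _ _ (by positivity) (by positivity), one_div, one_div,
          h.symm.inv_add_inv_eq_one, ENNReal.rpow_one]
      calc _ = (maxKernel W s r ^ (1 / q') * maxKernel W s r ^ (1 / q)) *
            ((H r) * (H r)⁻¹) * φ r := by ring
        _ = _ := by rw [e, ENNReal.mul_inv_cancel (hH0 r) (hHt r), mul_one]
    simp only [Pi.mul_apply, e1] at hol
    have e2 : ∀ r, (maxKernel W s r ^ (1 / q') * H r) ^ q' =
        maxKernel W s r * ENNReal.ofReal (W r ^ (-(1 / q))) := by
      intro r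
      rw [ENNReal.mul_rpow_of_nonneg _ _ hq'0.le, hHq', ← ENNReal.rpow_mul,
        one_div_mul_cancel hq'0.ne', ENNReal.rpow_one]
    have e3 : ∀ r, (maxKernel W s r ^ (1 / q) * ((H r)⁻¹ * φ r)) ^ q =
        maxKernel W s r * ((H r)⁻¹ * φ r) ^ q := by
      intro r
      rw [ENNReal.mul_rpow_of_nonneg _ _ hq0.le, ← ENNReal.rpow_mul,
        one_div_mul_cancel hq0.ne', ENNReal.rpow_one]
    simp only [e2, e3] at hol
    have hb := lintegral_maxKernel_mul_rpow_le hW hpos hν (α := 1 / q) (by positivity)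
      ((div_lt_one hq0).2 h.lt) s
    calc _ ≤ ((∫⁻ r, maxKernel W s r * ENNReal.ofReal (W r ^ (-(1 / q))) ∂ν) ^ (1 / q') *
          (∫⁻ r, maxKernel W s r * ((H r)⁻¹ * φ r) ^ q ∂ν) ^ (1 / q)) ^ q := by gcongr
      _ ≤ ((C₁ * H s ^ q') ^ (1 / q') *
          (∫⁻ r, maxKernel W s r * ((H r)⁻¹ * φ r) ^ q ∂ν) ^ (1 / q)) ^ q := by
          rw [hHq']; gcongr
      _ = _ := by
          have x1 : 1 / q' * q = q / q' := by ring
          have x2 : q' * (1 / q' * q) = q := by field_simp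
          rw [ENNReal.mul_rpow_of_nonneg _ _ hq0.le, ← ENNReal.rpow_mul _ (1 / q) q,
            one_div_mul_cancel hq0.ne', ENNReal.rpow_one, ← ENNReal.rpow_mul _ (1 / q') q,
            ENNReal.mul_rpow_of_nonneg _ _ (by positivity), ← ENNReal.rpow_mul _ q', x2, x1,
            mul_assoc]
  calc _ ≤ ∫⁻ s, C₁ ^ (q / q') * (H s ^ q * ∫⁻ r, maxKernel W s r * ((H r)⁻¹ * φ r) ^ q ∂ν) ∂ν :=
        lintegral_mono hpow
    _ = C₁ ^ (q / q') * ∫⁻ s, ∫⁻ r, H s ^ q * (maxKernel W s r * ((H r)⁻¹ * φ r) ^ q) ∂ν ∂ν := by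
        rw [lintegral_const_mul']
        · congr 1
          refine lintegral_congr fun s => ?_
          have hm : Measurable fun r => maxKernel W s r * ((H r)⁻¹ * φ r) ^ q :=
            (hKs s).mul ((hHm.inv.mul hφ).pow_const _)
          exact (lintegral_const_mul _ hm).symm
        · exact ENNReal.rpow_ne_top_of_nonneg (by positivity) ENNReal.ofReal_ne_top
    _ = C₁ ^ (q / q') * ∫⁻ r, ∫⁻ s, H s ^ q * (maxKernel W s r * ((H r)⁻¹ * φ r) ^ q) ∂ν ∂ν := by
        rw [lintegral_lintegral_swap]
        refine Measurable.aemeasurable ?_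
        exact ((hHm.comp measurable_fst).pow_const _).mul
          (hK.mul (((hHm.inv.mul hφ).comp measurable_snd).pow_const _))
    _ ≤ C₁ ^ (q / q') * ∫⁻ r, C₂ * φ r ^ q ∂ν := by
        gcongr with r
        have hb := lintegral_maxKernel_mul_rpow_le hW hpos hν (α := 1 / q') (by positivity)
          ((div_lt_one hq'0).2 h.symm.lt) r
        have hm : Measurable fun s => maxKernel W r s * H s ^ q :=
          (hKs r).mul (hHm.pow_const _)
        calc _ = ∫⁻ s, (maxKernel W r s * H s ^ q) * ((H r)⁻¹ * φ r) ^ q ∂ν := by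
              refine lintegral_congr fun s => ?_
              rw [maxKernel_comm W s r]; ring
          _ = (∫⁻ s, maxKernel W r s * H s ^ q ∂ν) * ((H r)⁻¹ * φ r) ^ q :=
              lintegral_mul_const _ hm
          _ ≤ (C₂ * H r ^ q) * ((H r)⁻¹ * φ r) ^ q := by
              simp only [hHq]
              gcongr
          _ = C₂ * ((H r * (H r)⁻¹) * φ r) ^ q := by
              rw [mul_assoc, ← ENNReal.mul_rpow_of_nonneg _ _ hq0.le, mul_assoc]
          _ = _ := by rw [ENNReal.mul_inv_cancel (hH0 r) (hHt r), one_mul]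
    _ = _ := by
        rw [lintegral_const_mul _ (hφ.pow_const _), mul_assoc]

/-- The measure `r ω(r) dr` on `(0,1)`. -/
def wmeas (ω : ℝ → ℝ) : Measure ℝ :=
  (volume.restrict (Ioo (0:ℝ) 1)).withDensity fun r => ENNReal.ofReal (r * ω r)

lemma ae_wmeas (ω : ℝ → ℝ) : ∀ᵐ r ∂(wmeas ω), r ∈ Ioo (0:ℝ) 1 :=
  (withDensity_absolutelyContinuous _ _).ae_le (ae_restrict_mem measurableSet_Ioo)

lemma IsRadialWeight.integrableOn_density {ω : ℝ → ℝ} (hω : IsRadialWeight ω) :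
    IntegrableOn (fun r => r * ω r) (Ioo (0:ℝ) 1) := by
  simpa using integrableOn_pow_mul hω 1

lemma lintegral_wmeas {ω : ℝ → ℝ} (hω : IsRadialWeight ω) (F : ℝ → ℝ≥0∞) :
    ∫⁻ r, F r ∂(wmeas ω) = ∫⁻ r in Ioo (0:ℝ) 1, F r * ENNReal.ofReal (r * ω r) := by
  rw [wmeas, lintegral_withDensity_eq_lintegral_mul_non_measurable₀ _
    hω.integrableOn_density.aemeasurable.ennreal_ofReal (ae_of_all _ fun _ => ENNReal.ofReal_lt_top)]
  simp only [Pi.mul_apply, mul_comm]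

lemma LpqNormE_eq {ω : ℝ → ℝ} (hω : IsRadialWeight ω) (p q : ℝ) (f : ℂ → ℂ) :
    LpqNormE ω p q f = (∫⁻ r, MpE p r f ^ q ∂(wmeas ω)) ^ (1 / q) := by
  rw [lintegral_wmeas hω, LpqNormE]

lemma isFiniteMeasure_wmeas {ω : ℝ → ℝ} (hω : IsRadialWeight ω) : IsFiniteMeasure (wmeas ω) :=
  isFiniteMeasure_withDensity_ofReal hω.integrableOn_density.2

lemma momentCoeff_eq_wmeas {ω : ℝ → ℝ} (hω : IsRadialWeight ω) (k : ℕ) :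
    momentCoeff ω k = ∫ r, r ^ (2 * k) ∂(wmeas ω) := by
  rw [wmeas, integral_withDensity_eq_integral_toReal_smul₀
    hω.integrableOn_density.aemeasurable.ennreal_ofReal
    (ae_of_all _ fun _ => ENNReal.ofReal_lt_top), momentCoeff_eq]
  refine setIntegral_congr_fun measurableSet_Ioo fun r hr => ?_
  have := hω.1 r ⟨hr.1.le, hr.2⟩
  have h0 := hr.1
  simp only [smul_eq_mul]
  rw [ENNReal.toReal_ofReal (by positivity)]
  ring

lemma measurable_indicator_of_continuousOn {X E : Type*} [TopologicalSpace X] [MeasurableSpace X]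
    [OpensMeasurableSpace X] [TopologicalSpace E] [MeasurableSpace E] [BorelSpace E] [Zero E]
    {f : X → E} {s : Set X} (hf : ContinuousOn f s) (hs : MeasurableSet s) :
    Measurable (s.indicator f) := by
  classical
  rw [← piecewise_eq_indicator]
  exact hf.measurable_piecewise continuousOn_const hs

/-- `ω̂` on `(0,1)`, extended by `1`. -/
def tailW (ω : ℝ → ℝ) (r : ℝ) : ℝ := (Ioo (0:ℝ) 1).indicator (fun r => omegaHat ω r - 1) r + 1

lemma tailW_of_mem {ω : ℝ → ℝ} {r : ℝ} (hr : r ∈ Ioo (0:ℝ) 1) : tailW ω r = omegaHat ω r := by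
  simp [tailW, hr]

lemma tailW_pos {ω : ℝ → ℝ} (hpos : ∀ r ∈ Ico (0:ℝ) 1, 0 < omegaHat ω r) (r : ℝ) :
    0 < tailW ω r := by
  by_cases hr : r ∈ Ioo (0:ℝ) 1
  · rw [tailW_of_mem hr]; exact hpos r ⟨hr.1.le, hr.2⟩
  · simp [tailW, hr]

lemma continuousOn_omegaHat {ω : ℝ → ℝ} (hω : IsRadialWeight ω) :
    ContinuousOn (omegaHat ω) (Icc 0 1) := by
  have h : IntegrableOn ω (uIcc 0 1) := by
    rw [uIcc_of_le zero_le_one, integrableOn_Icc_iff_integrableOn_Ico]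
    exact hω.2
  have := intervalIntegral.continuousOn_primitive_interval_left h
  rwa [uIcc_of_le zero_le_one] at this

lemma measurable_tailW {ω : ℝ → ℝ} (hω : IsRadialWeight ω) : Measurable (tailW ω) := by
  refine Measurable.add_const ?_ 1
  have hc : ContinuousOn (fun r => omegaHat ω r - 1) (Ioo (0:ℝ) 1) :=
    ((continuousOn_omegaHat hω).mono Ioo_subset_Icc_self).sub continuousOn_const
  exact measurable_indicator_of_continuousOn hc measurableSet_Ioo

lemma wmeas_tailW_le {ω : ℝ → ℝ} (hω : IsRadialWeight ω) (c : ℝ) :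
    wmeas ω {r | tailW ω r ≤ c} ≤ ENNReal.ofReal c := by
  set S : Set ℝ := {r | r ∈ Ioo (0:ℝ) 1 ∧ omegaHat ω r ≤ c} with hS
  have h1 : wmeas ω {r | tailW ω r ≤ c} ≤ wmeas ω S := by
    refine measure_mono_ae ?_
    filter_upwards [ae_wmeas ω] with r hr h
    exact ⟨hr, by rw [← tailW_of_mem hr]; exact h⟩
  refine h1.trans ?_
  rcases S.eq_empty_or_nonempty with he | hne
  · rw [he]; simp
  have hb : BddBelow S := ⟨0, fun r hr => hr.1.1.le⟩
  set a := sInf S with ha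
  have ha0 : 0 ≤ a := le_csInf hne fun r hr => hr.1.1.le
  have ha1 : a ≤ 1 := by
    obtain ⟨r, hr⟩ := hne
    exact (csInf_le hb hr).trans hr.1.2.le
  have hac : omegaHat ω a ≤ c := by
    have hcl : a ∈ closure S := csInf_mem_closure hne hb
    have hsub : S ⊆ Icc 0 1 := fun r hr => ⟨hr.1.1.le, hr.1.2.le⟩
    have hcw : ContinuousWithinAt (omegaHat ω) S a :=
      ((continuousOn_omegaHat hω) a ⟨ha0, ha1⟩).mono hsub
    have : omegaHat ω a ∈ closure (omegaHat ω '' S) := hcw.mem_closure_image hcl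
    refine closure_minimal ?_ isClosed_Iic this
    rintro _ ⟨r, hr, rfl⟩
    exact hr.2
  have hi : IntegrableOn ω (Ioo a 1) := hω.integrableOn_Ioo ha0
  have hi2 : IntegrableOn ω (Ico a 1) := by rwa [integrableOn_Ico_iff_integrableOn_Ioo]
  calc wmeas ω S ≤ wmeas ω (Ico a 1) := measure_mono fun r hr => ⟨csInf_le hb hr, hr.1.2⟩
    _ = ∫⁻ r in Ico a 1, ENNReal.ofReal (r * ω r) ∂(volume.restrict (Ioo (0:ℝ) 1)) := by
        rw [wmeas, withDensity_apply _ measurableSet_Ico]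
    _ = ∫⁻ r in Ico a 1 ∩ Ioo 0 1, ENNReal.ofReal (r * ω r) := by
        rw [Measure.restrict_restrict measurableSet_Ico]
    _ ≤ ∫⁻ r in Ico a 1 ∩ Ioo 0 1, ENNReal.ofReal (ω r) := by
        refine setLIntegral_mono' (measurableSet_Ico.inter measurableSet_Ioo) fun r hr => ?_
        refine ENNReal.ofReal_le_ofReal ?_
        have := hω.1 r ⟨hr.2.1.le, hr.2.2⟩
        nlinarith [hr.2.2]
    _ ≤ ∫⁻ r in Ico a 1, ENNReal.ofReal (ω r) := lintegral_mono_set inter_subset_left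
    _ = ENNReal.ofReal (∫ r in Ico a 1, ω r) := by
        rw [ofReal_integral_eq_lintegral_ofReal hi2]
        filter_upwards [ae_restrict_mem measurableSet_Ico] with r hr
        exact hω.1 r ⟨ha0.trans hr.1, hr.2⟩
    _ ≤ ENNReal.ofReal c := by
        refine ENNReal.ofReal_le_ofReal ?_
        rw [integral_Ico_eq_integral_Ioo, ← omegaHat_eq ha1]
        exact hac

lemma measurable_circlePt : Measurable fun x : ℝ × ℝ => circlePt x.1 x.2 := by
  unfold circlePt
  fun_prop

lemma measurable_nrm_circle {F : ℂ → ℂ} (hF : Measurable F) (p : ℝ) :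
    Measurable fun r => nrm p fun θ => F (circlePt r θ) := by
  have h : Measurable fun x : ℝ × ℝ => ‖F (circlePt x.1 x.2)‖ ^ p :=
    (hF.comp measurable_circlePt).norm.pow_const p
  exact (h.stronglyMeasurable.integral_prod_right (ν := circMeas)).measurable.pow_const _

lemma measurable_indicator_ball {f : ℂ → ℂ} (hf : DifferentiableOn ℂ f (Metric.ball 0 1)) :
    Measurable ((Metric.ball (0:ℂ) 1).indicator f) :=
  measurable_indicator_of_continuousOn hf.continuousOn measurableSet_ball

lemma indicator_circlePt (f : ℂ → ℂ) {r : ℝ} (h0 : 0 ≤ r) (h1 : r < 1) (θ : ℝ) :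
    (Metric.ball (0:ℂ) 1).indicator f (circlePt r θ) = f (circlePt r θ) := by
  refine indicator_of_mem ?_ f
  rw [mem_ball_zero_iff, norm_circlePt h0]
  exact h1

lemma aemeasurable_nrm_circle (ω : ℝ → ℝ) {f : ℂ → ℂ}
    (hf : DifferentiableOn ℂ f (Metric.ball 0 1)) (p : ℝ) :
    AEMeasurable (fun r => nrm p fun θ => f (circlePt r θ)) (wmeas ω) := by
  refine ⟨_, measurable_nrm_circle (measurable_indicator_ball hf) p, ?_⟩
  filter_upwards [ae_wmeas ω] with r hr
  simp only [indicator_circlePt f hr.1.le hr.2]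

lemma LpqNormE_eq_nrm {ω : ℝ → ℝ} (hω : IsRadialWeight ω) {p : ℝ} (hp : 0 < p) {q : ℝ}
    (hq : 0 ≤ q) {f : ℂ → ℂ} (hf : DifferentiableOn ℂ f (Metric.ball 0 1)) :
    LpqNormE ω p q f =
      (∫⁻ r, ENNReal.ofReal ((nrm p fun θ => f (circlePt r θ)) ^ q) ∂(wmeas ω)) ^ (1 / q) := by
  rw [LpqNormE_eq hω]
  congr 1
  refine lintegral_congr_ae ?_
  filter_upwards [ae_wmeas ω] with r hr
  rw [MpE_eq_nrm hp hf hr.1.le hr.2, ENNReal.ofReal_rpow_of_nonneg (nrm_nonneg _ _) hq]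

lemma LpqNormE_eq_eLpNorm {ω : ℝ → ℝ} (hω : IsRadialWeight ω) {p : ℝ} (hp : 0 < p) {q : ℝ}
    (hq : 0 < q) {f : ℂ → ℂ} (hf : DifferentiableOn ℂ f (Metric.ball 0 1)) :
    LpqNormE ω p q f =
      eLpNorm (fun r => nrm p fun θ => f (circlePt r θ)) (ENNReal.ofReal q) (wmeas ω) := by
  rw [eLpNorm_eq_lintegral_rpow_enorm_toReal (by simpa using hq) ENNReal.ofReal_ne_top,
    ENNReal.toReal_ofReal hq.le, LpqNormE_eq_nrm hω hp hq.le hf]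
  congr 1
  refine lintegral_congr fun r => ?_
  rw [Real.enorm_eq_ofReal (nrm_nonneg _ _), ENNReal.ofReal_rpow_of_nonneg (nrm_nonneg _ _) hq.le]

lemma InApq.memLp {ω : ℝ → ℝ} (hω : IsRadialWeight ω) {p : ℝ} (hp : 0 < p) {q : ℝ}
    (hq : 0 < q) {f : ℂ → ℂ} (hf : InApq ω p q f) :
    MemLp (fun r => nrm p fun θ => f (circlePt r θ)) (ENNReal.ofReal q) (wmeas ω) :=
  ⟨(aemeasurable_nrm_circle ω hf.1 p).aestronglyMeasurable,
    LpqNormE_eq_eLpNorm hω hp hq hf.1 ▸ hf.2⟩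

lemma toReal_LpqNormE {ω : ℝ → ℝ} (hω : IsRadialWeight ω) {p : ℝ} (hp : 0 < p) {q : ℝ}
    (hq : 0 < q) {f : ℂ → ℂ} (hf : InApq ω p q f) :
    (LpqNormE ω p q f).toReal =
      (∫ r, ‖nrm p fun θ => f (circlePt r θ)‖ ^ q ∂(wmeas ω)) ^ (1 / q) := by
  rw [LpqNormE_eq_eLpNorm hω hp hq hf.1, (hf.memLp hω hp hq).eLpNorm_eq_integral_rpow_norm
    (by simpa using hq) ENNReal.ofReal_ne_top, ENNReal.toReal_ofReal hq.le,
    ENNReal.toReal_ofReal (by positivity), one_div]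

/-- The mean of `f(ρ r e^{iθ}) conj g(r e^{iθ})` over the circle. -/
def pairMean (f g : ℂ → ℂ) (ρ r : ℝ) : ℂ :=
  ∫ θ, f (circlePt (ρ * r) θ) * (starRingEnd ℂ) (g (circlePt r θ)) ∂circMeas

lemma summable_norm_taylorCoeff_mul {f g : ℂ → ℂ} (hf : DifferentiableOn ℂ f (Metric.ball 0 1))
    (hg : DifferentiableOn ℂ g (Metric.ball 0 1)) {x : ℝ} (h0 : 0 ≤ x) (h1 : x < 1) :
    Summable fun k => ‖taylorCoeff f k‖ * ‖taylorCoeff g k‖ * x ^ k := by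
  have hs0 := Real.sqrt_nonneg x
  have hs1 : √x < 1 := by rw [Real.sqrt_lt' one_pos]; simpa using h1
  have hsf := summable_taylorCoeff hf hs0 hs1
  have hsg := summable_taylorCoeff hg hs0 hs1
  refine Summable.of_nonneg_of_le (fun k => by positivity) (fun k => ?_)
    (hsf.mul_right (∑' k, ‖taylorCoeff g k‖ * √x ^ k))
  have h2 : ‖taylorCoeff g k‖ * √x ^ k ≤ ∑' k, ‖taylorCoeff g k‖ * √x ^ k :=
    hsg.le_tsum k fun j _ => by positivity
  calc _ = (‖taylorCoeff f k‖ * √x ^ k) * (‖taylorCoeff g k‖ * √x ^ k) := by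
        conv_lhs => rw [← Real.mul_self_sqrt h0]
        rw [mul_pow]; ring
    _ ≤ _ := by gcongr

lemma hasSum_pairMean {f g : ℂ → ℂ} (hf : DifferentiableOn ℂ f (Metric.ball 0 1))
    (hg : DifferentiableOn ℂ g (Metric.ball 0 1)) {ρ r : ℝ} (h0 : 0 ≤ ρ) (h1 : ρ ≤ 1)
    (hr0 : 0 ≤ r) (hr1 : r < 1) :
    HasSum (fun k => taylorCoeff f k * (starRingEnd ℂ) (taylorCoeff g k) * (ρ:ℂ) ^ k *
      ((r ^ (2 * k) : ℝ) : ℂ)) (pairMean f g ρ r) := by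
  have hx0 : 0 ≤ ρ * r := by positivity
  have hx1 : ρ * r < 1 := by nlinarith
  have h := hasSum_pairing (summable_taylorCoeff_mul_pow hf hx0 hx1)
    (continuous_circlePt_comp hg hr0 hr1)
  simp only [fcoef_circle hg hr0 hr1, ← circle_series hf hx0 hx1] at h
  refine h.congr_fun fun k => ?_
  rw [map_mul, map_pow, Complex.conj_ofReal]
  push_cast
  ring

lemma aestronglyMeasurable_pairMean (ω : ℝ → ℝ) {f g : ℂ → ℂ}
    (hf : DifferentiableOn ℂ f (Metric.ball 0 1)) (hg : DifferentiableOn ℂ g (Metric.ball 0 1))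
    {ρ : ℝ} (h0 : 0 ≤ ρ) (h1 : ρ ≤ 1) : AEStronglyMeasurable (pairMean f g ρ) (wmeas ω) := by
  have hF := measurable_indicator_ball hf
  have hG := measurable_indicator_ball hg
  have hm : Measurable fun x : ℝ × ℝ => (Metric.ball (0:ℂ) 1).indicator f (circlePt (ρ * x.1) x.2) *
      (starRingEnd ℂ) ((Metric.ball (0:ℂ) 1).indicator g (circlePt x.1 x.2)) := by
    have hd : Measurable fun x : ℝ × ℝ => (ρ * x.1, x.2) := by fun_prop
    refine (hF.comp (measurable_circlePt.comp hd)).mul ?_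
    exact Complex.continuous_conj.measurable.comp (hG.comp measurable_circlePt)
  refine ⟨_, hm.stronglyMeasurable.integral_prod_right' (ν := circMeas), ?_⟩
  filter_upwards [ae_wmeas ω] with r hr
  have := hr.1
  have hx1 : ρ * r < 1 := by nlinarith [hr.2]
  simp only [indicator_circlePt f (by positivity : 0 ≤ ρ * r) hx1,
    indicator_circlePt g hr.1.le hr.2]
  rfl

lemma norm_pairMean_le {p p' : ℝ} (h : p.HolderConjugate p') {f g : ℂ → ℂ}
    (hf : DifferentiableOn ℂ f (Metric.ball 0 1)) (hg : DifferentiableOn ℂ g (Metric.ball 0 1))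
    {ρ r : ℝ} (h0 : 0 ≤ ρ) (h1 : ρ ≤ 1) (hr0 : 0 ≤ r) (hr1 : r < 1) :
    ‖pairMean f g ρ r‖ ≤
      (nrm p fun θ => f (circlePt r θ)) * nrm p' fun θ => g (circlePt r θ) :=
  (norm_integral_mul_conj_le h (continuous_circlePt_comp hf (by positivity) (by nlinarith))
    (continuous_circlePt_comp hg hr0 hr1)).trans
    (mul_le_mul_of_nonneg_right (nrm_circle_mono h.lt hf h0 h1 hr0 hr1) (nrm_nonneg _ _))

lemma hasSum_moment_pairing {ω : ℝ → ℝ} (hω : IsRadialWeight ω) {f g : ℂ → ℂ}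
    (hf : DifferentiableOn ℂ f (Metric.ball 0 1)) (hg : DifferentiableOn ℂ g (Metric.ball 0 1))
    {ρ : ℝ} (h0 : 0 ≤ ρ) (h1 : ρ < 1) :
    HasSum (fun k => taylorCoeff f k * (starRingEnd ℂ) (taylorCoeff g k) *
      ((momentCoeff ω k : ℝ) : ℂ) * (ρ:ℂ) ^ k) (∫ r, pairMean f g ρ r ∂(wmeas ω)) := by
  have := isFiniteMeasure_wmeas hω
  have h_int : ∀ k : ℕ, Integrable (fun r : ℝ => r ^ (2 * k)) (wmeas ω) := fun k => by
    refine Integrable.of_bound (C := 1) (by fun_prop) ?_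
    filter_upwards [ae_wmeas ω] with r hr
    rw [Real.norm_of_nonneg (pow_nonneg hr.1.le _)]
    exact pow_le_one₀ hr.1.le hr.2.le
  set F : ℕ → ℝ → ℂ := fun k r => taylorCoeff f k * (starRingEnd ℂ) (taylorCoeff g k) *
    (ρ:ℂ) ^ k * ((r ^ (2 * k) : ℝ) : ℂ) with hF
  have hFi : ∀ k, Integrable (F k) (wmeas ω) := fun k => (h_int k).ofReal.const_mul _
  have hmom : ∀ k, ∫ r, ‖F k r‖ ∂(wmeas ω) =
      ‖taylorCoeff f k‖ * ‖taylorCoeff g k‖ * ρ ^ k * momentCoeff ω k := fun k => by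
    rw [momentCoeff_eq_wmeas hω, ← integral_const_mul]
    refine integral_congr_ae ?_
    filter_upwards [ae_wmeas ω] with r hr
    simp only [hF, norm_mul, norm_pow, RCLike.norm_conj, Complex.norm_real, Real.norm_eq_abs,
      abs_of_nonneg h0, abs_of_nonneg hr.1.le]
  have hle : ∀ k, momentCoeff ω k ≤ momentCoeff ω 0 := fun k =>
    antitone_nat_of_succ_le (momentCoeff_anti hω) (Nat.zero_le k)
  have hs : Summable fun k => ∫ r, ‖F k r‖ ∂(wmeas ω) := by
    refine Summable.of_nonneg_of_le (fun k => by positivity) (fun k => ?_)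
      ((summable_norm_taylorCoeff_mul hf hg h0 h1).mul_right (momentCoeff ω 0))
    rw [hmom]
    exact mul_le_mul_of_nonneg_left (hle k) (by positivity)
  have hsum := hasSum_integral_of_summable_integral_norm hFi hs
  have e1 : ∫ r, ∑' k, F k r ∂(wmeas ω) = ∫ r, pairMean f g ρ r ∂(wmeas ω) := by
    refine integral_congr_ae ?_
    filter_upwards [ae_wmeas ω] with r hr
    exact (hasSum_pairMean hf hg h0 h1.le hr.1.le hr.2).tsum_eq
  rw [e1] at hsum
  refine hsum.congr_fun fun k => ?_
  rw [hF]
  simp only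
  rw [integral_const_mul, integral_complex_ofReal, ← momentCoeff_eq_wmeas hω]
  ring

lemma integrable_nrm_mul_nrm {ω : ℝ → ℝ} (hω : IsRadialWeight ω) {p q p' q' : ℝ}
    (hp : p.HolderConjugate p') (hq : q.HolderConjugate q') {f g : ℂ → ℂ}
    (hf : InApq ω p q f) (hg : InApq ω p' q' g) :
    Integrable (fun r => (nrm p fun θ => f (circlePt r θ)) *
      nrm p' fun θ => g (circlePt r θ)) (wmeas ω) := by
  have := hq.ennrealOfReal
  exact (hf.memLp hω hp.pos hq.pos).integrable_mul (hg.memLp hω hp.symm.pos hq.symm.pos)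

lemma tendsto_integral_pairMean {ω : ℝ → ℝ} (hω : IsRadialWeight ω) {p q p' q' : ℝ}
    (hp : p.HolderConjugate p') (hq : q.HolderConjugate q') {f g : ℂ → ℂ}
    (hf : InApq ω p q f) (hg : InApq ω p' q' g) :
    Tendsto (fun ρ : ℝ => ∫ r, pairMean f g ρ r ∂(wmeas ω)) (nhdsWithin 1 (Iio 1))
      (nhds (∫ r, pairMean f g 1 r ∂(wmeas ω))) := by
  have hev : ∀ᶠ ρ : ℝ in nhdsWithin 1 (Iio 1), ρ ∈ Ico (0:ℝ) 1 :=
    Ico_mem_nhdsLT zero_lt_one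
  refine tendsto_integral_filter_of_dominated_convergence _ ?_ ?_
    (integrable_nrm_mul_nrm hω hp hq hf hg) ?_
  · filter_upwards [hev] with ρ hρ
    exact aestronglyMeasurable_pairMean ω hf.1 hg.1 hρ.1 hρ.2.le
  · filter_upwards [hev] with ρ hρ
    filter_upwards [ae_wmeas ω] with r hr
    exact norm_pairMean_le hp hf.1 hg.1 hρ.1 hρ.2.le hr.1.le hr.2
  · filter_upwards [ae_wmeas ω] with r hr
    have hsum := (hasSum_pairMean hf.1 hg.1 zero_le_one le_rfl hr.1.le hr.2)
    rw [← hsum.tsum_eq]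
    refine (tendsto_tsum_of_dominated_convergence (f := fun (ρ : ℝ) k => taylorCoeff f k *
      (starRingEnd ℂ) (taylorCoeff g k) * (ρ:ℂ) ^ k * ((r ^ (2 * k) : ℝ) : ℂ))
      hsum.summable.norm (fun k => ?_) ?_).congr' ?_
    · refine Tendsto.mono_left ?_ nhdsWithin_le_nhds
      exact Continuous.tendsto (by fun_prop) 1
    · filter_upwards [hev] with ρ hρ k
      simp only [norm_mul, norm_pow, Complex.norm_real, Real.norm_eq_abs, abs_of_nonneg hρ.1,
        abs_one, one_pow]
      gcongr
      exact pow_le_one₀ hρ.1 hρ.2.le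
    · filter_upwards [hev] with ρ hρ
      exact (hasSum_pairMean hf.1 hg.1 hρ.1 hρ.2.le hr.1.le hr.2).tsum_eq

lemma hasPairingC_integral {ω : ℝ → ℝ} (hω : IsRadialWeight ω) {p q p' q' : ℝ}
    (hp : p.HolderConjugate p') (hq : q.HolderConjugate q') {f g : ℂ → ℂ}
    (hf : InApq ω p q f) (hg : InApq ω p' q' g) :
    HasPairingC (momentCoeff ω) f g (∫ r, pairMean f g 1 r ∂(wmeas ω)) := by
  refine ⟨fun ρ hρ => (hasSum_moment_pairing hω hf.1 hg.1 hρ.1 hρ.2).summable, ?_⟩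
  refine (tendsto_integral_pairMean hω hp hq hf hg).congr' ?_
  filter_upwards [Ico_mem_nhdsLT (zero_lt_one (α := ℝ))] with ρ hρ
  exact (hasSum_moment_pairing hω hf.1 hg.1 hρ.1 hρ.2).tsum_eq.symm

lemma norm_integral_pairMean_le {ω : ℝ → ℝ} (hω : IsRadialWeight ω) {p q p' q' : ℝ}
    (hp : p.HolderConjugate p') (hq : q.HolderConjugate q') {f g : ℂ → ℂ}
    (hf : InApq ω p q f) (hg : InApq ω p' q' g) :
    ‖∫ r, pairMean f g 1 r ∂(wmeas ω)‖ ≤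
      (LpqNormE ω p' q' g).toReal * (LpqNormE ω p q f).toReal := by
  rw [mul_comm, toReal_LpqNormE hω hp.pos hq.pos hf, toReal_LpqNormE hω hp.symm.pos hq.symm.pos hg]
  refine le_trans ?_ (integral_mul_norm_le_Lp_mul_Lq hq (hf.memLp hω hp.pos hq.pos)
    (hg.memLp hω hp.symm.pos hq.symm.pos))
  refine norm_integral_le_of_norm_le ?_ ?_
  · simpa only [Real.norm_of_nonneg (nrm_nonneg _ _)] using integrable_nrm_mul_nrm hω hp hq hf hg
  · filter_upwards [ae_wmeas ω] with r hr
    simpa only [Real.norm_of_nonneg (nrm_nonneg _ _)] using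
      norm_pairMean_le hp hf.1 hg.1 zero_le_one le_rfl hr.1.le hr.2

lemma nrm_sub_le {p : ℝ} (hp : 1 ≤ p) {u v : ℝ → ℂ} (hu : MemLp u (ENNReal.ofReal p) circMeas)
    (hv : MemLp v (ENNReal.ofReal p) circMeas) :
    nrm p (fun θ => u θ - v θ) ≤ nrm p u + nrm p v := by
  have key : ∀ w : ℝ → ℂ, MemLp w (ENNReal.ofReal p) circMeas →
      eLpNorm w (ENNReal.ofReal p) circMeas = ENNReal.ofReal (nrm p w) := fun w hw => by
    rw [hw.eLpNorm_eq_integral_rpow_norm (by simp; linarith) ENNReal.ofReal_ne_top,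
      ENNReal.toReal_ofReal (by linarith), nrm, one_div]
  have h := eLpNorm_sub_le (p := ENNReal.ofReal p) hu.1 hv.1 (by simpa using hp)
  rw [key u hu, key v hv, key _ (hu.sub hv), ← ENNReal.ofReal_add (nrm_nonneg _ _)
    (nrm_nonneg _ _), ENNReal.ofReal_le_ofReal_iff (add_nonneg (nrm_nonneg _ _)
    (nrm_nonneg _ _))] at h
  exact h

lemma LpqNormE_le_of_bound {ω : ℝ → ℝ} (hω : IsRadialWeight ω) {p q : ℝ} (hp : 0 < p)
    (hq : 0 < q) {f : ℂ → ℂ} (hf : DifferentiableOn ℂ f (Metric.ball 0 1)) {B : ℝ} (hB : 0 ≤ B)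
    (hfB : ∀ z ∈ Metric.ball (0:ℂ) 1, ‖f z‖ ≤ B) :
    LpqNormE ω p q f ≤ wmeas ω univ ^ q⁻¹ * ENNReal.ofReal B := by
  rw [LpqNormE_eq_eLpNorm hω hp hq hf]
  have h := eLpNorm_le_of_ae_bound (μ := wmeas ω) (p := ENNReal.ofReal q)
    (f := fun r => nrm p fun θ => f (circlePt r θ)) (C := B) ?_
  · rwa [ENNReal.toReal_ofReal hq.le] at h
  · filter_upwards [ae_wmeas ω] with r hr
    rw [Real.norm_of_nonneg (nrm_nonneg _ _)]
    refine nrm_le_of_bound hp (continuous_circlePt_comp hf hr.1.le hr.2) hB fun θ => hfB _ ?_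
    rw [mem_ball_zero_iff, norm_circlePt hr.1.le]
    exact hr.2

lemma inApq_of_bound {ω : ℝ → ℝ} (hω : IsRadialWeight ω) {p q : ℝ} (hp : 0 < p)
    (hq : 0 < q) {f : ℂ → ℂ} (hf : DifferentiableOn ℂ f (Metric.ball 0 1)) {B : ℝ} (hB : 0 ≤ B)
    (hfB : ∀ z ∈ Metric.ball (0:ℂ) 1, ‖f z‖ ≤ B) : InApq ω p q f := by
  have := isFiniteMeasure_wmeas hω
  refine ⟨hf, (LpqNormE_le_of_bound hω hp hq hf hB hfB).trans_lt ?_⟩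
  exact ENNReal.mul_lt_top (ENNReal.rpow_lt_top_of_nonneg (by positivity) (measure_ne_top _ _))
    ENNReal.ofReal_lt_top

lemma inApq_pow {ω : ℝ → ℝ} (hω : IsRadialWeight ω) {p q : ℝ} (hp : 0 < p)
    (hq : 0 < q) (k : ℕ) : InApq ω p q fun z => z ^ k := by
  refine inApq_of_bound hω hp hq (by fun_prop) zero_le_one fun z hz => ?_
  rw [norm_pow]
  exact pow_le_one₀ (norm_nonneg _) (mem_ball_zero_iff.1 hz).le

lemma InApq.sub {ω : ℝ → ℝ} (hω : IsRadialWeight ω) {p q : ℝ} (hp : 1 < p)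
    (hq : 1 < q) {f g : ℂ → ℂ} (hf : InApq ω p q f) (hg : InApq ω p q g) :
    InApq ω p q (f - g) := by
  have hp0 := zero_lt_one.trans hp
  have hq0 := zero_lt_one.trans hq
  have hd := hf.1.sub hg.1
  refine ⟨hd, ?_⟩
  rw [LpqNormE_eq_eLpNorm hω hp0 hq0 hd]
  refine lt_of_le_of_lt (eLpNorm_mono_ae ?_)
    ((hf.memLp hω hp0 hq0).add (hg.memLp hω hp0 hq0)).2
  filter_upwards [ae_wmeas ω] with r hr
  rw [Real.norm_of_nonneg (nrm_nonneg _ _), Pi.add_apply,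
    Real.norm_of_nonneg (add_nonneg (nrm_nonneg _ _) (nrm_nonneg _ _))]
  exact nrm_sub_le hp.le ((continuous_circlePt_comp hf.1 hr.1.le hr.2).memLp_circMeas _)
    ((continuous_circlePt_comp hg.1 hr.1.le hr.2).memLp_circMeas _)

lemma InApq.smul {ω : ℝ → ℝ} (hω : IsRadialWeight ω) {p q : ℝ} (hp : 0 < p)
    (hq : 0 < q) {f : ℂ → ℂ} (hf : InApq ω p q f) (c : ℂ) : InApq ω p q (c • f) := by
  have hd := hf.1.const_smul c
  refine ⟨hd, ?_⟩
  rw [LpqNormE_eq_eLpNorm hω hp hq hd]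
  refine lt_of_le_of_lt (eLpNorm_mono_ae ?_) ((hf.memLp hω hp hq).const_mul ‖c‖).2
  filter_upwards [ae_wmeas ω] with r hr
  simp only [Pi.smul_apply, smul_eq_mul, nrm_const_mul hp]
  rfl

lemma IsLinearOn.map_sub {ω : ℝ → ℝ} (hω : IsRadialWeight ω) {p q : ℝ} (hp : 0 < p)
    (hq : 0 < q) {L : (ℂ → ℂ) → ℂ} (hL : IsLinearOn (InApq ω p q) L) {f g : ℂ → ℂ}
    (hf : InApq ω p q f) (hg : InApq ω p q g) : L (f - g) = L f - L g := by
  have h : f - g = f + (-1 : ℂ) • g := by rw [neg_one_smul, sub_eq_add_neg]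
  rw [h, hL.1 _ _ hf (hg.smul hω hp hq _), hL.2 _ _ hg]
  ring

/-- A bounded linear functional acts termwise on absolutely summable power series. -/
lemma hasSum_apply_powerSeries {ω : ℝ → ℝ} (hω : IsRadialWeight ω) {p q : ℝ} (hp : 1 < p)
    (hq : 1 < q) {L : (ℂ → ℂ) → ℂ} (hL : IsLinearOn (InApq ω p q) L) {M : ℝ}
    (hM : ∀ f : ℂ → ℂ, InApq ω p q f → ‖L f‖ ≤ M * (LpqNormE ω p q f).toReal) (hM0 : 0 ≤ M)
    {d : ℕ → ℂ} (hd : Summable fun k => ‖d k‖) {f : ℂ → ℂ} (hf : InApq ω p q f)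
    (hfd : ∀ z ∈ Metric.ball (0:ℂ) 1, HasSum (fun k => d k * z ^ k) (f z)) :
    HasSum (fun k => d k * L fun z => z ^ k) (L f) := by
  have hp0 := zero_lt_one.trans hp
  have hq0 := zero_lt_one.trans hq
  have := isFiniteMeasure_wmeas hω
  have hX := fun k => inApq_pow hω hp0 hq0 k
  set κ := (wmeas ω univ ^ q⁻¹).toReal with hκ
  have hbd : ∀ (h : ℂ → ℂ) (B : ℝ), InApq ω p q h → 0 ≤ B →
      (∀ z ∈ Metric.ball (0:ℂ) 1, ‖h z‖ ≤ B) → ‖L h‖ ≤ M * (κ * B) := by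
    intro h B hh hB hhB
    refine (hM h hh).trans (mul_le_mul_of_nonneg_left ?_ hM0)
    have h1 := LpqNormE_le_of_bound hω hp0 hq0 hh.1 hB hhB
    have h2 := ENNReal.toReal_mono (ENNReal.mul_ne_top (ENNReal.rpow_ne_top_of_nonneg
      (by positivity) (measure_ne_top _ _)) ENNReal.ofReal_ne_top) h1
    rwa [ENNReal.toReal_mul, ENNReal.toReal_ofReal hB] at h2
  have hmono : ∀ k : ℕ, ‖L fun z => z ^ k‖ ≤ M * (κ * 1) := fun k =>
    hbd _ 1 (hX k) zero_le_one fun z hz => by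
      rw [norm_pow]
      exact pow_le_one₀ (norm_nonneg _) (mem_ball_zero_iff.1 hz).le
  have hsum : Summable fun k => d k * L fun z => z ^ k := by
    refine Summable.of_norm_bounded (hd.mul_right (M * (κ * 1))) fun k => ?_
    rw [norm_mul]
    exact mul_le_mul_of_nonneg_left (hmono k) (norm_nonneg _)
  set S : ℕ → ℂ → ℂ := fun n => fun z => ∑ k ∈ Finset.range n, d k * z ^ k with hS
  have hSX : ∀ n, InApq ω p q (S n) := fun n => by
    refine inApq_of_bound hω hp0 hq0 (by fun_prop) (B := ∑ k ∈ Finset.range n, ‖d k‖)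
      (by positivity) fun z hz => ?_
    refine norm_sum_le_of_le _ fun k _ => ?_
    rw [norm_mul, norm_pow]
    exact mul_le_of_le_one_right (norm_nonneg _)
      (pow_le_one₀ (norm_nonneg _) (mem_ball_zero_iff.1 hz).le)
  have hLS : ∀ n, L (S n) = ∑ k ∈ Finset.range n, d k * L fun z => z ^ k := by
    intro n
    induction n with
    | zero =>
      have h0 : S 0 = (0:ℂ) • S 0 := by funext z; simp [hS]
      rw [h0, hL.2 _ _ (hSX 0)]; simp
    | succ n ih =>
      have h1 : S (n + 1) = S n + d n • fun z : ℂ => z ^ n := by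
        funext z; simp [hS, Finset.sum_range_succ]
      rw [h1, hL.1 _ _ (hSX n) ((hX n).smul hω hp0 hq0 _), hL.2 _ _ (hX n), ih,
        Finset.sum_range_succ]
  rw [hsum.hasSum_iff_tendsto_nat]
  simp only [← hLS]
  rw [tendsto_iff_norm_sub_tendsto_zero]
  have hlim : Tendsto (fun n => M * (κ * ∑' k, ‖d (k + n)‖)) atTop (nhds 0) := by
    have := ((tendsto_sum_nat_add fun k => ‖d k‖).const_mul κ).const_mul M
    simpa using this
  refine squeeze_zero (fun _ => norm_nonneg _) (fun n => ?_) hlim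
  rw [← norm_neg, neg_sub, ← hL.map_sub hω hp0 hq0 hf (hSX n)]
  refine hbd _ _ (hf.sub hω hp hq (hSX n)) (tsum_nonneg fun k => norm_nonneg _) fun z hz => ?_
  have h1 := hfd z hz
  have h2 : HasSum (fun k => d (k + n) * z ^ (k + n)) (f z - S n z) :=
    (hasSum_nat_add_iff' n).2 h1
  rw [Pi.sub_apply, ← h2.tsum_eq]
  refine tsum_of_norm_bounded ((summable_nat_add_iff n).2 hd).hasSum fun k => ?_
  rw [norm_mul, norm_pow]
  exact mul_le_of_le_one_right (norm_nonneg _)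
    (pow_le_one₀ (norm_nonneg _) (mem_ball_zero_iff.1 hz).le)

lemma circlePt_mul (ρ r θ : ℝ) : circlePt (ρ * r) θ = (ρ:ℂ) * circlePt r θ := by
  simp only [circlePt]; push_cast; ring

lemma differentiableOn_dilate {f : ℂ → ℂ} (hf : DifferentiableOn ℂ f (Metric.ball 0 1)) {ρ : ℝ}
    (h0 : 0 ≤ ρ) (h1 : ρ ≤ 1) :
    DifferentiableOn ℂ (fun z => f ((ρ:ℂ) * z)) (Metric.ball 0 1) := by
  refine hf.comp (by fun_prop) fun z hz => ?_
  rw [mem_ball_zero_iff] at hz ⊢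
  rw [norm_mul, Complex.norm_real, Real.norm_of_nonneg h0]
  nlinarith [norm_nonneg z]

lemma InApq.dilate {ω : ℝ → ℝ} (hω : IsRadialWeight ω) {p q : ℝ} (hp : 1 < p)
    (hq : 0 < q) {f : ℂ → ℂ} (hf : InApq ω p q f) {ρ : ℝ} (h0 : 0 ≤ ρ) (h1 : ρ ≤ 1) :
    InApq ω p q fun z => f ((ρ:ℂ) * z) := by
  have hp0 := zero_lt_one.trans hp
  have hd := differentiableOn_dilate hf.1 h0 h1
  refine ⟨hd, ?_⟩
  rw [LpqNormE_eq_eLpNorm hω hp0 hq hd]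
  refine lt_of_le_of_lt (eLpNorm_mono_ae ?_) (hf.memLp hω hp0 hq).2
  filter_upwards [ae_wmeas ω] with r hr
  rw [Real.norm_of_nonneg (nrm_nonneg _ _), Real.norm_of_nonneg (nrm_nonneg _ _)]
  simp only [← circlePt_mul]
  exact nrm_circle_mono hp hf.1 h0 h1 hr.1.le hr.2

lemma tendsto_nrm_sub_dilate {p : ℝ} (hp : 0 < p) {f : ℂ → ℂ}
    (hf : DifferentiableOn ℂ f (Metric.ball 0 1)) {r : ℝ} (h0 : 0 ≤ r) (h1 : r < 1) :
    Tendsto (fun ρ : ℝ => nrm p fun θ => f (circlePt r θ) - f (circlePt (ρ * r) θ))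
      (nhdsWithin 1 (Iio 1)) (nhds 0) := by
  have hev : ∀ᶠ ρ : ℝ in nhdsWithin 1 (Iio 1), ρ ∈ Ico (0:ℝ) 1 :=
    Ico_mem_nhdsLT zero_lt_one
  have hs := summable_taylorCoeff hf h0 h1
  have hlim : Tendsto (fun ρ : ℝ => ∑' k, ‖taylorCoeff f k‖ * r ^ k * (1 - ρ ^ k))
      (nhdsWithin 1 (Iio 1)) (nhds 0) := by
    have : (0:ℝ) = ∑' k, ‖taylorCoeff f k‖ * r ^ k * (1 - (1:ℝ) ^ k) := by simp
    rw [this]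
    refine tendsto_tsum_of_dominated_convergence hs (fun k => ?_) ?_
    · refine Tendsto.mono_left ?_ nhdsWithin_le_nhds
      exact Continuous.tendsto (f := fun ρ : ℝ => ‖taylorCoeff f k‖ * r ^ k * (1 - ρ ^ k))
        (by fun_prop) 1
    · filter_upwards [hev] with ρ hρ k
      have h2 := pow_le_one₀ (n := k) hρ.1 hρ.2.le
      have h3 := pow_nonneg hρ.1 k
      rw [Real.norm_of_nonneg (by have : 0 ≤ 1 - ρ ^ k := by linarith
                                  positivity)]
      exact mul_le_of_le_one_right (by positivity) (by linarith)
  refine squeeze_zero' (Eventually.of_forall fun _ => nrm_nonneg _ _) ?_ hlim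
  filter_upwards [hev] with ρ hρ
  have hx0 : 0 ≤ ρ * r := mul_nonneg hρ.1 h0
  have hx1 : ρ * r < 1 := by nlinarith [hρ.2, hρ.1]
  have hb : ∀ k, 0 ≤ ‖taylorCoeff f k‖ * r ^ k * (1 - ρ ^ k) ∧
      ‖taylorCoeff f k‖ * r ^ k * (1 - ρ ^ k) ≤ ‖taylorCoeff f k‖ * r ^ k := fun k => by
    have h2 := pow_le_one₀ (n := k) hρ.1 hρ.2.le
    have h3 := pow_nonneg hρ.1 k
    have h4 : 0 ≤ 1 - ρ ^ k := by linarith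
    exact ⟨by positivity, mul_le_of_le_one_right (by positivity) (by linarith)⟩
  refine nrm_le_of_bound hp ((continuous_circlePt_comp hf h0 h1).sub
    (continuous_circlePt_comp hf hx0 hx1)) (tsum_nonneg fun k => (hb k).1) fun θ => ?_
  have hsum := (hasSum_taylorCoeff hf (z := circlePt r θ) (by rwa [norm_circlePt h0])).sub
    (hasSum_taylorCoeff hf (z := circlePt (ρ * r) θ) (by rwa [norm_circlePt hx0]))
  rw [Pi.sub_apply, ← hsum.tsum_eq]
  refine tsum_of_norm_bounded (Summable.of_nonneg_of_le (fun k => (hb k).1)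
    (fun k => (hb k).2) hs).hasSum fun k => le_of_eq ?_
  have e : taylorCoeff f k * circlePt r θ ^ k - taylorCoeff f k * circlePt (ρ * r) θ ^ k =
      taylorCoeff f k * circlePt r θ ^ k * ((1 - ρ ^ k : ℝ) : ℂ) := by
    rw [circlePt_mul]; push_cast; ring
  have h2 := pow_le_one₀ (n := k) hρ.1 hρ.2.le
  rw [e, norm_mul, norm_mul, norm_pow, norm_circlePt h0, Complex.norm_real,
    Real.norm_of_nonneg (by linarith)]

lemma tendsto_LpqNormE_sub_dilate {ω : ℝ → ℝ} (hω : IsRadialWeight ω) {p q : ℝ} (hp : 1 < p)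
    (hq : 1 < q) {f : ℂ → ℂ} (hf : InApq ω p q f) :
    Tendsto (fun ρ : ℝ => (LpqNormE ω p q (f - fun z => f ((ρ:ℂ) * z))).toReal)
      (nhdsWithin 1 (Iio 1)) (nhds 0) := by
  have hp0 := zero_lt_one.trans hp
  have hq0 := zero_lt_one.trans hq
  have hev : ∀ᶠ ρ : ℝ in nhdsWithin 1 (Iio 1), ρ ∈ Ico (0:ℝ) 1 :=
    Ico_mem_nhdsLT zero_lt_one
  have h_int := ((hf.memLp hω hp0 hq0).const_mul 2).integrable_norm_rpow
    (by simpa using hq0) ENNReal.ofReal_ne_top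
  rw [ENNReal.toReal_ofReal hq0.le] at h_int
  have hX : ∀ ρ ∈ Ico (0:ℝ) 1, InApq ω p q (f - fun z => f ((ρ:ℂ) * z)) := fun ρ hρ =>
    hf.sub hω hp hq (hf.dilate hω hp hq0 hρ.1 hρ.2.le)
  have hlim : Tendsto (fun ρ : ℝ => ∫ r, ‖nrm p fun θ =>
      (f - fun z => f ((ρ:ℂ) * z)) (circlePt r θ)‖ ^ q ∂(wmeas ω)) (nhdsWithin 1 (Iio 1))
      (nhds (∫ r, (0:ℝ) ∂(wmeas ω))) := by
    refine tendsto_integral_filter_of_dominated_convergence _ ?_ ?_ h_int ?_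
    · filter_upwards [hev] with ρ hρ
      exact ((aemeasurable_nrm_circle ω (hX ρ hρ).1 p).norm.pow_const q).aestronglyMeasurable
    · filter_upwards [hev] with ρ hρ
      filter_upwards [ae_wmeas ω] with r hr
      rw [Real.norm_of_nonneg (by positivity)]
      refine Real.rpow_le_rpow (norm_nonneg _) ?_ hq0.le
      rw [Real.norm_of_nonneg (nrm_nonneg _ _), Real.norm_of_nonneg
        (mul_nonneg zero_le_two (nrm_nonneg _ _)), two_mul]
      have hx0 : 0 ≤ ρ * r := mul_nonneg hρ.1 hr.1.le
      have hx1 : ρ * r < 1 := by nlinarith [hρ.2, hρ.1, hr.1, hr.2]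
      refine le_trans ?_ (add_le_add_right (nrm_circle_mono hp hf.1 hρ.1 hρ.2.le hr.1.le hr.2) _)
      simp only [Pi.sub_apply, ← circlePt_mul]
      exact nrm_sub_le hp.le ((continuous_circlePt_comp hf.1 hr.1.le hr.2).memLp_circMeas _)
        ((continuous_circlePt_comp hf.1 hx0 hx1).memLp_circMeas _)
    · filter_upwards [ae_wmeas ω] with r hr
      have := ((tendsto_nrm_sub_dilate hp0 hf.1 hr.1.le hr.2).norm.rpow_const
        (p := q) (Or.inr hq0.le))
      simpa only [Pi.sub_apply, ← circlePt_mul, norm_zero, Real.zero_rpow hq0.ne'] using this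
  have h2 := hlim.rpow_const (p := 1 / q) (Or.inr (by positivity))
  rw [integral_zero, Real.zero_rpow (by positivity)] at h2
  refine h2.congr' ?_
  filter_upwards [hev] with ρ hρ
  exact (toReal_LpqNormE hω hp0 hq0 (hX ρ hρ)).symm

lemma hasPairingC_of_moments {ω : ℝ → ℝ} (hω : IsRadialWeight ω) {p q : ℝ} (hp : 1 < p)
    (hq : 1 < q) {L : (ℂ → ℂ) → ℂ} (hL : IsLinearOn (InApq ω p q) L) {M : ℝ}
    (hM : ∀ f : ℂ → ℂ, InApq ω p q f → ‖L f‖ ≤ M * (LpqNormE ω p q f).toReal) (hM0 : 0 ≤ M)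
    {g : ℂ → ℂ} (hg : ∀ k, (starRingEnd ℂ) (taylorCoeff g k) * ((momentCoeff ω k : ℝ) : ℂ) =
      L fun z => z ^ k) {f : ℂ → ℂ} (hf : InApq ω p q f) :
    HasPairingC (momentCoeff ω) f g (L f) := by
  have hp0 := zero_lt_one.trans hp
  have hq0 := zero_lt_one.trans hq
  have hdil : ∀ ρ ∈ Ico (0:ℝ) 1, HasSum (fun k => taylorCoeff f k *
      (starRingEnd ℂ) (taylorCoeff g k) * ((momentCoeff ω k : ℝ) : ℂ) * (ρ:ℂ) ^ k)
      (L fun z => f ((ρ:ℂ) * z)) := by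
    intro ρ hρ
    have h := hasSum_apply_powerSeries hω hp hq hL hM hM0
      (summable_taylorCoeff_mul_pow hf.1 hρ.1 hρ.2) (hf.dilate hω hp hq0 hρ.1 hρ.2.le) ?_
    · refine h.congr_fun fun k => ?_
      rw [← hg k]; ring
    · intro z hz
      rw [mem_ball_zero_iff] at hz
      have := hasSum_taylorCoeff hf.1 (z := (ρ:ℂ) * z) (by
        rw [norm_mul, Complex.norm_real, Real.norm_of_nonneg hρ.1]
        nlinarith [norm_nonneg z, hρ.2, hρ.1])
      refine this.congr_fun fun k => ?_
      rw [mul_pow]; ring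
  have hev : ∀ᶠ ρ : ℝ in nhdsWithin 1 (Iio 1), ρ ∈ Ico (0:ℝ) 1 :=
    Ico_mem_nhdsLT zero_lt_one
  refine ⟨fun ρ hρ => (hdil ρ hρ).summable, ?_⟩
  have hlim : Tendsto (fun ρ : ℝ => L fun z => f ((ρ:ℂ) * z)) (nhdsWithin 1 (Iio 1))
      (nhds (L f)) := by
    rw [tendsto_iff_norm_sub_tendsto_zero]
    have h0 := (tendsto_LpqNormE_sub_dilate hω hp hq hf).const_mul M
    rw [mul_zero] at h0
    refine squeeze_zero' (Eventually.of_forall fun _ => norm_nonneg _) ?_ h0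
    filter_upwards [hev] with ρ hρ
    have hρX := hf.dilate hω hp hq0 hρ.1 hρ.2.le
    rw [← norm_neg, neg_sub, ← hL.map_sub hω hp0 hq0 hf hρX]
    exact hM _ (hf.sub hω hp hq hρX)
  refine hlim.congr' ?_
  filter_upwards [hev] with ρ hρ
  exact (hdil ρ hρ).tsum_eq.symm

lemma hasSum_integral_mul_of_le {ν : Measure ℝ} [IsFiniteMeasure ν] {c : ℕ → ℝ → ℂ}
    (hc : ∀ k, AEStronglyMeasurable (c k) ν) {B R : ℝ}
    (hB : ∀ k, ∀ᵐ r ∂ν, ‖c k r‖ ≤ B * R ^ k) {e : ℕ → ℂ}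
    (he : Summable fun k => ‖e k‖ * R ^ k) :
    HasSum (fun k => (∫ r, c k r ∂ν) * e k) (∫ r, ∑' k, c k r * e k ∂ν) := by
  have hi : ∀ k, Integrable (fun r => c k r * e k) ν := fun k =>
    (Integrable.of_bound (hc k) _ (hB k)).mul_const _
  have hs : Summable fun k => ∫ r, ‖c k r * e k‖ ∂ν := by
    refine Summable.of_nonneg_of_le (fun k => integral_nonneg fun r => norm_nonneg _) (fun k => ?_)
      (he.mul_left (B * ν.real univ))
    calc ∫ r, ‖c k r * e k‖ ∂ν ≤ ∫ _, (B * R ^ k) * ‖e k‖ ∂ν := by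
          refine integral_mono_ae (hi k).norm (integrable_const _) ?_
          filter_upwards [hB k] with r hr
          rw [norm_mul]
          exact mul_le_mul_of_nonneg_right hr (norm_nonneg _)
      _ = _ := by rw [integral_const, smul_eq_mul]; ring
  refine (hasSum_integral_of_summable_integral_norm hi hs).congr_fun fun k => ?_
  rw [integral_mul_const]

/-- The Taylor coefficients of the Bergman-type projection of a function given on the circles
of radius less than `R` by `U`. -/
def projCoeff (ω : ℝ → ℝ) (U : ℝ → ℝ → ℂ) (R : ℝ) (k : ℕ) : ℂ :=
  (∫ r in Ioo 0 R, (r:ℂ) ^ k * fcoef (U r) k ∂(wmeas ω)) * (((momentCoeff ω k)⁻¹ : ℝ) : ℂ)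

lemma measurable_fcoef {U : ℝ → ℝ → ℂ} (hU : Measurable (Function.uncurry U)) (k : ℕ) :
    Measurable fun r => fcoef (U r) k := by
  have h : Measurable fun x : ℝ × ℝ => (starRingEnd ℂ) (ex x.2) ^ k * Function.uncurry U x :=
    Measurable.mul (by fun_prop) hU
  exact (h.stronglyMeasurable.integral_prod_right' (ν := circMeas)).measurable

lemma measurable_nrm {U : ℝ → ℝ → ℂ} (hU : Measurable (Function.uncurry U)) (p : ℝ) :
    Measurable fun r => nrm p (U r) := by
  have h : Measurable fun x : ℝ × ℝ => ‖Function.uncurry U x‖ ^ p := hU.norm.pow_const p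
  exact (h.stronglyMeasurable.integral_prod_right' (ν := circMeas)).measurable.pow_const _

section projection

variable {ω : ℝ → ℝ} {p p' : ℝ} {U : ℝ → ℝ → ℂ} {R B : ℝ}

lemma aestronglyMeasurable_pow_mul_fcoef (ν : Measure ℝ) (hU : Measurable (Function.uncurry U))
    (k : ℕ) : AEStronglyMeasurable (fun r : ℝ => (r:ℂ) ^ k * fcoef (U r) k) ν :=
  (Measurable.mul (by fun_prop) (measurable_fcoef hU k)).aestronglyMeasurable

lemma norm_pow_mul_fcoef_le (hp : p.HolderConjugate p')
    (hUc : ∀ r ∈ Ioo 0 R, Continuous (U r)) (hUB : ∀ r ∈ Ioo 0 R, nrm p (U r) ≤ B) {r : ℝ}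
    (hr : r ∈ Ioo 0 R) (k : ℕ) : ‖(r:ℂ) ^ k * fcoef (U r) k‖ ≤ B * R ^ k := by
  have h0 := hr.1
  rw [norm_mul, norm_pow, Complex.norm_real, Real.norm_of_nonneg h0.le, mul_comm]
  exact mul_le_mul ((norm_fcoef_le hp (hUc r hr) k).trans (hUB r hr))
    (pow_le_pow_left₀ h0.le hr.2.le k) (by positivity) ((nrm_nonneg _ _).trans (hUB r hr))

lemma hasSum_projCoeff_mul (hω : IsRadialWeight ω) (hp : p.HolderConjugate p')
    (hU : Measurable (Function.uncurry U)) (hUc : ∀ r ∈ Ioo 0 R, Continuous (U r))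
    (hUB : ∀ r ∈ Ioo 0 R, nrm p (U r) ≤ B) {e : ℕ → ℂ}
    (he : Summable fun k => ‖(((momentCoeff ω k)⁻¹ : ℝ) : ℂ) * e k‖ * R ^ k) :
    HasSum (fun k => projCoeff ω U R k * e k) (∫ r in Ioo 0 R, ∑' k,
      ((r:ℂ) ^ k * fcoef (U r) k) * ((((momentCoeff ω k)⁻¹ : ℝ) : ℂ) * e k) ∂(wmeas ω)) := by
  have := isFiniteMeasure_wmeas hω
  refine (hasSum_integral_mul_of_le (aestronglyMeasurable_pow_mul_fcoef _ hU) (B := B) (R := R)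
    (fun k => ?_) he).congr_fun fun k => ?_
  · filter_upwards [ae_restrict_mem measurableSet_Ioo] with r hr
    exact norm_pow_mul_fcoef_le hp hUc hUB hr k
  · rw [projCoeff, mul_assoc]

lemma summable_norm_projCoeff (hω : IsRadialWeight ω)
    (hpos : ∀ r ∈ Set.Ico (0:ℝ) 1, 0 < omegaHat ω r) (hD : InDhat ω)
    (hp : p.HolderConjugate p') (hR0 : 0 ≤ R) (hR1 : R < 1)
    (hUc : ∀ r ∈ Ioo 0 R, Continuous (U r)) (hUB : ∀ r ∈ Ioo 0 R, nrm p (U r) ≤ B) :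
    Summable fun k => ‖projCoeff ω U R k‖ := by
  have := isFiniteMeasure_wmeas hω
  refine Summable.of_nonneg_of_le (fun _ => norm_nonneg _) (fun k => ?_)
    ((summable_pow_div_momentCoeff hω hpos hD hR0 hR1).mul_left (B * (wmeas ω).real (Ioo 0 R)))
  have hm := momentCoeff_pos hω hpos k
  rw [projCoeff, norm_mul, Complex.norm_real, Real.norm_of_nonneg (by positivity)]
  have h := norm_setIntegral_le_of_norm_le_const (μ := wmeas ω) (s := Ioo 0 R)
    (f := fun r : ℝ => (r:ℂ) ^ k * fcoef (U r) k) (C := B * R ^ k) (measure_lt_top _ _)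
    fun r hr => norm_pow_mul_fcoef_le hp hUc hUB hr k
  calc _ ≤ (B * R ^ k * (wmeas ω).real (Ioo 0 R)) * (momentCoeff ω k)⁻¹ := by gcongr
    _ = _ := by ring

end projection

lemma summable_mul_pow_of_summable {d : ℕ → ℂ} (hd : Summable fun k => ‖d k‖) {x : ℝ}
    (h0 : 0 ≤ x) (h1 : x < 1) : Summable fun k => ‖d k‖ * x ^ k :=
  Summable.of_nonneg_of_le (fun k => by positivity)
    (fun k => mul_le_of_le_one_right (norm_nonneg _) (pow_le_one₀ h0 h1.le)) hd

lemma inv_omegaHat_mul_le_maxKernel {ω : ℝ → ℝ} (hω : IsRadialWeight ω)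
    (hpos : ∀ r ∈ Set.Ico (0:ℝ) 1, 0 < omegaHat ω r) {s r : ℝ} (hs : s ∈ Ioo (0:ℝ) 1)
    (hr : r ∈ Ioo (0:ℝ) 1) : ENNReal.ofReal (1 / omegaHat ω (s * r)) ≤ maxKernel (tailW ω) s r := by
  rw [maxKernel, tailW_of_mem hs, tailW_of_mem hr]
  have h0 := hs.1
  have h1 := hr.1
  have := hpos s ⟨hs.1.le, hs.2⟩
  refine ENNReal.ofReal_le_ofReal (one_div_le_one_div_of_le (lt_max_of_lt_left this) (max_le ?_ ?_))
  · exact omegaHat_anti hω (by positivity) (mul_le_of_le_one_right h0.le hr.2.le) hs.2.le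
  · exact omegaHat_anti hω (by positivity) (mul_le_of_le_one_left h1.le hs.2.le) hr.2.le

/-- Pointwise bound for the integral means of the projection. -/
lemma exists_nrm_projection_le {ω : ℝ → ℝ} (hω : IsRadialWeight ω)
    (hpos : ∀ r ∈ Set.Ico (0:ℝ) 1, 0 < omegaHat ω r) (hD : InDhat ω) {p p' : ℝ}
    (hp : p.HolderConjugate p') :
    ∃ A > (0:ℝ), ∀ (U : ℝ → ℝ → ℂ) (R B : ℝ), Measurable (Function.uncurry U) → 0 ≤ R → R < 1 →
      (∀ r ∈ Ioo 0 R, Continuous (U r)) → (∀ r ∈ Ioo 0 R, nrm p (U r) ≤ B) →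
      ∀ s ∈ Ioo (0:ℝ) 1,
      ENNReal.ofReal (nrm p fun θ => ∑' k, projCoeff ω U R k * circlePt s θ ^ k) ≤
        ENNReal.ofReal A * ∫⁻ r in Ioo 0 R, maxKernel (tailW ω) s r * ENNReal.ofReal (nrm p (U r))
          ∂(wmeas ω) := by
  obtain ⟨A, hA, H⟩ := exists_kernel_bound hω hpos hD hp
  refine ⟨A, hA, fun U R B hU hR0 hR1 hUc hUB s hs => ?_⟩
  have hd := summable_norm_projCoeff hω hpos hD hp hR0 hR1 hUc hUB
  have hds : Summable fun k => ‖projCoeff ω U R k * (s:ℂ) ^ k‖ := by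
    have := summable_mul_pow_of_summable hd hs.1.le hs.2
    simpa [abs_of_nonneg hs.1.le] using this
  set w : ℝ → ℂ := fun θ => ∑' k, projCoeff ω U R k * circlePt s θ ^ k with hw
  have hwe : w = fun θ => ∑' k, (projCoeff ω U R k * (s:ℂ) ^ k) * ex θ ^ k := by
    funext θ
    refine tsum_congr fun k => ?_
    rw [circlePt_eq, mul_pow, mul_assoc]
  have hwc : Continuous w := by rw [hwe]; exact continuous_series hds
  set v : ℝ → ℂ := fun θ => dualFun p (w θ) with hv
  have hvc : Continuous v := (continuous_dualFun hp.lt).comp hwc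
  set ν := nrm p w with hν
  have hν0 : 0 ≤ ν := nrm_nonneg _ _
  have hvn : nrm p' v = ν ^ (p - 1) := nrm_dualFun hp w
  have hpair := hasSum_pairing hds hvc
  have h_int : ∫ θ, (∑' k, (projCoeff ω U R k * (s:ℂ) ^ k) * ex θ ^ k) *
      (starRingEnd ℂ) (v θ) ∂circMeas = ((ν ^ p : ℝ) : ℂ) := by
    rw [nrm_rpow hp.pos, ← integral_complex_ofReal]
    refine integral_congr_ae (ae_of_all _ fun θ => ?_)
    simp only [hv]
    rw [← mul_conj_dualFun hp.lt, hwe]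
  rw [h_int] at hpair
  have hV : ∀ k, ‖fcoef v k‖ ≤ nrm p' v := norm_fcoef_le hp.symm hvc
  have he : Summable fun k => ‖(((momentCoeff ω k)⁻¹ : ℝ) : ℂ) *
      ((s:ℂ) ^ k * (starRingEnd ℂ) (fcoef v k))‖ * R ^ k := by
    refine Summable.of_nonneg_of_le (fun k => by positivity) (fun k => ?_)
      ((summable_pow_div_momentCoeff hω hpos hD hR0 hR1).mul_right (nrm p' v))
    have hm := momentCoeff_pos hω hpos k
    rw [norm_mul, norm_mul, norm_pow, RCLike.norm_conj, Complex.norm_real, Complex.norm_real,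
      Real.norm_of_nonneg (by positivity), Real.norm_of_nonneg hs.1.le]
    calc _ ≤ (momentCoeff ω k)⁻¹ * (1 * nrm p' v) * R ^ k := by
          gcongr
          · exact pow_le_one₀ hs.1.le hs.2.le
          · exact hV k
      _ = _ := by ring
  have h2 := hasSum_projCoeff_mul hω hp hU hUc hUB he
  have heq : ((ν ^ p : ℝ) : ℂ) = _ := (hpair.congr_fun fun k => by ring).unique h2
  have hbound : ENNReal.ofReal (ν ^ p) ≤ ENNReal.ofReal (ν ^ (p - 1)) * (ENNReal.ofReal A *
      ∫⁻ r in Ioo 0 R, maxKernel (tailW ω) s r * ENNReal.ofReal (nrm p (U r)) ∂(wmeas ω)) := by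
    have e1 : ENNReal.ofReal (ν ^ p) = ‖((ν ^ p : ℝ) : ℂ)‖ₑ := by
      rw [← ofReal_norm, Complex.norm_real, Real.norm_of_nonneg (by positivity)]
    rw [e1, heq, ← mul_assoc, ← lintegral_const_mul' _ _
      (ENNReal.mul_ne_top ENNReal.ofReal_ne_top ENNReal.ofReal_ne_top)]
    refine (enorm_integral_le_lintegral_enorm _).trans (lintegral_mono_ae ?_)
    filter_upwards [ae_restrict_mem measurableSet_Ioo] with r hr
    have hr1 : r ∈ Ioo (0:ℝ) 1 := ⟨hr.1, hr.2.trans hR1⟩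
    have hx1 : s * r < 1 := by nlinarith [hs.1, hs.2, hr1.1, hr1.2]
    have hx0 : 0 ≤ s * r := mul_nonneg hs.1.le hr.1.le
    have hk := H (U r) (hUc r hr) v hvc (s * r) hx0 hx1
    have ho := hpos (s * r) ⟨hx0, hx1⟩
    have e2 : ∑' k, ((r:ℂ) ^ k * fcoef (U r) k) * ((((momentCoeff ω k)⁻¹ : ℝ) : ℂ) *
        ((s:ℂ) ^ k * (starRingEnd ℂ) (fcoef v k))) =
        ∑' k, (((s * r) ^ k / momentCoeff ω k : ℝ) : ℂ) *
          (fcoef (U r) k * (starRingEnd ℂ) (fcoef v k)) := by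
      refine tsum_congr fun k => ?_
      push_cast
      rw [mul_pow]
      ring
    rw [e2, ← ofReal_norm]
    calc _ ≤ ENNReal.ofReal (A / omegaHat ω (s * r) * (nrm p (U r) * nrm p' v)) :=
          ENNReal.ofReal_le_ofReal hk
      _ = ENNReal.ofReal (ν ^ (p - 1)) * ENNReal.ofReal A *
          (ENNReal.ofReal (1 / omegaHat ω (s * r)) * ENNReal.ofReal (nrm p (U r))) := by
          rw [← ENNReal.ofReal_mul (by positivity), ← ENNReal.ofReal_mul (by positivity),
            ← ENNReal.ofReal_mul (by positivity), hvn]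
          congr 1
          ring
      _ ≤ _ := by
          gcongr
          exact inv_omegaHat_mul_le_maxKernel hω hpos hs hr1
  rcases hν0.eq_or_lt with h | h
  · rw [← h]; simp
  · have e3 : ν ^ p = ν ^ (p - 1) * ν := by
      rw [← Real.rpow_add_one h.ne']; congr 1; ring
    rw [e3, ENNReal.ofReal_mul (by positivity)] at hbound
    refine (ENNReal.mul_le_mul_iff_right ?_ ENNReal.ofReal_ne_top).1 hbound
    rw [ne_eq, ENNReal.ofReal_eq_zero, not_le]
    positivity

lemma exists_LpqNormE_projection_le {ω : ℝ → ℝ} (hω : IsRadialWeight ω)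
    (hpos : ∀ r ∈ Set.Ico (0:ℝ) 1, 0 < omegaHat ω r) (hD : InDhat ω) {p p' q q' : ℝ}
    (hp : p.HolderConjugate p') (hq : q.HolderConjugate q') :
    ∃ C > (0:ℝ), ∀ (U : ℝ → ℝ → ℂ) (R B : ℝ), Measurable (Function.uncurry U) → 0 ≤ R → R < 1 →
      (∀ r ∈ Ioo 0 R, Continuous (U r)) → (∀ r ∈ Ioo 0 R, nrm p (U r) ≤ B) →
      LpqNormE ω p q (fun z => ∑' k, projCoeff ω U R k * z ^ k) ≤ ENNReal.ofReal C *
        (∫⁻ r in Ioo 0 R, ENNReal.ofReal (nrm p (U r) ^ q) ∂(wmeas ω)) ^ (1 / q) := by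
  obtain ⟨A, hA, H⟩ := exists_nrm_projection_le hω hpos hD hp
  have hfin := isFiniteMeasure_wmeas hω
  have hq0 := hq.pos
  set C₀ : ℝ≥0∞ := ENNReal.ofReal (1 / (1 - 1 / q) + 1 / (1 / q)) ^ (q / q') *
      ENNReal.ofReal (1 / (1 - 1 / q') + 1 / (1 / q')) with hC₀
  have hC₀t : C₀ ≠ ⊤ := ENNReal.mul_ne_top (ENNReal.rpow_ne_top_of_nonneg
    (div_nonneg hq0.le hq.symm.pos.le) ENNReal.ofReal_ne_top) ENNReal.ofReal_ne_top
  set E : ℝ≥0∞ := ENNReal.ofReal A * C₀ ^ (1 / q) with hE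
  have hEt : E ≠ ⊤ := ENNReal.mul_ne_top ENNReal.ofReal_ne_top
    (ENNReal.rpow_ne_top_of_nonneg (by positivity) hC₀t)
  refine ⟨E.toReal + 1, by positivity, fun U R B hU hR0 hR1 hUc hUB => ?_⟩
  have hd := summable_norm_projCoeff hω hpos hD hp hR0 hR1 hUc hUB
  have hdiff : DifferentiableOn ℂ (fun z => ∑' k, projCoeff ω U R k * z ^ k) (Metric.ball 0 1) :=
    differentiableOn_powerSeries fun x h0 h1 => summable_mul_pow_of_summable hd h0 h1
  set φ : ℝ → ℝ≥0∞ := (Ioo 0 R).indicator fun r => ENNReal.ofReal (nrm p (U r)) with hφ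
  have hφm : Measurable φ := (measurable_nrm hU p).ennreal_ofReal.indicator measurableSet_Ioo
  have hschur := lintegral_maxKernel_rpow_le (measurable_tailW hω) (tailW_pos hpos)
    (wmeas_tailW_le hω) hq hφm
  rw [← hC₀] at hschur
  have hφq : ∫⁻ r, φ r ^ q ∂(wmeas ω) =
      ∫⁻ r in Ioo 0 R, ENNReal.ofReal (nrm p (U r) ^ q) ∂(wmeas ω) := by
    rw [← lintegral_indicator measurableSet_Ioo]
    refine lintegral_congr fun r => ?_
    by_cases hr : r ∈ Ioo 0 R
    · simp only [hφ, indicator_of_mem hr]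
      rw [ENNReal.ofReal_rpow_of_nonneg (nrm_nonneg _ _) hq0.le]
    · simp only [hφ, indicator_of_notMem hr, ENNReal.zero_rpow_of_pos hq0]
  have hmeans : ∀ᵐ s ∂(wmeas ω), MpE p s (fun z => ∑' k, projCoeff ω U R k * z ^ k) ^ q ≤
      ENNReal.ofReal A ^ q * (∫⁻ r, maxKernel (tailW ω) s r * φ r ∂(wmeas ω)) ^ q := by
    filter_upwards [ae_wmeas ω] with s hs
    rw [MpE_eq_nrm hp.pos hdiff hs.1.le hs.2, ← ENNReal.mul_rpow_of_nonneg _ _ hq0.le]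
    refine ENNReal.rpow_le_rpow ((H U R B hU hR0 hR1 hUc hUB s hs).trans (le_of_eq ?_)) hq0.le
    congr 1
    rw [← lintegral_indicator measurableSet_Ioo]
    refine lintegral_congr fun r => ?_
    by_cases hr : r ∈ Ioo 0 R
    · simp only [hφ, indicator_of_mem hr]
    · simp only [hφ, indicator_of_notMem hr, mul_zero]
  rw [LpqNormE_eq hω]
  calc _ ≤ (ENNReal.ofReal A ^ q * (C₀ * ∫⁻ r, φ r ^ q ∂(wmeas ω))) ^ (1 / q) := by
        refine ENNReal.rpow_le_rpow ((lintegral_mono_ae hmeans).trans ?_) (by positivity)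
        rw [lintegral_const_mul' _ _ (ENNReal.rpow_ne_top_of_nonneg hq0.le ENNReal.ofReal_ne_top)]
        gcongr
    _ = E * (∫⁻ r, φ r ^ q ∂(wmeas ω)) ^ (1 / q) := by
        rw [ENNReal.mul_rpow_of_nonneg _ _ (by positivity), ← ENNReal.rpow_mul,
          mul_one_div_cancel hq0.ne', ENNReal.rpow_one,
          ENNReal.mul_rpow_of_nonneg _ _ (by positivity), hE, mul_assoc]
    _ ≤ _ := by
        rw [hφq]
        gcongr
        rw [← ENNReal.ofReal_toReal hEt]
        exact ENNReal.ofReal_le_ofReal (by simp)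

/-- The function whose pairing with `g` on every circle is `M_p(r, g) ^ q`. -/
def extremal (p q : ℝ) (g : ℂ → ℂ) (r θ : ℝ) : ℂ :=
  (((nrm p fun θ => g (circlePt r θ)) ^ (q - p) : ℝ) : ℂ) * dualFun p (g (circlePt r θ))

lemma nrm_extremal {p p' q : ℝ} (hp : p.HolderConjugate p') (hq : 1 < q) (g : ℂ → ℂ) (r : ℝ) :
    nrm p' (extremal p q g r) = (nrm p fun θ => g (circlePt r θ)) ^ (q - 1) := by
  have h0 := nrm_nonneg p fun θ => g (circlePt r θ)
  unfold extremal
  rw [nrm_const_mul hp.symm.pos, nrm_dualFun hp, Complex.norm_real,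
    Real.norm_of_nonneg (by positivity)]
  rcases h0.eq_or_lt with h | h
  · rw [← h, Real.zero_rpow (x := p - 1) (by linarith [hp.lt]),
      Real.zero_rpow (x := q - 1) (by linarith), mul_zero]
  · rw [← Real.rpow_add h]
    congr 1
    ring

lemma measurable_extremal {p : ℝ} (hp : 1 < p) (q : ℝ) {g : ℂ → ℂ} (hg : Measurable g) :
    Measurable (Function.uncurry (extremal p q g)) := by
  have h1 : Measurable fun x : ℝ × ℝ => nrm p fun θ => g (circlePt x.1 θ) :=
    (measurable_nrm_circle hg p).comp measurable_fst
  have h2 : Measurable fun x : ℝ × ℝ => dualFun p (g (circlePt x.1 x.2)) :=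
    (continuous_dualFun hp).measurable.comp (hg.comp measurable_circlePt)
  exact (Complex.measurable_ofReal.comp (h1.pow_const (q - p))).mul h2

lemma continuous_extremal {p : ℝ} (hp : 1 < p) (q : ℝ) {g : ℂ → ℂ}
    (hg : DifferentiableOn ℂ g (Metric.ball 0 1)) {r : ℝ} (h0 : 0 ≤ r) (h1 : r < 1) :
    Continuous (extremal p q g r) :=
  continuous_const.mul ((continuous_dualFun hp).comp (continuous_circlePt_comp hg h0 h1))

lemma integral_mul_conj_extremal {p q : ℝ} (hp : 1 < p) (hq : 0 < q) (g : ℂ → ℂ) (r : ℝ) :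
    ∫ θ, g (circlePt r θ) * (starRingEnd ℂ) (extremal p q g r θ) ∂circMeas =
      (((nrm p fun θ => g (circlePt r θ)) ^ q : ℝ) : ℂ) := by
  have hp0 := zero_lt_one.trans hp
  set N := nrm p fun θ => g (circlePt r θ) with hN
  have h0 : 0 ≤ N := nrm_nonneg p _
  have e : ∀ θ, g (circlePt r θ) * (starRingEnd ℂ) (extremal p q g r θ) =
      ((N ^ (q - p) * ‖g (circlePt r θ)‖ ^ p : ℝ) : ℂ) := fun θ => by
    rw [extremal, map_mul, Complex.conj_ofReal, mul_left_comm, mul_conj_dualFun hp, ← hN]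
    push_cast
    ring
  simp_rw [e]
  rw [integral_complex_ofReal, integral_const_mul, ← nrm_rpow hp0 fun θ => g (circlePt r θ), ← hN]
  rcases h0.eq_or_lt with h | h
  · rw [← h, Real.zero_rpow hp0.ne', Real.zero_rpow hq.ne', mul_zero]
  · rw [← Real.rpow_add h, sub_add_cancel]

/-- The expansion of the mean of `g · conj (extremal p q g r)` in Fourier coefficients. -/
lemma tsum_conj_taylorCoeff_extremal {p q : ℝ} (hp : 1 < p) (hq : 0 < q) {g : ℂ → ℂ}
    (hg : DifferentiableOn ℂ g (Metric.ball 0 1)) {r : ℝ} (h0 : 0 ≤ r) (h1 : r < 1) :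
    ∑' k, ((r:ℂ) ^ k * fcoef (extremal p q g r) k) * (starRingEnd ℂ) (taylorCoeff g k) =
      (((nrm p fun θ => g (circlePt r θ)) ^ q : ℝ) : ℂ) := by
  have h := hasSum_pairing (summable_taylorCoeff_mul_pow hg h0 h1)
    (continuous_extremal hp q hg h0 h1)
  simp_rw [← circle_series hg h0 h1] at h
  rw [integral_mul_conj_extremal hp hq] at h
  have h' := (Complex.hasSum_conj'.mpr h).tsum_eq
  rw [Complex.conj_ofReal] at h'
  rw [← h']
  refine tsum_congr fun k => ?_
  simp only [map_mul, map_pow, Complex.conj_ofReal, Complex.conj_conj]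
  ring

lemma nrm_circle_le_of_le {p : ℝ} (hp : 1 < p) {g : ℂ → ℂ}
    (hg : DifferentiableOn ℂ g (Metric.ball 0 1)) {r R : ℝ} (h0 : 0 ≤ r) (hrR : r ≤ R)
    (hR : R < 1) :
    (nrm p fun θ => g (circlePt r θ)) ≤ nrm p fun θ => g (circlePt R θ) := by
  rcases (h0.trans hrR).eq_or_lt with h | h
  · rw [← h] at hrR ⊢
    rw [le_antisymm hrR h0]
  · have := nrm_circle_mono hp hg (ρ := r / R) (by positivity) ((div_le_one h).mpr hrR) h.le hR
    rwa [div_mul_cancel₀ _ h.ne'] at this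

/-- A nonnegative real number dominated by a multiple of its own power `1 / q` is bounded. -/
lemma rpow_le_of_le_mul_rpow {q q' : ℝ} (hq : q.HolderConjugate q') {J K : ℝ} (hJ : 0 ≤ J)
    (hK : 0 ≤ K) (h : J ≤ K * J ^ (1 / q)) : J ≤ K ^ q' := by
  rcases hJ.eq_or_lt with h0 | h0
  · rw [← h0]
    positivity
  · have h1 : J ^ (1 / q') ≤ K := by
      have h2 : J = J ^ (1 / q') * J ^ (1 / q) := by
        rw [← Real.rpow_add h0, one_div, one_div, add_comm, hq.inv_add_inv_eq_one, Real.rpow_one]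
      have h3 : 0 < J ^ (1 / q) := Real.rpow_pos_of_pos h0 _
      rw [h2] at h
      refine le_of_mul_le_mul_right (h.trans_eq ?_) h3
      rw [← h2]
    calc J = (J ^ (1 / q')) ^ q' := by
          rw [← Real.rpow_mul hJ, one_div, inv_mul_cancel₀ hq.symm.pos.ne', Real.rpow_one]
      _ ≤ K ^ q' := Real.rpow_le_rpow (by positivity) h1 hq.symm.pos.le

section representation

variable {ω : ℝ → ℝ} {p q p' q' : ℝ} {L : (ℂ → ℂ) → ℂ} {M C : ℝ} {g : ℂ → ℂ}

lemma norm_apply_pow_le (hω : IsRadialWeight ω) (hp : 0 < p) (hq : 0 < q)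
    (hM : ∀ f : ℂ → ℂ, InApq ω p q f → ‖L f‖ ≤ M * (LpqNormE ω p q f).toReal) (hM0 : 0 ≤ M)
    (k : ℕ) : ‖L fun z => z ^ k‖ ≤ M * (wmeas ω univ ^ q⁻¹).toReal := by
  have := isFiniteMeasure_wmeas hω
  refine (hM _ (inApq_pow hω hp hq k)).trans ?_
  gcongr
  · exact ENNReal.rpow_ne_top_of_nonneg (inv_nonneg.mpr hq.le) (measure_ne_top _ _)
  · have h := LpqNormE_le_of_bound hω hp hq (inApq_pow hω hp hq k).1 zero_le_one fun z hz => by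
      rw [norm_pow]
      exact pow_le_one₀ (norm_nonneg _) (mem_ball_zero_iff.mp hz).le
    simpa using h

lemma setLIntegral_nrm_rpow_le (hω : IsRadialWeight ω)
    (hpos : ∀ r ∈ Set.Ico (0:ℝ) 1, 0 < omegaHat ω r) (hD : InDhat ω)
    (hp : p.HolderConjugate p') (hq : q.HolderConjugate q') (hC : 0 < C)
    (hP : ∀ (U : ℝ → ℝ → ℂ) (R B : ℝ), Measurable (Function.uncurry U) → 0 ≤ R → R < 1 →
      (∀ r ∈ Ioo 0 R, Continuous (U r)) → (∀ r ∈ Ioo 0 R, nrm p (U r) ≤ B) →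
      LpqNormE ω p q (fun z => ∑' k, projCoeff ω U R k * z ^ k) ≤
        ENNReal.ofReal C *
          (∫⁻ r in Ioo 0 R, ENNReal.ofReal (nrm p (U r) ^ q) ∂(wmeas ω)) ^ (1 / q))
    (hL : IsLinearOn (InApq ω p q) L)
    (hM : ∀ f : ℂ → ℂ, InApq ω p q f → ‖L f‖ ≤ M * (LpqNormE ω p q f).toReal) (hM0 : 0 ≤ M)
    (hgm : Measurable g) (hgd : DifferentiableOn ℂ g (Metric.ball 0 1))
    (hg : ∀ k, (starRingEnd ℂ) (taylorCoeff g k) * ((momentCoeff ω k : ℝ) : ℂ) = L fun z => z ^ k)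
    {R : ℝ} (hR0 : 0 ≤ R) (hR1 : R < 1) :
    ∫⁻ r in Ioo 0 R, ENNReal.ofReal ((nrm p' fun θ => g (circlePt r θ)) ^ q') ∂(wmeas ω) ≤
      ENNReal.ofReal ((M * C) ^ q') := by
  have := isFiniteMeasure_wmeas hω
  have hp0 := hp.pos
  have hq0 := hq.pos
  set N : ℝ → ℝ := fun r => nrm p' fun θ => g (circlePt r θ) with hN
  have hN0 : ∀ r, 0 ≤ N r := fun r => nrm_nonneg p' _
  have hNm : Measurable N := measurable_nrm_circle hgm p'
  set U := extremal p' q' g with hUdef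
  have hU : Measurable (Function.uncurry U) := measurable_extremal hp.symm.lt q' hgm
  have hUc : ∀ r ∈ Ioo 0 R, Continuous (U r) := fun r hr =>
    continuous_extremal hp.symm.lt q' hgd hr.1.le (hr.2.trans hR1)
  have hUn : ∀ r, nrm p (U r) = N r ^ (q' - 1) := nrm_extremal hp.symm hq.symm.lt g
  have hNR : ∀ r ∈ Ioo 0 R, N r ≤ N R := fun r hr =>
    nrm_circle_le_of_le hp.symm.lt hgd hr.1.le hr.2.le hR1
  have hq1 : 0 ≤ q' - 1 := by linarith [hq.symm.lt]
  have hUB : ∀ r ∈ Ioo 0 R, nrm p (U r) ≤ N R ^ (q' - 1) := fun r hr => by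
    rw [hUn]
    exact Real.rpow_le_rpow (hN0 r) (hNR r hr) hq1
  have hUq : ∀ r, nrm p (U r) ^ q = N r ^ q' := fun r => by
    rw [hUn, ← Real.rpow_mul (hN0 r), hq.symm.sub_one_mul_conj]
  have hd := summable_norm_projCoeff hω hpos hD hp hR0 hR1 hUc hUB
  set Φ : ℂ → ℂ := fun z => ∑' k, projCoeff ω U R k * z ^ k with hΦ
  have hle : ∀ z ∈ Metric.ball (0:ℂ) 1, ∀ k, ‖projCoeff ω U R k * z ^ k‖ ≤ ‖projCoeff ω U R k‖ :=
    fun z hz k => by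
      rw [norm_mul, norm_pow]
      exact mul_le_of_le_one_right (norm_nonneg _)
        (pow_le_one₀ (norm_nonneg _) (mem_ball_zero_iff.mp hz).le)
  have hsum : ∀ z ∈ Metric.ball (0:ℂ) 1, HasSum (fun k => projCoeff ω U R k * z ^ k) (Φ z) :=
    fun z hz => (Summable.of_norm_bounded hd (hle z hz)).hasSum
  have hΦX : InApq ω p q Φ := by
    refine inApq_of_bound hω hp0 hq0 (B := ∑' k, ‖projCoeff ω U R k‖) (differentiableOn_powerSeries fun x h0 h1 =>
      summable_mul_pow_of_summable hd h0 h1) (tsum_nonneg fun k => norm_nonneg (projCoeff ω U R k)) fun z hz => ?_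
    exact tsum_of_norm_bounded hd.hasSum (hle z hz)
  have hLΦ := hasSum_apply_powerSeries hω hp.lt hq.lt hL hM hM0 hd hΦX hsum
  have hconj : ∀ k, (((momentCoeff ω k)⁻¹ : ℝ) : ℂ) * (L fun z => z ^ k) =
      (starRingEnd ℂ) (taylorCoeff g k) := fun k => by
    have : ((momentCoeff ω k : ℝ) : ℂ) ≠ 0 := by exact_mod_cast (momentCoeff_pos hω hpos k).ne'
    rw [← hg k]
    push_cast
    field_simp
  have he : Summable fun k => ‖(((momentCoeff ω k)⁻¹ : ℝ) : ℂ) * (L fun z => z ^ k)‖ * R ^ k := by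
    simp_rw [hconj, RCLike.norm_conj]
    exact summable_taylorCoeff hgd hR0 hR1
  have hval := hLΦ.unique (hasSum_projCoeff_mul hω hp hU hUc hUB he)
  have hJ : L Φ = ((∫ r in Ioo 0 R, N r ^ q' ∂(wmeas ω) : ℝ) : ℂ) := by
    rw [hval, ← integral_complex_ofReal]
    refine setIntegral_congr_fun measurableSet_Ioo fun r hr => ?_
    simp_rw [hconj]
    exact tsum_conj_taylorCoeff_extremal hp.symm.lt hq.symm.pos hgd hr.1.le (hr.2.trans hR1)
  set J := ∫ r in Ioo 0 R, N r ^ q' ∂(wmeas ω) with hJdef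
  have hNq0 : ∀ r, 0 ≤ N r ^ q' := fun r => Real.rpow_nonneg (hN0 r) _
  have hJ0 : 0 ≤ J := integral_nonneg hNq0
  have h_int : Integrable (fun r => N r ^ q') ((wmeas ω).restrict (Ioo 0 R)) := by
    refine Integrable.of_bound (C := N R ^ q') (hNm.pow_const q').aestronglyMeasurable ?_
    filter_upwards [ae_restrict_mem measurableSet_Ioo] with r hr
    rw [Real.norm_of_nonneg (hNq0 r)]
    exact Real.rpow_le_rpow (hN0 r) (hNR r hr) hq.symm.pos.le
  have hJl : ∫⁻ r in Ioo 0 R, ENNReal.ofReal (N r ^ q') ∂(wmeas ω) = ENNReal.ofReal J :=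
    (ofReal_integral_eq_lintegral_ofReal h_int (ae_of_all _ hNq0)).symm
  have hΦn : (LpqNormE ω p q Φ).toReal ≤ C * J ^ (1 / q) := by
    have h := hP U R _ hU hR0 hR1 hUc hUB
    simp_rw [hUq] at h
    rw [hJl, ENNReal.ofReal_rpow_of_nonneg hJ0 (by positivity), ← ENNReal.ofReal_mul hC.le] at h
    exact ENNReal.toReal_le_of_le_ofReal (by positivity) h
  rw [hJl]
  refine ENNReal.ofReal_le_ofReal (rpow_le_of_le_mul_rpow hq hJ0 (by positivity) ?_)
  calc J = ‖L Φ‖ := by rw [hJ, Complex.norm_real, Real.norm_of_nonneg hJ0]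
    _ ≤ M * (LpqNormE ω p q Φ).toReal := hM Φ hΦX
    _ ≤ M * (C * J ^ (1 / q)) := by gcongr
    _ = M * C * J ^ (1 / q) := by ring

lemma LpqNormE_le_of_setLIntegral_le (hω : IsRadialWeight ω) (hp : 0 < p) (hq : 0 < q)
    (hgd : DifferentiableOn ℂ g (Metric.ball 0 1)) {K : ℝ} (hK : 0 ≤ K)
    (h : ∀ R : ℝ, 0 ≤ R → R < 1 → ∫⁻ r in Ioo 0 R,
      ENNReal.ofReal ((nrm p fun θ => g (circlePt r θ)) ^ q) ∂(wmeas ω) ≤ ENNReal.ofReal (K ^ q)) :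
    LpqNormE ω p q g ≤ ENNReal.ofReal K := by
  rw [LpqNormE_eq_nrm hω hp hq.le hgd]
  have hun : ⋃ n : ℕ, Ioo (0:ℝ) (1 - 1 / ((n:ℝ) + 1)) = Ioo 0 1 := by
    ext r
    simp only [mem_iUnion, mem_Ioo]
    constructor
    · rintro ⟨n, h0, h1⟩
      exact ⟨h0, h1.trans (by linarith [Nat.one_div_pos_of_nat (α := ℝ) (n := n)])⟩
    · rintro ⟨h0, h1⟩
      obtain ⟨n, hn⟩ := exists_nat_one_div_lt (sub_pos.mpr h1)
      exact ⟨n, h0, by linarith⟩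
  have hmono : Monotone fun n : ℕ => Ioo (0:ℝ) (1 - 1 / ((n:ℝ) + 1)) := fun m n hmn =>
    Ioo_subset_Ioo_right (sub_le_sub_left (Nat.one_div_le_one_div hmn) 1)
  have hres : (wmeas ω).restrict (Ioo 0 1) = wmeas ω := Measure.restrict_eq_self_of_ae_mem (ae_wmeas ω)
  have key : ∫⁻ r, ENNReal.ofReal ((nrm p fun θ => g (circlePt r θ)) ^ q) ∂(wmeas ω) ≤
      ENNReal.ofReal (K ^ q) := by
    rw [← hres, ← hun, setLIntegral_iUnion_of_directed _ hmono.directed_le]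
    refine iSup_le fun n => h _ ?_ ?_
    · rw [sub_nonneg, div_le_one (by positivity)]
      linarith [n.cast_nonneg (α := ℝ)]
    · linarith [Nat.one_div_pos_of_nat (α := ℝ) (n := n)]
  calc _ ≤ ENNReal.ofReal (K ^ q) ^ (1 / q) := ENNReal.rpow_le_rpow key (by positivity)
    _ = ENNReal.ofReal K := by
      rw [ENNReal.ofReal_rpow_of_nonneg (by positivity) (by positivity), ← Real.rpow_mul hK,
        mul_one_div_cancel hq.ne', Real.rpow_one]

lemma bound_nonneg (hω : IsRadialWeight ω) (hpos : ∀ r ∈ Set.Ico (0:ℝ) 1, 0 < omegaHat ω r)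
    (hp : 0 < p) (hq : 0 < q)
    (hM : ∀ f : ℂ → ℂ, InApq ω p q f → ‖L f‖ ≤ M * (LpqNormE ω p q f).toReal) : 0 ≤ M := by
  have hX := inApq_pow hω hp hq 0
  have h := (norm_nonneg _).trans (hM _ hX)
  refine nonneg_of_mul_nonneg_left h ?_
  have hone : ∀ r : ℝ, ‖nrm p fun θ => circlePt r θ ^ 0‖ ^ q = r ^ (2 * 0) := fun r => by
    have h1 : (nrm p fun θ => circlePt r θ ^ 0) ^ p = 1 := by
      rw [nrm_rpow hp]
      simp [probReal_univ]
    have h2 : (nrm p fun θ => circlePt r θ ^ 0) = 1 := by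
      rw [← Real.rpow_rpow_inv (nrm_nonneg p fun θ => circlePt r θ ^ 0) hp.ne', h1, Real.one_rpow]
    rw [h2]
    simp
  rw [toReal_LpqNormE hω hp hq hX]
  simp_rw [hone]
  rw [← momentCoeff_eq_wmeas hω]
  exact Real.rpow_pos_of_pos (momentCoeff_pos hω hpos 0) _

/-- Bounded functionals have an analytic symbol determined by their values on monomials. -/
lemma exists_symbol (hω : IsRadialWeight ω) (hpos : ∀ r ∈ Set.Ico (0:ℝ) 1, 0 < omegaHat ω r)
    (hD : InDhat ω) (hp : 0 < p) (hq : 0 < q)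
    (hM : ∀ f : ℂ → ℂ, InApq ω p q f → ‖L f‖ ≤ M * (LpqNormE ω p q f).toReal) (hM0 : 0 ≤ M) :
    ∃ g : ℂ → ℂ, Measurable g ∧ DifferentiableOn ℂ g (Metric.ball 0 1) ∧ ∀ k : ℕ,
      (starRingEnd ℂ) (taylorCoeff g k) * ((momentCoeff ω k : ℝ) : ℂ) = L fun z => z ^ k := by
  set b : ℕ → ℂ := fun k => (starRingEnd ℂ) ((L fun z => z ^ k) / ((momentCoeff ω k : ℝ) : ℂ))
    with hb
  have hs : ∀ x : ℝ, 0 ≤ x → x < 1 → Summable fun k => ‖b k‖ * x ^ k := fun x h0 h1 => by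
    refine Summable.of_nonneg_of_le (fun k => by positivity) (fun k => ?_)
      ((summable_pow_div_momentCoeff hω hpos hD h0 h1).mul_left
        (M * (wmeas ω univ ^ q⁻¹).toReal))
    have hm := momentCoeff_pos hω hpos k
    rw [hb, RCLike.norm_conj, norm_div, Complex.norm_real, Real.norm_of_nonneg hm.le, div_mul_eq_mul_div,
      ← mul_div_assoc]
    gcongr
    exact norm_apply_pow_le hω hp hq hM hM0 k
  have hd := differentiableOn_powerSeries hs
  have heq : EqOn ((Metric.ball (0:ℂ) 1).indicator fun z => ∑' k, b k * z ^ k)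
      (fun z => ∑' k, b k * z ^ k) (Metric.ball 0 1) := fun z hz => indicator_of_mem hz _
  refine ⟨_, measurable_indicator_ball hd, hd.congr heq, fun k => ?_⟩
  have hm : ((momentCoeff ω k : ℝ) : ℂ) ≠ 0 := by exact_mod_cast (momentCoeff_pos hω hpos k).ne'
  rw [taylorCoeff_powerSeries hs heq, hb, Complex.conj_conj, div_mul_cancel₀ _ hm]

end representation

/-- For `ω ∈ D̂` and `1<p,q<∞`, `(A^{p,q}_ω)* ≃ A^{p',q'}_ω` under the
`A²_ω`-pairing with equivalence of norms. -/
theorem duality_Apq_plarge_qlarge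
    (ω : ℝ → ℝ) (hω : IsRadialWeight ω)
    (hpos : ∀ r ∈ Set.Ico (0:ℝ) 1, 0 < omegaHat ω r)
    (hD : InDhat ω)
    (p q p' q' : ℝ) (hp : 1 < p) (hq : 1 < q)
    (hp' : p' = p / (p - 1)) (hq' : q' = q / (q - 1)) :
    ∃ C₁ > (0:ℝ), ∃ C₂ > (0:ℝ),
      (∀ g : ℂ → ℂ, InApq ω p' q' g → ∀ f : ℂ → ℂ, InApq ω p q f →
        ∃ l : ℂ, HasPairingC (momentCoeff ω) f g l ∧
          ‖l‖ ≤ C₂ * (LpqNormE ω p' q' g).toReal * (LpqNormE ω p q f).toReal) ∧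
      (∀ L : (ℂ → ℂ) → ℂ, IsLinearOn (InApq ω p q) L →
        (∃ M : ℝ, ∀ f : ℂ → ℂ, InApq ω p q f → ‖L f‖ ≤ M * (LpqNormE ω p q f).toReal) →
        ∃ g : ℂ → ℂ, InApq ω p' q' g ∧
          (∀ f : ℂ → ℂ, InApq ω p q f → HasPairingC (momentCoeff ω) f g (L f)) ∧
          (∀ M : ℝ, (∀ f : ℂ → ℂ, InApq ω p q f → ‖L f‖ ≤ M * (LpqNormE ω p q f).toReal) →
            (LpqNormE ω p' q' g).toReal ≤ C₁ * M)) := by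
  have hpc : p.HolderConjugate p' := (Real.holderConjugate_iff_eq_conjExponent hp).mpr hp'
  have hqc : q.HolderConjugate q' := (Real.holderConjugate_iff_eq_conjExponent hq).mpr hq'
  obtain ⟨C, hC, hP⟩ := exists_LpqNormE_projection_le hω hpos hD hpc hqc
  refine ⟨C, hC, 1, one_pos, fun g hg f hf =>
    ⟨_, hasPairingC_integral hω hpc hqc hf hg, ?_⟩, fun L hL hLb => ?_⟩
  · rw [one_mul]
    exact norm_integral_pairMean_le hω hpc hqc hf hg
  · obtain ⟨M, hM⟩ := hLb
    have hM0 := bound_nonneg hω hpos hpc.pos hqc.pos hM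
    obtain ⟨g, hgm, hgd, hg⟩ := exists_symbol hω hpos hD hpc.pos hqc.pos hM hM0
    have hle : ∀ M : ℝ, (∀ f : ℂ → ℂ, InApq ω p q f → ‖L f‖ ≤ M * (LpqNormE ω p q f).toReal) →
        0 ≤ M → LpqNormE ω p' q' g ≤ ENNReal.ofReal (M * C) := fun M hM hM0 =>
      LpqNormE_le_of_setLIntegral_le hω hpc.symm.pos hqc.symm.pos hgd (by positivity)
        fun R => setLIntegral_nrm_rpow_le hω hpos hD hpc hqc hC hP hL hM hM0 hgm hgd hg
    refine ⟨g, ⟨hgd, (hle M hM hM0).trans_lt ENNReal.ofReal_lt_top⟩,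
      fun f hf => hasPairingC_of_moments hω hp hq hL hM hM0 hg hf, fun M' hM' => ?_⟩
    have hM0' := bound_nonneg hω hpos hpc.pos hqc.pos hM'
    rw [mul_comm]
    exact ENNReal.toReal_le_of_le_ofReal (by positivity) (hle M' hM' hM0')
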